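/- arXiv:gr-qc/0002034 — 2 statements merged into one kernel-verified Lean document; each statement's English description precedes it below -/
import Mathlib

section
/- For every real α > 1 and every nonnegative integer n, there exist a real number a > 0 and functions f, A, C : [0, ∞) → ℝ that form an a-orbit of the mini-boson-star system with parameters a and α, defined for all x ≥ 0, which is globally regular (lim_{x→∞} M(x) exists and is finite and positive), and such that f has exactly n zeros in (0, ∞). -/
open Real Set Filter Topology MeasureTheory

noncomputable section

/-- The mini-boson-star ODE system for `f, A, C` on a set `s ⊆ (0, ∞)`
(prime denotes `d/dx`):
`(x² f'/C)' = (x²/(A C))·(1 − A C²)·f`,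
`A' = (1 − A)/x − x·(A f'² + A C² f² + f²)`,
`C' = (C/(x A))·(A − 1 + x² f²)`, with `A > 0` and `C > 0`. -/
def MiniBosonSystem (f A C : ℝ → ℝ) (s : Set ℝ) : Prop :=
  ∀ x ∈ s, 0 < x ∧ 0 < A x ∧ 0 < C x ∧
    DifferentiableAt ℝ f x ∧ DifferentiableAt ℝ (deriv f) x ∧
    DifferentiableAt ℝ A x ∧ DifferentiableAt ℝ C x ∧
    deriv (fun y => y ^ 2 * deriv f y / C y) x
      = x ^ 2 / (A x * C x) * (1 - A x * C x ^ 2) * f x ∧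
    deriv A x = (1 - A x) / x
      - x * (A x * deriv f x ^ 2 + A x * C x ^ 2 * f x ^ 2 + f x ^ 2) ∧
    deriv C x = C x / (x * A x) * (A x - 1 + x ^ 2 * f x ^ 2)

/-- A domain of the form `[0, x̄)` with `0 < x̄ ≤ ∞`. -/
def IsOrbitDomain (s : Set ℝ) : Prop :=
  s = Set.Ici (0 : ℝ) ∨ ∃ xbar > (0 : ℝ), s = Set.Ico 0 xbar

/-- An `a`-orbit of the mini-boson-star system with parameters `a, α` on the
domain `s = [0, x̄)`: a solution of the system on `s \ {0}`, continuous up to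
`x = 0` with `f` differentiable at `0`, satisfying `f 0 = a`, `f' 0 = 0`,
`A 0 = 1`, `C 0 = α`. -/
def IsAOrbit (f A C : ℝ → ℝ) (a α : ℝ) (s : Set ℝ) : Prop :=
  IsOrbitDomain s ∧
  MiniBosonSystem f A C (s \ {0}) ∧
  ContinuousWithinAt f s 0 ∧ ContinuousWithinAt A s 0 ∧ ContinuousWithinAt C s 0 ∧
  HasDerivWithinAt f 0 s 0 ∧
  f 0 = a ∧ A 0 = 1 ∧ C 0 = α

/-- The mass function `M(x) = x (1 − A x)/2`. -/
def massFn (A : ℝ → ℝ) (x : ℝ) : ℝ := x * (1 - A x) / 2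

/-- `θ` is the rotation function of the orbit with scalar field `f`:
`θ` is continuous on the domain, `θ 0 = 0`, and for every `x` in the domain
there is `ρ x > 0` with `f x = ρ x · cos (θ x)` and `f' x = −ρ x · sin (θ x)`. -/
def IsRotation (f θ : ℝ → ℝ) (s : Set ℝ) : Prop :=
  ContinuousOn θ s ∧ θ 0 = 0 ∧
  ∀ x ∈ s, ∃ ρ > (0 : ℝ), f x = ρ * Real.cos (θ x) ∧ deriv f x = -(ρ * Real.sin (θ x))

/-- An exponential weight turns the Volterra operator into a contraction. -/
lemma mul_integral_exp_le {l y : ℝ} (hl : 0 < l) :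
    y * ∫ θ in (0 : ℝ)..1, exp (l * (θ * y)) ≤ exp (l * y) / l := by
  have h : ∫ θ in (0 : ℝ)..1, (l * y) * exp (l * (θ * y)) = exp (l * (1 * y)) - exp (l * (0 * y)) := by
    apply intervalIntegral.integral_eq_sub_of_hasDerivAt (f := fun θ => exp (l * (θ * y)))
    · intro θ _
      have h1 : HasDerivAt (fun θ : ℝ => l * (θ * y)) (l * (1 * y)) θ :=
        ((hasDerivAt_id θ).mul_const y).const_mul l
      exact h1.exp.congr_deriv (by ring)
    · apply Continuous.intervalIntegrable
      fun_prop
  rw [intervalIntegral.integral_const_mul] at h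
  rw [le_div_iff₀ hl]
  have h2 : (y * ∫ θ in (0 : ℝ)..1, exp (l * (θ * y))) * l = exp (l * y) - 1 := by
    simp only [one_mul, zero_mul, mul_zero, exp_zero] at h
    linarith
  linarith

section Volterra

variable {E : Type*} [NormedAddCommGroup E] [NormedSpace ℝ E]

lemma volterra_continuous {F : ℝ → ℝ × ℝ × E → E}
    (hF : Continuous (fun p : ℝ × (ℝ × ℝ × E) => F p.1 p.2)) {Q : ℝ × ℝ → E} (hQ : Continuous Q) :
    Continuous fun p : ℝ × ℝ => p.2 • ∫ θ in (0 : ℝ)..1, F θ (p.1, θ * p.2, Q (p.1, θ * p.2)) := by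
  refine continuous_snd.smul ?_
  apply intervalIntegral.continuous_parametric_intervalIntegral_of_continuous'
  have : (Function.uncurry fun (x : ℝ × ℝ) (t : ℝ) => F t (x.1, t * x.2, Q (x.1, t * x.2)))
      = (fun p : ℝ × (ℝ × ℝ × E) => F p.1 p.2) ∘
        fun z : (ℝ × ℝ) × ℝ => (z.2, (z.1.1, z.2 * z.1.2, Q (z.1.1, z.2 * z.1.2))) := by
    ext z; rfl
  rw [this]
  exact hF.comp (by fun_prop)

/-- The difference of two Volterra integrals in the exponentially weighted norm. -/
lemma volterra_diff_le {F : ℝ → ℝ × ℝ × E → E} {L l d t y : ℝ} (hl : 0 < l) (hy : 0 ≤ y)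
    (hL0 : 0 ≤ L) (hd : 0 ≤ d)
    (hL : ∀ θ ∈ Icc (0 : ℝ) 1, ∀ t s q q', ‖F θ (t, s, q) - F θ (t, s, q')‖ ≤ L * ‖q - q'‖)
    {a b : ℝ → E} {σ : ℝ}
    (ha : IntervalIntegrable (fun θ => F θ (t, θ * σ, a θ)) volume 0 1)
    (hb : IntervalIntegrable (fun θ => F θ (t, θ * σ, b θ)) volume 0 1)
    (hab : ∀ θ ∈ Icc (0 : ℝ) 1, ‖a θ - b θ‖ ≤ exp (l * (θ * y)) * d) (hσ : |σ| = y) :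
    ‖σ • (∫ θ in (0 : ℝ)..1, F θ (t, θ * σ, a θ)) - σ • ∫ θ in (0 : ℝ)..1, F θ (t, θ * σ, b θ)‖
      ≤ exp (l * y) * (L / l * d) := by
  rw [← smul_sub, ← intervalIntegral.integral_sub ha hb, norm_smul, Real.norm_eq_abs, hσ]
  have h1 : ‖∫ θ in (0 : ℝ)..1, (F θ (t, θ * σ, a θ) - F θ (t, θ * σ, b θ))‖
      ≤ ∫ θ in (0 : ℝ)..1, exp (l * (θ * y)) * (L * d) := by
    apply intervalIntegral.norm_integral_le_of_norm_le zero_le_one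
    · refine Eventually.of_forall fun θ hθ => ?_
      have hθ' : θ ∈ Icc (0 : ℝ) 1 := ⟨hθ.1.le, hθ.2⟩
      refine (hL θ hθ' _ _ _ _).trans ?_
      calc L * ‖a θ - b θ‖ ≤ L * (exp (l * (θ * y)) * d) := by
            gcongr; exact hab θ hθ'
        _ = _ := by ring
    · apply Continuous.intervalIntegrable
      fun_prop
  rw [intervalIntegral.integral_mul_const] at h1
  calc y * _ ≤ y * ((∫ θ in (0 : ℝ)..1, exp (l * (θ * y))) * (L * d)) := by gcongr
    _ = (y * ∫ θ in (0 : ℝ)..1, exp (l * (θ * y))) * (L * d) := by ring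
    _ ≤ (exp (l * y) / l) * (L * d) := by
        gcongr; exact mul_integral_exp_le hl
    _ = _ := by ring

/-- A Volterra equation with a bounded Lipschitz right-hand side has a solution that depends
continuously on the parameter `t`. -/
theorem exists_volterra [CompleteSpace E] {F : ℝ → ℝ × ℝ × E → E}
    (hF : Continuous (fun p : ℝ × (ℝ × ℝ × E) => F p.1 p.2)) {B L : ℝ} (hL0 : 0 ≤ L)
    (hB : ∀ θ ∈ Icc (0 : ℝ) 1, ∀ x, ‖F θ x‖ ≤ B)
    (hL : ∀ θ ∈ Icc (0 : ℝ) 1, ∀ t s q q', ‖F θ (t, s, q) - F θ (t, s, q')‖ ≤ L * ‖q - q'‖) :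
    ∃ Q : ℝ × ℝ → E, Continuous Q ∧
      ∀ t y, Q (t, y) = y • ∫ θ in (0 : ℝ)..1, F θ (t, θ * y, Q (t, θ * y)) := by
  set l : ℝ := 2 * L + 1 with hl
  have hlpos : 0 < l := by positivity
  have hB0 : 0 ≤ B := (norm_nonneg _).trans (hB 0 (by simp) (0, 0, 0))
  let W : (ℝ × ℝ → E) → ℝ × ℝ → E := fun u p => exp (l * |p.2|) • u p
  have hW : ∀ u : ℝ × ℝ → E, Continuous u → Continuous (W u) := fun u hu => by
    simp only [W]; fun_prop
  let V : (ℝ × ℝ → E) → ℝ × ℝ → E := fun u p =>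
    p.2 • ∫ θ in (0 : ℝ)..1, F θ (p.1, θ * p.2, u (p.1, θ * p.2))
  have hV : ∀ u : ℝ × ℝ → E, Continuous u → Continuous (V u) := fun u hu =>
    volterra_continuous hF hu
  have hbd : ∀ u : ℝ × ℝ → E, ∀ p, ‖exp (-(l * |p.2|)) • V u p‖ ≤ B / l := by
    intro u p
    have h1 : ‖∫ θ in (0 : ℝ)..1, F θ (p.1, θ * p.2, u (p.1, θ * p.2))‖ ≤ B * |1 - 0| := by
      apply intervalIntegral.norm_integral_le_of_norm_le_const
      intro θ hθ
      rw [uIoc_of_le zero_le_one] at hθ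
      exact hB θ ⟨hθ.1.le, hθ.2⟩ _
    simp only [sub_zero, abs_one, mul_one] at h1
    rw [norm_smul, norm_smul, Real.norm_eq_abs, Real.norm_eq_abs, abs_exp, exp_neg]
    rw [inv_mul_le_iff₀ (exp_pos _)]
    have h2 := Real.add_one_le_exp (l * |p.2|)
    have h3 : |p.2| ≤ exp (l * |p.2|) / l := by rw [le_div_iff₀ hlpos]; linarith
    calc |p.2| * _ ≤ (exp (l * |p.2|) / l) * B := by gcongr
      _ = _ := by ring
  let T : BoundedContinuousFunction (ℝ × ℝ) E → BoundedContinuousFunction (ℝ × ℝ) E := fun u =>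
    BoundedContinuousFunction.ofNormedAddCommGroup (fun p => exp (-(l * |p.2|)) • V (W u) p)
      (by
        have := hV _ (hW _ u.continuous)
        fun_prop) (B / l) (hbd _)
  have hT : ContractingWith (1 / 2 : NNReal) T := by
    refine ⟨by rw [← NNReal.coe_lt_coe]; norm_num, LipschitzWith.of_dist_le_mul fun u w => ?_⟩
    have hhalf : ((1 / 2 : NNReal) : ℝ) = 1 / 2 := by norm_num
    rw [hhalf]
    rw [BoundedContinuousFunction.dist_le (by positivity)]
    intro p
    rw [dist_eq_norm]
    change ‖exp (-(l * |p.2|)) • V (W u) p - exp (-(l * |p.2|)) • V (W w) p‖ ≤ 1 / 2 * dist u w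
    rw [← smul_sub, norm_smul, Real.norm_eq_abs, abs_exp, exp_neg, inv_mul_le_iff₀ (exp_pos _)]
    have hii : ∀ u : ℝ × ℝ → E, Continuous u → IntervalIntegrable
        (fun θ => F θ (p.1, θ * p.2, u (p.1, θ * p.2))) volume 0 1 := by
      intro u hu
      apply Continuous.intervalIntegrable
      exact hF.comp (g := fun p : ℝ × (ℝ × ℝ × E) => F p.1 p.2)
        (f := fun θ => (θ, (p.1, θ * p.2, u (p.1, θ * p.2)))) (by fun_prop)
    have := volterra_diff_le (F := F) (t := p.1) (σ := p.2) (l := l) (d := dist u w) hlpos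
      (abs_nonneg p.2) hL0 dist_nonneg hL
      (hii _ (hW _ u.continuous)) (hii _ (hW _ w.continuous)) ?_ rfl
    · refine this.trans ?_
      have : L / l ≤ 1 / 2 := by rw [div_le_iff₀ hlpos]; linarith
      gcongr
    · intro θ hθ
      simp only [W]
      rw [← smul_sub, norm_smul, Real.norm_eq_abs, abs_exp, abs_mul, abs_of_nonneg hθ.1]
      gcongr
      rw [← dist_eq_norm]
      exact BoundedContinuousFunction.dist_coe_le_dist _
  set u := ContractingWith.fixedPoint T hT with hu
  have hfix : T u = u := hT.fixedPoint_isFixedPt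
  refine ⟨W u, hW _ u.continuous, fun t y => ?_⟩
  have h := congrArg (fun f : BoundedContinuousFunction (ℝ × ℝ) E => f (t, y)) hfix
  change exp (-(l * |y|)) • V (W u) (t, y) = u (t, y) at h
  change exp (l * |y|) • u (t, y) = V (W u) (t, y)
  rw [← h, smul_smul, ← exp_add, add_neg_cancel, exp_zero, one_smul]

/-- Uniqueness for the Volterra equation. -/
theorem volterra_unique {F : ℝ → ℝ × ℝ × E → E}
    (hF : Continuous (fun p : ℝ × (ℝ × ℝ × E) => F p.1 p.2)) {L : ℝ} (hL0 : 0 ≤ L)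
    (hL : ∀ θ ∈ Icc (0 : ℝ) 1, ∀ t s q q', ‖F θ (t, s, q) - F θ (t, s, q')‖ ≤ L * ‖q - q'‖)
    {t Y : ℝ} {a b : ℝ → E} (ha : ContinuousOn a (Icc 0 Y)) (hb : ContinuousOn b (Icc 0 Y))
    (hae : ∀ y ∈ Icc 0 Y, a y = y • ∫ θ in (0 : ℝ)..1, F θ (t, θ * y, a (θ * y)))
    (hbe : ∀ y ∈ Icc 0 Y, b y = y • ∫ θ in (0 : ℝ)..1, F θ (t, θ * y, b (θ * y))) :
    ∀ y ∈ Icc 0 Y, a y = b y := by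
  rcases lt_or_ge Y 0 with hY | hY
  · intro y hy; exact absurd (hy.1.trans hy.2) (not_le.2 hY)
  set l : ℝ := 2 * L + 1 with hl
  have hlpos : 0 < l := by positivity
  have hcont : ContinuousOn (fun y => exp (-(l * y)) * ‖a y - b y‖) (Icc 0 Y) := by fun_prop
  obtain ⟨y, hy, hmax⟩ := isCompact_Icc.exists_isMaxOn (nonempty_Icc.2 hY) hcont
  set d := exp (-(l * y)) * ‖a y - b y‖ with hd
  have hd0 : 0 ≤ d := by positivity
  have hmem : ∀ θ ∈ Icc (0 : ℝ) 1, θ * y ∈ Icc 0 Y := fun θ hθ =>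
    ⟨mul_nonneg hθ.1 hy.1, (mul_le_of_le_one_left hy.1 hθ.2).trans hy.2⟩
  have hii : ∀ a : ℝ → E, ContinuousOn a (Icc 0 Y) → IntervalIntegrable
      (fun θ => F θ (t, θ * y, a (θ * y))) volume 0 1 := by
    intro a ha
    apply ContinuousOn.intervalIntegrable
    rw [uIcc_of_le zero_le_one]
    have h1 : ContinuousOn (fun θ => a (θ * y)) (Icc 0 1) :=
      ha.comp (by fun_prop) hmem
    exact hF.comp_continuousOn (g := fun p : ℝ × (ℝ × ℝ × E) => F p.1 p.2)
      (f := fun θ => (θ, (t, θ * y, a (θ * y))))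
      (continuousOn_id.prodMk (continuousOn_const.prodMk
        ((continuousOn_id.mul continuousOn_const).prodMk h1)))
  have key := volterra_diff_le (F := F) (t := t) (σ := y) (l := l) (d := d) hlpos hy.1 hL0 hd0 hL
    (hii a ha) (hii b hb) ?_ (abs_of_nonneg hy.1)
  · rw [← hae y hy, ← hbe y hy] at key
    have h1 : d ≤ L / l * d := by
      rw [hd, exp_neg, inv_mul_le_iff₀ (exp_pos _)]
      rw [hd, exp_neg] at key
      exact key
    have h2 : L / l ≤ 1 / 2 := by rw [div_le_iff₀ hlpos]; linarith
    have h3 : d = 0 := by nlinarith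
    intro z hz
    have h4 : exp (-(l * z)) * ‖a z - b z‖ ≤ d := hmax hz
    have h5 : ‖a z - b z‖ ≤ 0 := by
      by_contra hc
      push Not at hc
      have := mul_pos (exp_pos (-(l * z))) hc
      linarith
    exact sub_eq_zero.1 (norm_le_zero_iff.1 h5)
  · intro θ hθ
    have h4 : exp (-(l * (θ * y))) * ‖a (θ * y) - b (θ * y)‖ ≤ d := hmax (hmem θ hθ)
    rw [exp_neg, inv_mul_le_iff₀ (exp_pos _)] at h4
    exact h4

end Volterra

/-- A `C¹` map on an open set agrees on a given compact subset with a bounded Lipschitz map. -/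
lemma exists_bounded_lipschitz_extension {X E : Type*} [NormedAddCommGroup X] [NormedSpace ℝ X]
    [FiniteDimensional ℝ X] [NormedAddCommGroup E] [NormedSpace ℝ E]
    {H : X → E} {Ω K : Set X} (hΩ : IsOpen Ω) (hH : ContDiffOn ℝ 1 H Ω) (hK : IsCompact K)
    (hKΩ : K ⊆ Ω) :
    ∃ G : X → E, ∃ B : ℝ, ∃ L : NNReal, Continuous G ∧ (∀ x, ‖G x‖ ≤ B) ∧ LipschitzWith L G ∧
      ∀ x ∈ K, G x = H x := by
  obtain ⟨K', hK', hKK', hK'Ω⟩ := exists_compact_between hK hΩ hKΩ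
  obtain ⟨χ, hχ0, hχ1, -⟩ := exists_contMDiffMap_zero_one_of_isClosed (n := 1)
    (modelWithCornersSelf ℝ X) (isOpen_interior (s := K')).isClosed_compl hK.isClosed
    (disjoint_compl_left_iff_subset.2 hKK')
  have hχ : ContDiff ℝ 1 χ := χ.contMDiff.contDiff
  have hts : tsupport χ ⊆ K' := by
    apply closure_minimal _ hK'.isClosed
    intro x hx
    by_contra hc
    exact hx (hχ0 fun hi => hc (interior_subset hi))
  have hcs : HasCompactSupport (fun x => χ x • H x) := by
    apply HasCompactSupport.smul_right
    exact hK'.of_isClosed_subset (isClosed_tsupport _) hts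
  have hG : ContDiff ℝ 1 (fun x => χ x • H x) := by
    rw [contDiff_iff_contDiffAt]
    intro x
    by_cases hx : x ∈ Ω
    · exact hχ.contDiffAt.smul (hH.contDiffAt (hΩ.mem_nhds hx))
    · have hx' : x ∉ tsupport χ := fun h => hx (hK'Ω (hts h))
      have : (fun x => χ x • H x) =ᶠ[𝓝 x] fun _ => 0 := by
        filter_upwards [notMem_tsupport_iff_eventuallyEq.1 hx'] with y hy
        simp [hy]
      exact contDiffAt_const.congr_of_eventuallyEq this
  obtain ⟨L, hL⟩ := ContDiff.lipschitzWith_of_hasCompactSupport hcs hG one_ne_zero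
  obtain ⟨B, hB⟩ := hcs.exists_bound_of_continuous hG.continuous
  refine ⟨_, B, L, hG.continuous, hB, hL, fun x hx => ?_⟩
  simp [hχ1 hx]

section Maximal

variable {E : Type*} [NormedAddCommGroup E] [NormedSpace ℝ E]

/-- `q` solves the Volterra equation with kernel `κ` and field `H` on `[0, Y]` inside `Ω`. -/
structure IsVolterraSol (κ : ℝ → E →L[ℝ] E) (H : ℝ × ℝ × E → E) (Ω : Set (ℝ × ℝ × E))
    (t Y : ℝ) (q : ℝ → E) : Prop where
  cont : ContinuousOn q (Icc 0 Y)
  mem : ∀ s ∈ Icc 0 Y, (t, s, q s) ∈ Ω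
  eq : ∀ s ∈ Icc 0 Y, q s = s • ∫ θ in (0 : ℝ)..1, κ θ (H (t, θ * s, q (θ * s)))

lemma mul_mem_Icc_of_mem {θ s Y : ℝ} (hθ : θ ∈ Icc (0 : ℝ) 1) (hs : s ∈ Icc 0 Y) :
    θ * s ∈ Icc 0 Y :=
  ⟨mul_nonneg hθ.1 hs.1, (mul_le_of_le_one_left hs.1 hθ.2).trans hs.2⟩

variable {κ : ℝ → E →L[ℝ] E} {H : ℝ × ℝ × E → E} {Ω : Set (ℝ × ℝ × E)} {t t₀ Y Z : ℝ} {q q' : ℝ → E}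

lemma IsVolterraSol.mono (h : IsVolterraSol κ H Ω t Y q) (hZ : Z ≤ Y) :
    IsVolterraSol κ H Ω t Z q := by
  have hs : Icc 0 Z ⊆ Icc 0 Y := Icc_subset_Icc_right hZ
  exact ⟨h.cont.mono hs, fun s h' => h.mem s (hs h'), fun s h' => h.eq s (hs h')⟩

lemma IsVolterraSol.isCompact_graph (h : IsVolterraSol κ H Ω t Y q) :
    IsCompact ((fun s => (t, s, q s)) '' Icc 0 Y) :=
  isCompact_Icc.image_of_continuousOn
    (continuousOn_const.prodMk (continuousOn_id.prodMk h.cont))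

lemma IsVolterraSol.graph_subset (h : IsVolterraSol κ H Ω t Y q) :
    (fun s => (t, s, q s)) '' Icc 0 Y ⊆ Ω := by
  rintro _ ⟨s, hs, rfl⟩
  exact h.mem s hs

/-- A continuous family that contains every solution with graph in the compact set `K`. -/
lemma exists_volterra_family [FiniteDimensional ℝ E] (hκ : Continuous κ)
    (hκ1 : ∀ θ ∈ Icc (0 : ℝ) 1, ‖κ θ‖ ≤ 1) (hΩ : IsOpen Ω) (hH : ContDiffOn ℝ 1 H Ω)
    {K : Set (ℝ × ℝ × E)} (hK : IsCompact K) (hKΩ : K ⊆ Ω) :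
    ∃ Q : ℝ × ℝ → E, Continuous Q ∧
      (∀ t Y, (∀ s ∈ Icc 0 Y, (t, s, Q (t, s)) ∈ K) →
        IsVolterraSol κ H Ω t Y fun s => Q (t, s)) ∧
      ∀ t Y q, IsVolterraSol κ H Ω t Y q → (∀ s ∈ Icc 0 Y, (t, s, q s) ∈ K) →
        ∀ s ∈ Icc 0 Y, q s = Q (t, s) := by
  obtain ⟨G, B, L, hG, hB, hL, hGH⟩ := exists_bounded_lipschitz_extension hΩ hH hK hKΩ
  have hB0 : 0 ≤ B := (norm_nonneg _).trans (hB 0)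
  set F : ℝ → ℝ × ℝ × E → E := fun θ x => κ θ (G x) with hFdef
  have hF : Continuous fun p : ℝ × (ℝ × ℝ × E) => F p.1 p.2 :=
    (hκ.comp continuous_fst).clm_apply (hG.comp continuous_snd)
  have hFB : ∀ θ ∈ Icc (0 : ℝ) 1, ∀ x, ‖F θ x‖ ≤ B := fun θ hθ x =>
    ((κ θ).le_opNorm _).trans <| (mul_le_mul (hκ1 θ hθ) (hB x) (norm_nonneg _) zero_le_one).trans
      (one_mul B).le
  have hFL : ∀ θ ∈ Icc (0 : ℝ) 1, ∀ t s q q',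
      ‖F θ (t, s, q) - F θ (t, s, q')‖ ≤ L * ‖q - q'‖ := by
    intro θ hθ t s q q'
    have h1 : ‖G (t, s, q) - G (t, s, q')‖ ≤ L * ‖q - q'‖ := by
      have := hL.dist_le_mul (t, s, q) (t, s, q')
      simpa [dist_eq_norm, Prod.norm_def] using this
    rw [hFdef]
    simp only
    rw [← map_sub]
    exact ((κ θ).le_opNorm _).trans <|
      (mul_le_mul (hκ1 θ hθ) h1 (norm_nonneg _) zero_le_one).trans (one_mul _).le
  obtain ⟨Q, hQ, hQe⟩ := exists_volterra hF L.2 hFB hFL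
  refine ⟨Q, hQ, fun t Y h => ⟨by fun_prop, fun s hs => hKΩ (h s hs), fun s hs => ?_⟩,
    fun t Y q hq hqK => ?_⟩
  · rw [hQe t s]
    congr 1
    apply intervalIntegral.integral_congr
    intro θ hθ
    rw [uIcc_of_le zero_le_one] at hθ
    simp only [hFdef]
    rw [hGH _ (h _ (mul_mem_Icc_of_mem hθ hs))]
  · refine volterra_unique hF L.2 hFL (t := t) hq.cont (b := fun s => Q (t, s)) (by fun_prop)
      (fun s hs => ?_) fun s _ => hQe t s
    rw [hq.eq s hs]
    congr 1
    apply intervalIntegral.integral_congr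
    intro θ hθ
    rw [uIcc_of_le zero_le_one] at hθ
    simp only [hFdef]
    rw [hGH _ (hqK _ (mul_mem_Icc_of_mem hθ hs))]

variable (κ H Ω t) in
/-- The times up to which the solution with parameter `t` exists. -/
def volterraDom : Set ℝ := {Y | 0 ≤ Y ∧ ∃ q, IsVolterraSol κ H Ω t Y q}

open Classical in
variable (κ H Ω t) in
/-- The maximal solution with parameter `t`, extended by zero. -/
def volterraSol (y : ℝ) : E :=
  if h : y ∈ volterraDom κ H Ω t then h.2.choose y else 0

lemma volterraDom_of_le (h : Y ∈ volterraDom κ H Ω t) (hZ : 0 ≤ Z) (hZY : Z ≤ Y) :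
    Z ∈ volterraDom κ H Ω t := by
  obtain ⟨-, q, hq⟩ := h
  exact ⟨hZ, q, hq.mono hZY⟩

lemma zero_mem_volterraDom (h0 : (t, 0, 0) ∈ Ω) : 0 ∈ volterraDom κ H Ω t := by
  refine ⟨le_rfl, fun _ => 0, continuousOn_const, fun s hs => ?_, fun s hs => ?_⟩ <;>
  · obtain rfl : s = 0 := le_antisymm hs.2 hs.1
    simp [h0]

variable [FiniteDimensional ℝ E] (hκ : Continuous κ)
    (hκ1 : ∀ θ ∈ Icc (0 : ℝ) 1, ‖κ θ‖ ≤ 1) (hΩ : IsOpen Ω) (hH : ContDiffOn ℝ 1 H Ω)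

include hκ hκ1 hΩ hH in
lemma IsVolterraSol.unique (h : IsVolterraSol κ H Ω t Y q) (h' : IsVolterraSol κ H Ω t Y q') :
    ∀ s ∈ Icc 0 Y, q s = q' s := by
  obtain ⟨Q, -, -, hQ⟩ := exists_volterra_family hκ hκ1 hΩ hH
    (h.isCompact_graph.union h'.isCompact_graph) (union_subset h.graph_subset h'.graph_subset)
  intro s hs
  rw [hQ t Y q h (fun s hs => Or.inl ⟨s, hs, rfl⟩) s hs,
    hQ t Y q' h' (fun s hs => Or.inr ⟨s, hs, rfl⟩) s hs]

include hκ hκ1 hΩ hH in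
/-- Solutions extend slightly to the right and to nearby parameters. -/
lemma IsVolterraSol.extend (h : IsVolterraSol κ H Ω t₀ Y q) (hY : 0 ≤ Y) :
    ∃ δ > 0, ∃ Q : ℝ × ℝ → E, Continuous Q ∧
      ∀ t, |t - t₀| < δ → IsVolterraSol κ H Ω t (Y + δ) fun s => Q (t, s) := by
  obtain ⟨K, hK, hgK, hKΩ⟩ := exists_compact_between h.isCompact_graph hΩ h.graph_subset
  obtain ⟨Q, hQ, hQ1, hQ2⟩ := exists_volterra_family hκ hκ1 hΩ hH hK hKΩ
  have hq : ∀ s ∈ Icc 0 Y, q s = Q (t₀, s) :=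
    hQ2 t₀ Y q h fun s hs => interior_subset (hgK ⟨s, hs, rfl⟩)
  let U : Set (ℝ × ℝ) := (fun p : ℝ × ℝ => (p.1, p.2, Q p)) ⁻¹' interior K
  have hU : IsOpen U := isOpen_interior.preimage (by fun_prop)
  obtain ⟨u, v, hu, hv, h1, h2, h3⟩ := generalized_tube_lemma (isCompact_singleton (x := t₀))
    (isCompact_Icc (a := (0 : ℝ)) (b := Y)) hU (by
      rintro ⟨a, s⟩ ⟨ha, hs⟩
      obtain rfl : a = t₀ := ha
      change (a, s, Q (a, s)) ∈ interior K
      rw [← hq s hs]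
      exact hgK ⟨s, hs, rfl⟩)
  obtain ⟨δ₁, hδ₁, hb1⟩ := Metric.isOpen_iff.1 hu t₀ (h1 rfl)
  obtain ⟨δ₂, hδ₂, hb2⟩ := Metric.isOpen_iff.1 hv Y (h2 ⟨hY, le_rfl⟩)
  refine ⟨min δ₁ (δ₂ / 2), by positivity, Q, hQ, fun t ht => hQ1 t _ fun s hs => ?_⟩
  refine interior_subset (h3 (a := (t, s)) ⟨hb1 ?_, ?_⟩)
  · rw [Metric.mem_ball, Real.dist_eq]
    exact ht.trans_le (min_le_left _ _)
  · change s ∈ v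
    rcases le_or_gt s Y with hsY | hsY
    · exact h2 ⟨hs.1, hsY⟩
    · apply hb2
      have := min_le_right δ₁ (δ₂ / 2)
      have := hs.2
      rw [Metric.mem_ball, Real.dist_eq, abs_of_pos (by linarith)]
      linarith

include hκ hκ1 hΩ hH in
lemma IsVolterraSol.eq_volterraSol (h : IsVolterraSol κ H Ω t Y q) :
    ∀ s ∈ Icc 0 Y, volterraSol κ H Ω t s = q s := by
  intro s hs
  have hd : s ∈ volterraDom κ H Ω t := ⟨hs.1, q, h.mono hs.2⟩
  rw [volterraSol, dif_pos hd]
  exact hd.2.choose_spec.unique hκ hκ1 hΩ hH (h.mono hs.2) s ⟨hs.1, le_rfl⟩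

include hκ hκ1 hΩ hH in
lemma isVolterraSol_volterraSol (h : Y ∈ volterraDom κ H Ω t) :
    IsVolterraSol κ H Ω t Y (volterraSol κ H Ω t) := by
  obtain ⟨hY, q, hq⟩ := h
  have he := hq.eq_volterraSol hκ hκ1 hΩ hH
  refine ⟨hq.cont.congr he, fun s hs => by rw [he s hs]; exact hq.mem s hs, fun s hs => ?_⟩
  rw [he s hs, hq.eq s hs]
  congr 1
  apply intervalIntegral.integral_congr
  intro θ hθ
  rw [uIcc_of_le zero_le_one] at hθ
  simp only
  rw [he _ (mul_mem_Icc_of_mem hθ hs)]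

include hκ hκ1 hΩ hH in
/-- Near a time of existence, the maximal solution is jointly continuous. -/
lemma volterraDom_extend (h : Y ∈ volterraDom κ H Ω t₀) :
    ∃ δ > 0, ∃ Q : ℝ × ℝ → E, Continuous Q ∧ ∀ t, |t - t₀| < δ → Y + δ ∈ volterraDom κ H Ω t ∧
      ∀ s ∈ Icc 0 (Y + δ), volterraSol κ H Ω t s = Q (t, s) := by
  obtain ⟨hY, q, hq⟩ := h
  obtain ⟨δ, hδ, Q, hQ, h1⟩ := hq.extend hκ hκ1 hΩ hH hY
  exact ⟨δ, hδ, Q, hQ, fun t ht => ⟨⟨by positivity, _, h1 t ht⟩,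
    (h1 t ht).eq_volterraSol hκ hκ1 hΩ hH⟩⟩

include hκ hκ1 hΩ hH in
/-- A solution that stays in a compact subset of the domain is global. -/
lemma volterraDom_eq_Ici (h0 : (t, 0, 0) ∈ Ω) {K : Set (ℝ × ℝ × E)} (hK : IsCompact K)
    (hKΩ : K ⊆ Ω) (hmem : ∀ Y ∈ volterraDom κ H Ω t, (t, Y, volterraSol κ H Ω t Y) ∈ K) :
    volterraDom κ H Ω t = Ici 0 := by
  refine Subset.antisymm (fun y hy => hy.1) fun y hy => ?_
  by_contra hc
  obtain ⟨Q, hQ, hQ1, hQ2⟩ := exists_volterra_family hκ hκ1 hΩ hH hK hKΩ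
  set D := volterraDom κ H Ω t with hD
  have hD0 : (0 : ℝ) ∈ D := zero_mem_volterraDom h0
  have hbd : ∀ Y ∈ D, Y ≤ y := fun Y hY => by
    by_contra h
    exact hc (volterraDom_of_le hY hy (le_of_not_ge h))
  have hbdd : BddAbove D := ⟨y, hbd⟩
  set X := sSup D with hX
  have hext : ∀ Y ∈ D, ∃ δ > 0, Y + δ ∈ D := fun Y hY => by
    obtain ⟨δ, hδ, _, _, h⟩ := volterraDom_extend hκ hκ1 hΩ hH hY
    exact ⟨δ, hδ, (h t (by simpa)).1⟩
  have hX0 : 0 < X := by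
    obtain ⟨δ, hδ, h⟩ := hext 0 hD0
    have := le_csSup hbdd h
    linarith
  have hin : ∀ s ∈ Ico 0 X, (t, s, Q (t, s)) ∈ K := fun s hs => by
    obtain ⟨Y, hY, hsY⟩ := exists_lt_of_lt_csSup ⟨0, hD0⟩ hs.2
    have hsD : s ∈ D := volterraDom_of_le hY hs.1 hsY.le
    rw [← hQ2 t s (volterraSol κ H Ω t) (isVolterraSol_volterraSol hκ hκ1 hΩ hH hsD)
      (fun r hr => hmem r (volterraDom_of_le hsD hr.1 hr.2)) s ⟨hs.1, le_rfl⟩]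
    exact hmem s hsD
  have hcl : ∀ s ∈ Icc 0 X, (t, s, Q (t, s)) ∈ K := by
    have hcont : Continuous fun s => (t, s, Q (t, s)) := by fun_prop
    have h1 : closure (Ico 0 X) ⊆ (fun s => (t, s, Q (t, s))) ⁻¹' K :=
      closure_minimal hin (hK.isClosed.preimage hcont)
    rw [closure_Ico hX0.ne] at h1
    exact h1
  obtain ⟨δ, hδ, h⟩ := hext X ⟨hX0.le, _, hQ1 t X hcl⟩
  have := le_csSup hbdd h
  linarith

end Maximal

/-- Phase space of the desingularised system: `(g - 1, C - α, (1 - A) / y, v / y ^ 2)`. -/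
abbrev BosonPhase : Type := ℝ × ℝ × ℝ × ℝ

/-- The region where the metric functions are positive. -/
def bosonRegion (α : ℝ) : Set (ℝ × ℝ × BosonPhase) :=
  {x | 0 < 1 - x.2.1 * x.2.2.2.2.1 ∧ 0 < α + x.2.2.2.1}

/-- The right-hand side of the desingularised system at parameter `x.1` and radius `x.2.1`. -/
def bosonField (α : ℝ) (x : ℝ × ℝ × BosonPhase) : BosonPhase :=
  ((1 - x.1) * x.2.2.2.2.2 * (α + x.2.2.2.1),
   (α + x.2.2.2.1) * (x.1 * x.2.1 * (1 + x.2.2.1) ^ 2 - x.2.2.2.2.1) / (1 - x.2.1 * x.2.2.2.2.1),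
   x.1 * ((1 - x.1) * (1 - x.2.1 * x.2.2.2.2.1) * (x.2.2.2.2.2 * (α + x.2.2.2.1)) ^ 2
     + ((1 - x.2.1 * x.2.2.2.2.1) * (α + x.2.2.2.1) ^ 2 + 1) * (1 + x.2.2.1) ^ 2),
   (1 + x.2.2.1) / ((1 - x.2.1 * x.2.2.2.2.1) * (α + x.2.2.2.1)) -
     (1 + x.2.2.1) * (α + x.2.2.2.1))

/-- The singular weight: the last two equations carry a factor `θ ^ 2`. -/
def bosonKernel (θ : ℝ) : BosonPhase →L[ℝ] BosonPhase :=
  (ContinuousLinearMap.id ℝ ℝ).prodMap ((ContinuousLinearMap.id ℝ ℝ).prodMap 0) +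
    θ ^ 2 • (0 : ℝ →L[ℝ] ℝ).prodMap ((0 : ℝ →L[ℝ] ℝ).prodMap (ContinuousLinearMap.id ℝ (ℝ × ℝ)))

lemma bosonKernel_apply (θ : ℝ) (q : BosonPhase) :
    bosonKernel θ q = (q.1, q.2.1, θ ^ 2 * q.2.2.1, θ ^ 2 * q.2.2.2) := by
  obtain ⟨a, b, c, d⟩ := q
  simp [bosonKernel]

lemma continuous_bosonKernel : Continuous bosonKernel := by
  unfold bosonKernel
  fun_prop

lemma norm_bosonKernel_le : ∀ θ ∈ Icc (0 : ℝ) 1, ‖bosonKernel θ‖ ≤ 1 := by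
  intro θ hθ
  apply ContinuousLinearMap.opNorm_le_bound _ zero_le_one
  intro q
  have h1 : |θ ^ 2| ≤ 1 := by
    rw [abs_of_nonneg (by positivity)]
    exact pow_le_one₀ hθ.1 hθ.2
  have h2 : ∀ r : ℝ, |θ ^ 2 * r| ≤ |r| := fun r => by
    rw [abs_mul]
    exact mul_le_of_le_one_left (abs_nonneg _) h1
  rw [bosonKernel_apply, one_mul]
  simp only [Prod.norm_def, Real.norm_eq_abs]
  exact max_le_max le_rfl (max_le_max le_rfl (max_le_max (h2 _) (h2 _)))

lemma isOpen_bosonRegion (α : ℝ) : IsOpen (bosonRegion α) := by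
  rw [bosonRegion, ofPred_and]
  refine IsOpen.inter (isOpen_lt ?_ ?_) (isOpen_lt ?_ ?_) <;> fun_prop

lemma contDiffOn_bosonField (α : ℝ) : ContDiffOn ℝ 1 (bosonField α) (bosonRegion α) := by
  have h1 : ∀ x ∈ bosonRegion α, 1 - x.2.1 * x.2.2.2.2.1 ≠ 0 := fun x hx => hx.1.ne'
  have h2 : ∀ x ∈ bosonRegion α, (1 - x.2.1 * x.2.2.2.2.1) * (α + x.2.2.2.1) ≠ 0 :=
    fun x hx => (mul_pos hx.1 hx.2).ne'
  unfold bosonField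
  refine ContDiffOn.prodMk (by fun_prop) (ContDiffOn.prodMk ?_ (ContDiffOn.prodMk (by fun_prop) ?_))
  · exact ContDiffOn.div (by fun_prop) (by fun_prop) h1
  · exact (ContDiffOn.div (by fun_prop) (by fun_prop) h2).sub (by fun_prop)

/-- The weighted mean `y ∫₀¹ θ ^ k h (θ y) dθ` as a primitive. -/
lemma pow_mul_volterra_eq (k : ℕ) (h : ℝ → ℝ) (y : ℝ) :
    y ^ k * (y * ∫ θ in (0 : ℝ)..1, θ ^ k * h (θ * y)) = ∫ s in (0 : ℝ)..y, s ^ k * h s := by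
  have h1 := intervalIntegral.smul_integral_comp_mul_right (a := 0) (b := 1)
    (fun s => s ^ k * h s) y
  rw [zero_mul, one_mul, smul_eq_mul] at h1
  rw [← h1, mul_left_comm, ← intervalIntegral.integral_const_mul]
  congr 2
  ext θ
  ring

lemma hasDerivAt_of_volterra {k : ℕ} {q h : ℝ → ℝ} {Y y : ℝ} (hh : ContinuousOn h (Icc 0 Y))
    (hq : ∀ s ∈ Icc 0 Y, q s = s * ∫ θ in (0 : ℝ)..1, θ ^ k * h (θ * s)) (hy : y ∈ Ioo 0 Y) :
    HasDerivAt (fun s => s ^ k * q s) (y ^ k * h y) y := by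
  have hnhds : Icc 0 Y ∈ 𝓝 y := Icc_mem_nhds hy.1 hy.2
  have h2 : ContinuousOn (fun s => s ^ k * h s) (Icc 0 Y) := by fun_prop
  have h3 : HasDerivAt (fun s => ∫ r in (0 : ℝ)..s, r ^ k * h r) (y ^ k * h y) y := by
    apply intervalIntegral.integral_hasDerivAt_right
    · apply ContinuousOn.intervalIntegrable
      rw [uIcc_of_le hy.1.le]
      exact h2.mono (Icc_subset_Icc_right hy.2.le)
    · exact h2.stronglyMeasurableAtFilter_nhdsWithin measurableSet_Icc y |>.filter_mono
        (by rw [nhdsWithin_eq_nhds.2 hnhds])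
    · exact h2.continuousAt hnhds
  apply h3.congr_of_eventuallyEq
  filter_upwards [hnhds] with s hs
  rw [hq s hs, pow_mul_volterra_eq]

lemma hasDerivWithinAt_zero_of_volterra {q h : ℝ → ℝ} {Y : ℝ} (hY : 0 < Y)
    (hh : ContinuousOn h (Icc 0 Y))
    (hq : ∀ s ∈ Icc 0 Y, q s = s * ∫ θ in (0 : ℝ)..1, h (θ * s)) :
    HasDerivWithinAt q (h 0) (Ici 0) 0 := by
  have h3 : HasDerivWithinAt (fun s => ∫ r in (0 : ℝ)..s, h r) (h 0) (Icc 0 Y) 0 := by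
    have : Fact ((0 : ℝ) ∈ Icc 0 Y) := ⟨⟨le_rfl, hY.le⟩⟩
    apply intervalIntegral.integral_hasDerivWithinAt_right
    · simp
    · exact hh.stronglyMeasurableAtFilter_nhdsWithin measurableSet_Icc 0
    · exact hh 0 this.out
  have h4 : HasDerivWithinAt q (h 0) (Icc 0 Y) 0 := by
    apply h3.congr
    · intro s hs
      have := pow_mul_volterra_eq 0 h s
      simp only [pow_zero, one_mul] at this
      rw [hq s hs, this]
    · simp [hq 0 ⟨le_rfl, hY.le⟩]
  exact h4.mono_of_mem_nhdsWithin (Icc_mem_nhdsGE hY)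

lemma monotoneOn_of_hasDerivAt_nonneg {S : Set ℝ} (hS : S.OrdConnected) {f f' : ℝ → ℝ}
    (h : ∀ x ∈ S, HasDerivAt f (f' x) x) (h0 : ∀ x ∈ S, 0 ≤ f' x) : MonotoneOn f S :=
  monotoneOn_of_hasDerivWithinAt_nonneg hS.convex
    (fun x hx => (h x hx).continuousAt.continuousWithinAt)
    (fun x hx => (h x (interior_subset hx)).hasDerivWithinAt) fun x hx => h0 x (interior_subset hx)

lemma antitoneOn_of_hasDerivAt_nonpos {S : Set ℝ} (hS : S.OrdConnected) {f f' : ℝ → ℝ}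
    (h : ∀ x ∈ S, HasDerivAt f (f' x) x) (h0 : ∀ x ∈ S, f' x ≤ 0) : AntitoneOn f S :=
  antitoneOn_of_hasDerivWithinAt_nonpos hS.convex
    (fun x hx => (h x hx).continuousAt.continuousWithinAt)
    (fun x hx => (h x (interior_subset hx)).hasDerivWithinAt) fun x hx => h0 x (interior_subset hx)

lemma le_mul_exp_of_hasDerivAt_le {S : Set ℝ} (hS : S.OrdConnected) {f f' : ℝ → ℝ} {k : ℝ}
    (h : ∀ x ∈ S, HasDerivAt f (f' x) x) (h0 : ∀ x ∈ S, f' x ≤ k * f x) {a b : ℝ} (ha : a ∈ S)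
    (hb : b ∈ S) (hab : a ≤ b) : f b ≤ f a * exp (k * (b - a)) := by
  have h1 : AntitoneOn (fun x => f x * exp (-(k * x))) S := by
    apply antitoneOn_of_hasDerivAt_nonpos hS
      (f' := fun x => f' x * exp (-(k * x)) + f x * (exp (-(k * x)) * -(k * 1)))
    · intro x hx
      exact (h x hx).mul ((hasDerivAt_id x).const_mul k).neg.exp
    · intro x hx
      have := h0 x hx
      have h2 := exp_pos (-(k * x))
      nlinarith
  have h2 := h1 ha hb hab
  simp only at h2
  have h3 : exp (k * (b - a)) = exp (-(k * a)) * exp (k * b) := by rw [← exp_add]; ring_nf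
  have h4 : f b = f b * exp (-(k * b)) * exp (k * b) := by
    rw [mul_assoc, ← exp_add, neg_add_cancel, exp_zero, mul_one]
  rw [h3, h4, ← mul_assoc]
  gcongr

lemma le_mul_exp_of_le_hasDerivAt {S : Set ℝ} (hS : S.OrdConnected) {f f' : ℝ → ℝ} {k : ℝ}
    (h : ∀ x ∈ S, HasDerivAt f (f' x) x) (h0 : ∀ x ∈ S, -(k * f x) ≤ f' x) {a b : ℝ} (ha : a ∈ S)
    (hb : b ∈ S) (hab : a ≤ b) : f a ≤ f b * exp (k * (b - a)) := by
  have h1 := le_mul_exp_of_hasDerivAt_le hS (f := fun x => -f x) (f' := fun x => -f' x) (k := -k)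
    (fun x hx => (h x hx).neg) (fun x hx => by have := h0 x hx; linarith) ha hb hab
  have h2 : exp (k * (b - a)) * exp (-k * (b - a)) = 1 := by
    rw [← exp_add]; simp
  have h3 := exp_pos (k * (b - a))
  have h4 := mul_le_mul_of_nonneg_right h1 h3.le
  have h5 : -f a * exp (-k * (b - a)) * exp (k * (b - a))
    = -f a * (exp (k * (b - a)) * exp (-k * (b - a))) := by ring
  rw [h5, h2] at h4
  linarith

/-- Orbits of the rescaled mini-boson-star system, written as a first order system for the
scalar field `g`, the momentum `v = y ^ 2 g' / (ε C)` and the metric functions `A`, `C`. -/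
structure BosonOrbit (α ε μ : ℝ) (S : Set ℝ) (g v A C : ℝ → ℝ) : Prop where
  ordConnected : S.OrdConnected
  pos : ∀ y ∈ S, 0 < y
  A_pos : ∀ y ∈ S, 0 < A y
  C_pos : ∀ y ∈ S, 0 < C y
  A_le : ∀ y ∈ S, A y ≤ 1
  A_lt : 0 < μ → ∀ y ∈ S, A y < 1
  AC_le : ∀ y ∈ S, A y * C y ≤ α
  ne : ∀ y ∈ S, g y ≠ 0 ∨ v y ≠ 0
  hasDerivAt_g : ∀ y ∈ S, HasDerivAt g (ε * v y * C y / y ^ 2) y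
  hasDerivAt_v : ∀ y ∈ S, HasDerivAt v (y ^ 2 * (1 - A y * C y ^ 2) * g y / (A y * C y)) y
  hasDerivAt_A : ∀ y ∈ S, HasDerivAt A ((1 - A y) / y - y * μ *
    (ε * A y * (v y * C y / y ^ 2) ^ 2 + (A y * C y ^ 2 + 1) * g y ^ 2)) y
  hasDerivAt_C : ∀ y ∈ S, HasDerivAt C (C y * (A y - 1 + μ * y ^ 2 * g y ^ 2) / (y * A y)) y

section

variable (α t : ℝ)

/-- The radii up to which the orbit with parameter `t` exists. -/
def bosonDom : Set ℝ := volterraDom bosonKernel (bosonField α) (bosonRegion α) t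

/-- The maximal solution of the desingularised system. -/
def bosonSol (y : ℝ) : BosonPhase := volterraSol bosonKernel (bosonField α) (bosonRegion α) t y

/-- The scalar field of the orbit with parameter `t`. -/
def bosonG (y : ℝ) : ℝ := 1 + (bosonSol α t y).1

/-- The momentum of the orbit with parameter `t`. -/
def bosonV (y : ℝ) : ℝ := y ^ 2 * (bosonSol α t y).2.2.2

/-- The metric function `A` of the orbit with parameter `t`. -/
def bosonA (y : ℝ) : ℝ := 1 - y * (bosonSol α t y).2.2.1

/-- The metric function `C` of the orbit with parameter `t`. -/
def bosonC (y : ℝ) : ℝ := α + (bosonSol α t y).2.1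

end

section

variable {α t Y y : ℝ}

lemma zero_mem_bosonDom (hα : 0 < α) : 0 ∈ bosonDom α t :=
  zero_mem_volterraDom ⟨by simp, by simpa using hα⟩

lemma bosonDom_of_le (h : Y ∈ bosonDom α t) (h0 : 0 ≤ y) (hy : y ≤ Y) : y ∈ bosonDom α t :=
  volterraDom_of_le h h0 hy

lemma bosonDom_extend {t₀ : ℝ} (h : Y ∈ bosonDom α t₀) :
    ∃ δ > 0, ∃ Q : ℝ × ℝ → BosonPhase, Continuous Q ∧ ∀ t, |t - t₀| < δ →
      Y + δ ∈ bosonDom α t ∧ ∀ s ∈ Icc 0 (Y + δ), bosonSol α t s = Q (t, s) :=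
  volterraDom_extend continuous_bosonKernel norm_bosonKernel_le (isOpen_bosonRegion α)
    (contDiffOn_bosonField α) h

lemma exists_gt_mem_bosonDom (h : Y ∈ bosonDom α t) : ∃ Z ∈ bosonDom α t, Y < Z := by
  obtain ⟨δ, hδ, _, _, h1⟩ := bosonDom_extend h
  exact ⟨Y + δ, (h1 t (by simpa)).1, by linarith⟩

lemma isVolterraSol_bosonSol (h : Y ∈ bosonDom α t) :
    IsVolterraSol bosonKernel (bosonField α) (bosonRegion α) t Y (bosonSol α t) :=
  isVolterraSol_volterraSol continuous_bosonKernel norm_bosonKernel_le (isOpen_bosonRegion α)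
    (contDiffOn_bosonField α) h

/-- The field along the orbit. -/
def bosonRate (α t s : ℝ) : BosonPhase := bosonField α (t, s, bosonSol α t s)

lemma continuousOn_bosonRate (h : Y ∈ bosonDom α t) :
    ContinuousOn (bosonRate α t) (Icc 0 Y) := by
  have hs := isVolterraSol_bosonSol h
  exact (contDiffOn_bosonField α).continuousOn.comp
    (continuousOn_const.prodMk (continuousOn_id.prodMk hs.cont)) hs.mem

lemma bosonSol_eq (h : Y ∈ bosonDom α t) : ∀ s ∈ Icc 0 Y,
    (bosonSol α t s).1 = s * (∫ θ in (0 : ℝ)..1, θ ^ 0 * (bosonRate α t (θ * s)).1) ∧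
    (bosonSol α t s).2.1 = s * (∫ θ in (0 : ℝ)..1, θ ^ 0 * (bosonRate α t (θ * s)).2.1) ∧
    (bosonSol α t s).2.2.1 = s * (∫ θ in (0 : ℝ)..1, θ ^ 2 * (bosonRate α t (θ * s)).2.2.1) ∧
    (bosonSol α t s).2.2.2 = s * (∫ θ in (0 : ℝ)..1, θ ^ 2 * (bosonRate α t (θ * s)).2.2.2) := by
  intro s hs
  have hsol := isVolterraSol_bosonSol h
  have hii : IntervalIntegrable (fun θ => bosonKernel θ (bosonRate α t (θ * s))) volume 0 1 := by
    apply ContinuousOn.intervalIntegrable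
    rw [uIcc_of_le zero_le_one]
    apply continuous_bosonKernel.continuousOn.clm_apply
    exact (continuousOn_bosonRate h).comp (by fun_prop) fun θ hθ => mul_mem_Icc_of_mem hθ hs
  have hpr : ∀ l : BosonPhase →L[ℝ] ℝ, l (bosonSol α t s)
      = s * ∫ θ in (0 : ℝ)..1, l (bosonKernel θ (bosonRate α t (θ * s))) := by
    intro l
    rw [l.intervalIntegral_comp_comm hii, ← smul_eq_mul, ← map_smul]
    exact congrArg l (hsol.eq s hs)
  simp only [bosonKernel_apply] at hpr
  refine ⟨?_, ?_, ?_, ?_⟩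
  · simpa using hpr (.fst ℝ _ _)
  · simpa using hpr ((ContinuousLinearMap.fst ℝ _ _).comp (.snd ℝ _ _))
  · simpa using hpr ((ContinuousLinearMap.fst ℝ _ _).comp
      ((ContinuousLinearMap.snd ℝ _ _).comp (.snd ℝ _ _)))
  · simpa using hpr ((ContinuousLinearMap.snd ℝ _ _).comp
      ((ContinuousLinearMap.snd ℝ _ _).comp (.snd ℝ _ _)))

lemma bosonA_pos (h : y ∈ bosonDom α t) : 0 < bosonA α t y :=
  ((isVolterraSol_bosonSol h).mem y ⟨h.1, le_rfl⟩).1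

lemma bosonC_pos (h : y ∈ bosonDom α t) : 0 < bosonC α t y :=
  ((isVolterraSol_bosonSol h).mem y ⟨h.1, le_rfl⟩).2

lemma bosonSol_zero (hα : 0 < α) : bosonSol α t 0 = 0 := by
  have := (isVolterraSol_bosonSol (zero_mem_bosonDom (t := t) hα)).eq 0 (by simp)
  rw [this, zero_smul]

lemma bosonRate_eq (s : ℝ) : bosonRate α t s =
    ((1 - t) * (bosonSol α t s).2.2.2 * bosonC α t s,
     bosonC α t s * (t * s * bosonG α t s ^ 2 - (bosonSol α t s).2.2.1) / bosonA α t s,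
     t * ((1 - t) * bosonA α t s * ((bosonSol α t s).2.2.2 * bosonC α t s) ^ 2
       + (bosonA α t s * bosonC α t s ^ 2 + 1) * bosonG α t s ^ 2),
     bosonG α t s / (bosonA α t s * bosonC α t s) - bosonG α t s * bosonC α t s) := rfl

/-- Continuity up to the centre of all components. -/
lemma continuousOn_bosonSol (h : Y ∈ bosonDom α t) : ContinuousOn (bosonSol α t) (Icc 0 Y) :=
  (isVolterraSol_bosonSol h).cont

lemma hasDerivAt_bosonG (h : y ∈ bosonDom α t) (hy : 0 < y) :
    HasDerivAt (bosonG α t) ((1 - t) * bosonV α t y * bosonC α t y / y ^ 2) y := by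
  obtain ⟨Z, hZ, hyZ⟩ := exists_gt_mem_bosonDom h
  have h1 := hasDerivAt_of_volterra (k := 0) (h := fun s => (bosonRate α t s).1)
    (q := fun s => (bosonSol α t s).1)
    (continuousOn_bosonRate hZ).fst (fun s hs => (bosonSol_eq hZ s hs).1) ⟨hy, hyZ⟩
  simp only [pow_zero, one_mul] at h1
  refine (h1.const_add 1).congr_deriv ?_
  simp only [bosonRate_eq, bosonV]
  field_simp

lemma hasDerivAt_bosonC (h : y ∈ bosonDom α t) (hy : 0 < y) :
    HasDerivAt (bosonC α t) (bosonC α t y * (bosonA α t y - 1 + t * y ^ 2 * bosonG α t y ^ 2) /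
      (y * bosonA α t y)) y := by
  obtain ⟨Z, hZ, hyZ⟩ := exists_gt_mem_bosonDom h
  have h1 := hasDerivAt_of_volterra (k := 0) (h := fun s => (bosonRate α t s).2.1)
    (q := fun s => (bosonSol α t s).2.1)
    (continuousOn_bosonRate hZ).snd.fst (fun s hs => (bosonSol_eq hZ s hs).2.1)
    ⟨hy, hyZ⟩
  simp only [pow_zero, one_mul] at h1
  refine (h1.const_add α).congr_deriv ?_
  have hA := bosonA_pos h
  simp only [bosonRate_eq]
  rw [div_eq_div_iff hA.ne' (by positivity)]
  rw [show bosonA α t y - 1 = - (y * (bosonSol α t y).2.2.1) by simp only [bosonA]; ring]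
  ring

lemma hasDerivAt_bosonV (h : y ∈ bosonDom α t) (hy : 0 < y) :
    HasDerivAt (bosonV α t) (y ^ 2 * (1 - bosonA α t y * bosonC α t y ^ 2) * bosonG α t y /
      (bosonA α t y * bosonC α t y)) y := by
  obtain ⟨Z, hZ, hyZ⟩ := exists_gt_mem_bosonDom h
  have h1 := hasDerivAt_of_volterra (k := 2) (h := fun s => (bosonRate α t s).2.2.2)
    (q := fun s => (bosonSol α t s).2.2.2)
    (continuousOn_bosonRate hZ).snd.snd.snd (fun s hs => (bosonSol_eq hZ s hs).2.2.2)
    ⟨hy, hyZ⟩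
  refine h1.congr_deriv ?_
  have hA := bosonA_pos h
  have hC := bosonC_pos h
  simp only [bosonRate_eq]
  field_simp

lemma hasDerivAt_mul_one_sub_bosonA (h : y ∈ bosonDom α t) (hy : 0 < y) :
    HasDerivAt (fun s => s * (1 - bosonA α t s)) (y ^ 2 * t * ((1 - t) * bosonA α t y *
      (bosonV α t y * bosonC α t y / y ^ 2) ^ 2 + (bosonA α t y * bosonC α t y ^ 2 + 1) *
        bosonG α t y ^ 2)) y := by
  obtain ⟨Z, hZ, hyZ⟩ := exists_gt_mem_bosonDom h
  have h1 := hasDerivAt_of_volterra (k := 2) (h := fun s => (bosonRate α t s).2.2.1)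
    (q := fun s => (bosonSol α t s).2.2.1)
    (continuousOn_bosonRate hZ).snd.snd.fst (fun s hs => (bosonSol_eq hZ s hs).2.2.1)
    ⟨hy, hyZ⟩
  have h2 : (fun s => s * (1 - bosonA α t s)) = fun s => s ^ 2 * (bosonSol α t s).2.2.1 := by
    ext s; simp only [bosonA]; ring
  rw [h2]
  refine h1.congr_deriv ?_
  have h3 : bosonV α t y * bosonC α t y / y ^ 2 = (bosonSol α t y).2.2.2 * bosonC α t y := by
    simp only [bosonV]; field_simp
  simp only [bosonRate_eq, h3]
  ring

lemma hasDerivAt_bosonA (h : y ∈ bosonDom α t) (hy : 0 < y) :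
    HasDerivAt (bosonA α t) ((1 - bosonA α t y) / y - y * t * ((1 - t) * bosonA α t y *
      (bosonV α t y * bosonC α t y / y ^ 2) ^ 2 + (bosonA α t y * bosonC α t y ^ 2 + 1) *
        bosonG α t y ^ 2)) y := by
  have h1 := ((hasDerivAt_mul_one_sub_bosonA h hy).div (hasDerivAt_id y) hy.ne').const_sub 1
  have h2 : bosonA α t =ᶠ[𝓝 y] fun s => 1 - s * (1 - bosonA α t s) / s := by
    filter_upwards [eventually_ne_nhds hy.ne'] with s hs
    field_simp
    ring
  refine (h1.congr_of_eventuallyEq h2).congr_deriv ?_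
  simp only [id]
  field_simp
  ring

lemma hasDerivWithinAt_bosonG_zero (hα : 0 < α) :
    HasDerivWithinAt (bosonG α t) 0 (Ici 0) 0 := by
  obtain ⟨Z, hZ, hyZ⟩ := exists_gt_mem_bosonDom (zero_mem_bosonDom (t := t) hα)
  have h1 := hasDerivWithinAt_zero_of_volterra (h := fun s => (bosonRate α t s).1)
    (q := fun s => (bosonSol α t s).1) hyZ
    (continuousOn_bosonRate hZ).fst
    (fun s hs => by simpa using (bosonSol_eq hZ s hs).1)
  refine (h1.const_add 1).congr_deriv ?_
  simp [bosonRate_eq, bosonSol_zero hα]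

end

section

variable {α t Y y : ℝ}

lemma bosonG_zero (hα : 0 < α) : bosonG α t 0 = 1 := by simp [bosonG, bosonSol_zero hα]

lemma bosonA_zero : bosonA α t 0 = 1 := by simp [bosonA]

lemma bosonC_zero (hα : 0 < α) : bosonC α t 0 = α := by simp [bosonC, bosonSol_zero hα]

lemma continuousOn_bosonG (h : Y ∈ bosonDom α t) : ContinuousOn (bosonG α t) (Icc 0 Y) :=
  continuousOn_const.add (continuousOn_bosonSol h).fst

lemma continuousOn_bosonA (h : Y ∈ bosonDom α t) : ContinuousOn (bosonA α t) (Icc 0 Y) :=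
  continuousOn_const.sub (continuousOn_id.mul (continuousOn_bosonSol h).snd.snd.fst)

lemma continuousOn_bosonC (h : Y ∈ bosonDom α t) : ContinuousOn (bosonC α t) (Icc 0 Y) :=
  continuousOn_const.add (continuousOn_bosonSol h).snd.fst

lemma ordConnected_bosonDom : (bosonDom α t ∩ Ioi 0).OrdConnected :=
  ⟨fun _ hx _ hy _ hz => ⟨bosonDom_of_le hy.1 (hx.1.1.trans hz.1) hz.2, hx.2.trans_le hz.1⟩⟩

/-- If `g` vanishes on `(0, y)` the central value would be zero. -/
lemma exists_bosonG_ne_zero (hα : 0 < α) (h : y ∈ bosonDom α t) (hy : 0 < y) :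
    ∃ s ∈ Ioo 0 y, bosonG α t s ≠ 0 := by
  by_contra! hc
  have h1 : Tendsto (bosonG α t) (𝓝[Ioo 0 y] 0) (𝓝 (bosonG α t 0)) :=
    ((continuousOn_bosonG h) 0 ⟨le_rfl, hy.le⟩).mono_left (nhdsWithin_mono _ Ioo_subset_Icc_self)
  have h2 : Tendsto (bosonG α t) (𝓝[Ioo 0 y] 0) (𝓝 0) := by
    apply tendsto_const_nhds.congr'
    filter_upwards [self_mem_nhdsWithin] with s hs using (hc s hs).symm
  have : (𝓝[Ioo 0 y] (0 : ℝ)).NeBot := left_nhdsWithin_Ioo_neBot hy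
  have := tendsto_nhds_unique h1 h2
  rw [bosonG_zero hα] at this
  exact one_ne_zero this

lemma bosonMassRate_nonneg (ht : t ∈ Icc (0 : ℝ) 1) (h : y ∈ bosonDom α t) :
    0 ≤ y ^ 2 * t * ((1 - t) * bosonA α t y * (bosonV α t y * bosonC α t y / y ^ 2) ^ 2 +
      (bosonA α t y * bosonC α t y ^ 2 + 1) * bosonG α t y ^ 2) := by
  have hA := bosonA_pos h
  have h1 : 0 ≤ 1 - t := by linarith [ht.2]
  have h2 := ht.1
  positivity

lemma monotoneOn_mul_one_sub_bosonA (ht : t ∈ Icc (0 : ℝ) 1) (h : Y ∈ bosonDom α t) :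
    MonotoneOn (fun s => s * (1 - bosonA α t s)) (Icc 0 Y) := by
  have hd : ∀ s ∈ Ioo 0 Y, s ∈ bosonDom α t := fun s hs => bosonDom_of_le h hs.1.le hs.2.le
  apply monotoneOn_of_hasDerivWithinAt_nonneg (convex_Icc 0 Y)
  · exact continuousOn_id.mul (continuousOn_const.sub (continuousOn_bosonA h))
  · rw [interior_Icc]
    exact fun s hs => (hasDerivAt_mul_one_sub_bosonA (hd s hs) hs.1).hasDerivWithinAt
  · rw [interior_Icc]
    exact fun s hs => bosonMassRate_nonneg ht (hd s hs)

lemma mul_one_sub_bosonA_nonneg (ht : t ∈ Icc (0 : ℝ) 1) (h : y ∈ bosonDom α t) :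
    0 ≤ y * (1 - bosonA α t y) := by
  have := monotoneOn_mul_one_sub_bosonA ht h ⟨le_rfl, h.1⟩ ⟨h.1, le_rfl⟩ h.1
  simpa using this

lemma bosonA_le_one (ht : t ∈ Icc (0 : ℝ) 1) (h : y ∈ bosonDom α t) (hy : 0 < y) :
    bosonA α t y ≤ 1 := by
  have h1 := mul_one_sub_bosonA_nonneg ht h
  have := nonneg_of_mul_nonneg_right h1 hy
  linarith

lemma bosonA_lt_one (hα : 0 < α) (ht : t ∈ Icc (0 : ℝ) 1) (ht0 : 0 < t) (h : y ∈ bosonDom α t)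
    (hy : 0 < y) : bosonA α t y < 1 := by
  refine (bosonA_le_one ht h hy).lt_of_ne fun hA => ?_
  obtain ⟨s, hs, hg⟩ := exists_bosonG_ne_zero hα h hy
  have hd : ∀ s ∈ Icc 0 y, s ∈ bosonDom α t := fun s hs => bosonDom_of_le h hs.1 hs.2
  have hz : ∀ r ∈ Icc 0 y, r * (1 - bosonA α t r) = 0 := by
    intro r hr
    have h1 := monotoneOn_mul_one_sub_bosonA ht h hr ⟨h.1, le_rfl⟩ hr.2
    simp only [hA, sub_self, mul_zero] at h1
    exact le_antisymm h1 (mul_one_sub_bosonA_nonneg ht (hd r hr))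
  have hsd := hd s ⟨hs.1.le, hs.2.le⟩
  have h2 := hasDerivAt_mul_one_sub_bosonA hsd hs.1
  have h3 : HasDerivAt (fun s => s * (1 - bosonA α t s)) 0 s := by
    apply (hasDerivAt_const s (0 : ℝ)).congr_of_eventuallyEq
    filter_upwards [Icc_mem_nhds hs.1 hs.2] with r hr using hz r hr
  have h4 := h2.unique h3
  have h5 : 0 ≤ 1 - t := by linarith [ht.2]
  have hA' := bosonA_pos hsd
  have h6 : 0 < bosonG α t s ^ 2 := by positivity
  have h7 := hs.1
  have h8 : 0 < s ^ 2 * t * ((1 - t) * bosonA α t s * (bosonV α t s * bosonC α t s / s ^ 2) ^ 2 +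
      (bosonA α t s * bosonC α t s ^ 2 + 1) * bosonG α t s ^ 2) := by
    positivity
  exact h8.ne' h4

lemma bosonA_mul_bosonC_le (hα : 0 < α) (ht : t ∈ Icc (0 : ℝ) 1) (h : y ∈ bosonDom α t) :
    bosonA α t y * bosonC α t y ≤ α := by
  have hd : ∀ s ∈ Ioo 0 y, s ∈ bosonDom α t := fun s hs => bosonDom_of_le h hs.1.le hs.2.le
  have h1 : AntitoneOn (fun s => bosonA α t s * bosonC α t s) (Icc 0 y) := by
    apply antitoneOn_of_hasDerivWithinAt_nonpos (convex_Icc 0 y)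
      (f' := fun s => -(s * t * ((1 - t) * (bosonV α t s * bosonC α t s / s ^ 2) ^ 2 +
        bosonC α t s ^ 2 * bosonG α t s ^ 2) * (bosonA α t s * bosonC α t s)))
    · exact (continuousOn_bosonA h).mul (continuousOn_bosonC h)
    · rw [interior_Icc]
      intro s hs
      have hA := bosonA_pos (hd s hs)
      have hs0 := hs.1
      refine (((hasDerivAt_bosonA (hd s hs) hs.1).mul
        (hasDerivAt_bosonC (hd s hs) hs.1)).congr_deriv ?_).hasDerivWithinAt
      field_simp
      ring
    · rw [interior_Icc]
      intro s hs
      have hA := bosonA_pos (hd s hs)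
      have hC := bosonC_pos (hd s hs)
      have h5 : 0 ≤ 1 - t := by linarith [ht.2]
      have h6 := ht.1
      have h7 := hs.1
      rw [neg_nonpos]
      positivity
  have := h1 ⟨le_rfl, h.1⟩ ⟨h.1, le_rfl⟩ h.1
  simpa [bosonA_zero, bosonC_zero hα] using this

lemma bosonG_ne_zero_or (hα : 0 < α) (h : y ∈ bosonDom α t)
    (hy : 0 < y) : bosonG α t y ≠ 0 ∨ bosonV α t y ≠ 0 := by
  by_contra! hc
  obtain ⟨s, hs, hg⟩ := exists_bosonG_ne_zero hα h hy
  have hd : ∀ r ∈ Icc s y, r ∈ bosonDom α t := fun r hr =>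
    bosonDom_of_le h (hs.1.le.trans hr.1) hr.2
  have hsub : Icc s y ⊆ Icc 0 y := Icc_subset_Icc_left hs.1.le
  have hr0 : ∀ r ∈ Icc s y, r ^ 2 ≠ 0 := fun r hr => by
    have := hs.1.trans_le hr.1
    positivity
  have hr1 : ∀ r ∈ Icc s y, bosonA α t r * bosonC α t r ≠ 0 := fun r hr =>
    (mul_pos (bosonA_pos (hd r hr)) (bosonC_pos (hd r hr))).ne'
  have hcA := (continuousOn_bosonA h).mono hsub
  have hcC := (continuousOn_bosonC h).mono hsub
  have hcont : ContinuousOn (fun r => (1 - t) * bosonC α t r / r ^ 2 +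
      r ^ 2 * (1 - bosonA α t r * bosonC α t r ^ 2) / (bosonA α t r * bosonC α t r)) (Icc s y) :=
    ((continuousOn_const.mul hcC).div (by fun_prop) hr0).add
      (ContinuousOn.div (by fun_prop) (by fun_prop) hr1)
  obtain ⟨k, hk⟩ := isCompact_Icc.exists_bound_of_continuousOn hcont
  have hfin := le_mul_exp_of_le_hasDerivAt (S := Icc s y) ordConnected_Icc (k := k)
    (f := fun r => bosonG α t r ^ 2 + bosonV α t r ^ 2)
    (fun r hr => ((hasDerivAt_bosonG (hd r hr) (hs.1.trans_le hr.1)).pow 2).add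
      ((hasDerivAt_bosonV (hd r hr) (hs.1.trans_le hr.1)).pow 2)) ?_ ⟨le_rfl, hs.2.le⟩
      ⟨hs.2.le, le_rfl⟩ hs.2.le
  · rw [hc.1, hc.2] at hfin
    have : 0 < bosonG α t s ^ 2 := by positivity
    nlinarith [sq_nonneg (bosonV α t s)]
  · intro r hr
    have h1 := hk r hr
    set w := (1 - t) * bosonC α t r / r ^ 2 +
      r ^ 2 * (1 - bosonA α t r * bosonC α t r ^ 2) / (bosonA α t r * bosonC α t r) with hw
    rw [Real.norm_eq_abs, abs_le] at h1
    have h2 : (2 : ℕ) * bosonG α t r ^ (2 - 1) * ((1 - t) * bosonV α t r * bosonC α t r / r ^ 2) +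
        (2 : ℕ) * bosonV α t r ^ (2 - 1) * (r ^ 2 * (1 - bosonA α t r * bosonC α t r ^ 2) *
          bosonG α t r / (bosonA α t r * bosonC α t r))
        = 2 * (bosonG α t r * bosonV α t r) * w := by
      rw [hw]; push_cast; ring
    rw [h2]
    nlinarith [sq_nonneg (bosonG α t r - bosonV α t r), sq_nonneg (bosonG α t r + bosonV α t r)]

theorem bosonOrbit (hα : 0 < α) (ht : t ∈ Icc (0 : ℝ) 1) :
    BosonOrbit α (1 - t) t (bosonDom α t ∩ Ioi 0) (bosonG α t) (bosonV α t) (bosonA α t)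
      (bosonC α t) where
  ordConnected := ordConnected_bosonDom
  pos _ hy := hy.2
  A_pos _ hy := bosonA_pos hy.1
  C_pos _ hy := bosonC_pos hy.1
  A_le _ hy := bosonA_le_one ht hy.1 hy.2
  A_lt h0 _ hy := bosonA_lt_one hα ht h0 hy.1 hy.2
  AC_le _ hy := bosonA_mul_bosonC_le hα ht hy.1
  ne _ hy := bosonG_ne_zero_or hα hy.1 hy.2
  hasDerivAt_g _ hy := hasDerivAt_bosonG hy.1 hy.2
  hasDerivAt_v _ hy := hasDerivAt_bosonV hy.1 hy.2
  hasDerivAt_A _ hy := hasDerivAt_bosonA hy.1 hy.2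
  hasDerivAt_C _ hy := hasDerivAt_bosonC hy.1 hy.2

end

lemma BosonOrbit.hasDerivAt_sq_add_sq {α ε μ : ℝ} {S : Set ℝ} {g v A C : ℝ → ℝ}
    (h : BosonOrbit α ε μ S g v A C) {y : ℝ} (hy : y ∈ S) :
    HasDerivAt (fun r => g r ^ 2 + v r ^ 2) (2 * (g y * v y) *
      (ε * C y / y ^ 2 + y ^ 2 * (1 - A y * C y ^ 2) / (A y * C y))) y :=
  (((h.hasDerivAt_g y hy).pow 2).add ((h.hasDerivAt_v y hy).pow 2)).congr_deriv
    (by push_cast; ring)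

/-- As long as `A` is bounded below, the orbit stays bounded on bounded intervals. -/
lemma BosonOrbit.bounded_of_le_A {α ε μ : ℝ} {S : Set ℝ} {g v A C : ℝ → ℝ}
    (h : BosonOrbit α ε μ S g v A C) (hα : 0 < α) (hε0 : 0 ≤ ε) (hε : ε ≤ 1) (hμ : 0 ≤ μ)
    {c y₁ X : ℝ} (hc : 0 < c)
    (hA : ∀ y ∈ S, c ≤ A y) (h1 : y₁ ∈ S) :
    ∃ c₁ > 0, ∃ R, ∀ y ∈ S, y₁ ≤ y → y ≤ X →
      c₁ ≤ C y ∧ C y ≤ α / c ∧ |g y| ≤ R ∧ |v y| ≤ R := by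
  have hy1 := h.pos _ h1
  set S' := S ∩ Ici y₁ with hS'
  have hS : S'.OrdConnected := h.ordConnected.inter ordConnected_Ici
  have h1' : y₁ ∈ S' := ⟨h1, le_refl y₁⟩
  have hCle : ∀ y ∈ S, C y ≤ α / c := fun y hy => by
    rw [le_div_iff₀ hc, mul_comm]
    exact (mul_le_mul_of_nonneg_right (hA y hy) (h.C_pos y hy).le).trans (h.AC_le y hy)
  set k := 1 / (y₁ * c) with hk
  have hk0 : 0 < k := by positivity
  have hClow : ∀ y ∈ S', C y₁ ≤ C y * exp (k * (y - y₁)) := fun y hy => by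
    refine le_mul_exp_of_le_hasDerivAt hS (fun r hr => h.hasDerivAt_C r hr.1) ?_ h1' hy hy.2
    intro r hr
    have hr0 := h.pos r hr.1
    have hCr := h.C_pos r hr.1
    have hAr := h.A_pos r hr.1
    have hAc := hA r hr.1
    have hr1 : y₁ ≤ r := hr.2
    have hrA : y₁ * c ≤ r * A r := mul_le_mul hr1 hAc hc.le hr0.le
    rw [le_div_iff₀ (by positivity)]
    have h2 : 1 ≤ k * (r * A r) := by
      rw [hk, div_mul_eq_mul_div, one_mul, le_div_iff₀ (by positivity)]
      linarith
    have h3 : 0 ≤ μ * r ^ 2 * g r ^ 2 := by positivity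
    have h4 : C r * 1 ≤ C r * (k * (r * A r)) := mul_le_mul_of_nonneg_left h2 hCr.le
    nlinarith
  set c₁ := C y₁ * exp (-(k * (X - y₁))) with hc₁
  have hc₁0 : 0 < c₁ := mul_pos (h.C_pos _ h1) (exp_pos _)
  have hCl : ∀ y ∈ S', y ≤ X → c₁ ≤ C y := fun y hy hyX => by
    rw [hc₁, exp_neg, mul_inv_le_iff₀ (exp_pos _)]
    refine (hClow y hy).trans ?_
    have := h.C_pos y hy.1
    gcongr
  set k' := α / c / y₁ ^ 2 + X ^ 2 * (1 / (c * c₁) + α / c) with hk'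
  have hk'0 : 0 < k' := by positivity
  set ρ := fun r => g r ^ 2 + v r ^ 2 with hρ
  have hρle : ∀ y ∈ S', y ≤ X → ρ y ≤ ρ y₁ * exp (k' * (X - y₁)) := fun y hy hyX => by
    have hmain := le_mul_exp_of_hasDerivAt_le (S := S' ∩ Iic X) (hS.inter ordConnected_Iic) (k := k')
      (fun r hr => h.hasDerivAt_sq_add_sq hr.1.1) ?_ ⟨h1', le_trans hy.2 hyX⟩ ⟨hy, hyX⟩ hy.2
    · refine hmain.trans ?_
      have : 0 ≤ g y₁ ^ 2 + v y₁ ^ 2 := by positivity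
      gcongr
    · intro r hr
      have hr0 := h.pos r hr.1.1
      have hCr := h.C_pos r hr.1.1
      have hAr := h.A_pos r hr.1.1
      have hAc := hA r hr.1.1
      have hr1 : y₁ ≤ r := hr.1.2
      have hrX : r ≤ X := hr.2
      have hC1 := hCl r hr.1 hrX
      have hC2 := hCle r hr.1.1
      set w1 := ε * C r / r ^ 2 with hw1
      have e1 : 0 ≤ w1 := by positivity
      have e2 : w1 ≤ α / c / y₁ ^ 2 := by
        rw [hw1]
        have : ε * C r ≤ α / c := by nlinarith
        gcongr
      have e3 : r ^ 2 * (1 - A r * C r ^ 2) / (A r * C r) = r ^ 2 * (1 / (A r * C r) - C r) := by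
        field_simp
      have e4 : r ^ 2 * (1 / (A r * C r) - C r) ≤ X ^ 2 * (1 / (c * c₁) + α / c) := by
        have : 1 / (A r * C r) ≤ 1 / (c * c₁) := by gcongr
        have h0 : 0 < 1 / (A r * C r) := by positivity
        have hrX2 : r ^ 2 ≤ X ^ 2 := by gcongr
        calc r ^ 2 * (1 / (A r * C r) - C r) ≤ r ^ 2 * (1 / (c * c₁) + α / c) := by
              gcongr; linarith [div_pos hα hc]
          _ ≤ _ := by gcongr
      have e5 : -(X ^ 2 * (1 / (c * c₁) + α / c)) ≤ r ^ 2 * (1 / (A r * C r) - C r) := by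
        have h0 : 0 < 1 / (A r * C r) := by positivity
        have h00 : 0 < 1 / (c * c₁) := by positivity
        have hrX2 : r ^ 2 ≤ X ^ 2 := by gcongr
        have : r ^ 2 * C r ≤ X ^ 2 * (1 / (c * c₁) + α / c) := by
          gcongr; linarith
        nlinarith
      rw [e3]
      have e6 : |w1 + r ^ 2 * (1 / (A r * C r) - C r)| ≤ k' := by
        rw [abs_le]; constructor <;> linarith [div_pos (div_pos hα hc) (pow_pos hy1 2)]
      rw [abs_le] at e6
      nlinarith [sq_nonneg (g r - v r), sq_nonneg (g r + v r)]
  refine ⟨c₁, hc₁0, ρ y₁ * exp (k' * (X - y₁)) + 1, fun y hy hyy hyX => ?_⟩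
  have hy' : y ∈ S' := ⟨hy, hyy⟩
  have h3 : g y ^ 2 + v y ^ 2 ≤ ρ y₁ * exp (k' * (X - y₁)) := hρle y hy' hyX
  refine ⟨hCl y hy' hyX, hCle y hy, ?_, ?_⟩ <;> rw [abs_le] <;> constructor <;>
    nlinarith [sq_nonneg (g y), sq_nonneg (v y), sq_nonneg (g y - 1), sq_nonneg (v y - 1),
      sq_nonneg (g y + 1), sq_nonneg (v y + 1)]

section

variable {α t : ℝ}

lemma bosonDom_eq_Ici_of_le_bosonA (hα : 0 < α) (ht : t ∈ Icc (0 : ℝ) 1) {c : ℝ} (hc : 0 < c)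
    (hA : ∀ y ∈ bosonDom α t, c ≤ bosonA α t y) : bosonDom α t = Ici 0 := by
  by_contra hne
  obtain ⟨X, hX0, hX⟩ : ∃ X, 0 ≤ X ∧ X ∉ bosonDom α t := by
    by_contra! hcon
    exact hne (Subset.antisymm (fun y hy => hy.1) hcon)
  have hbd : ∀ y ∈ bosonDom α t, y ≤ X := fun y hy => by
    by_contra h
    exact hX (bosonDom_of_le hy hX0 (le_of_not_ge h))
  obtain ⟨y₁, h1, hy1⟩ := exists_gt_mem_bosonDom (zero_mem_bosonDom (t := t) hα)
  have ho := bosonOrbit hα ht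
  obtain ⟨c₁, hc₁, R, hR⟩ := ho.bounded_of_le_A hα (by linarith [ht.2]) (by linarith [ht.1]) ht.1
    (X := X) hc (fun y hy => hA y hy.1) ⟨h1, hy1⟩
  set B := (|R| + 1) + (α / c + α) + 1 / y₁ + |R| / y₁ ^ 2 with hB
  have hp1 : 0 < α / c := by positivity
  have hp2 : 0 < 1 / y₁ := by positivity
  have hp3 : 0 ≤ |R| / y₁ ^ 2 := by positivity
  have hp4 := abs_nonneg R
  set K₂ : Set (ℝ × ℝ × BosonPhase) := ({t} ×ˢ (Icc y₁ X ×ˢ Metric.closedBall 0 B)) ∩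
    ({x | c ≤ 1 - x.2.1 * x.2.2.2.2.1} ∩ {x | c₁ ≤ α + x.2.2.2.1}) with hK₂
  have hK₂c : IsCompact K₂ := by
    apply IsCompact.inter_right
    · exact isCompact_singleton.prod (isCompact_Icc.prod (isCompact_closedBall _ _))
    · refine IsClosed.inter (isClosed_le ?_ ?_) (isClosed_le ?_ ?_) <;> fun_prop
  have hgr := isVolterraSol_bosonSol h1
  refine hne (volterraDom_eq_Ici continuous_bosonKernel norm_bosonKernel_le (isOpen_bosonRegion α)
    (contDiffOn_bosonField α) (K := (fun s => (t, s, bosonSol α t s)) '' Icc 0 y₁ ∪ K₂)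
    ⟨by simp, by simpa using hα⟩ (hgr.isCompact_graph.union hK₂c)
    (union_subset hgr.graph_subset fun x hx => ⟨hc.trans_le hx.2.1, hc₁.trans_le hx.2.2⟩) ?_)
  intro y hy
  change (t, y, bosonSol α t y) ∈ _
  rcases le_or_gt y y₁ with hyy | hyy
  · exact Or.inl ⟨y, ⟨hy.1, hyy⟩, rfl⟩
  · refine Or.inr ⟨⟨rfl, ⟨hyy.le, hbd y hy⟩, ?_⟩, hA y hy, ?_⟩
    · obtain ⟨r1, r2, r3, r4⟩ := hR y ⟨hy, hy1.trans hyy⟩ hyy.le (hbd y hy)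
      have hy0 : 0 < y := hy1.trans hyy
      have hA0 := bosonA_pos hy
      have hA1 := bosonA_le_one ht hy hy0
      rw [mem_closedBall_zero_iff]
      simp only [Prod.norm_def, Real.norm_eq_abs]
      have hRR := le_abs_self R
      have s1 : |(bosonSol α t y).1| ≤ B := by
        have : (bosonSol α t y).1 = bosonG α t y - 1 := by simp [bosonG]
        rw [this]
        refine (abs_sub _ _).trans ?_
        rw [abs_one]
        linarith
      have s2 : |(bosonSol α t y).2.1| ≤ B := by
        have : (bosonSol α t y).2.1 = bosonC α t y - α := by simp [bosonC]
        rw [this, abs_le]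
        constructor <;> linarith
      have s3 : |(bosonSol α t y).2.2.1| ≤ B := by
        have : (bosonSol α t y).2.2.1 = (1 - bosonA α t y) / y := by
          simp only [bosonA]; field_simp; ring
        rw [this, abs_of_nonneg (div_nonneg (by linarith) hy0.le)]
        have : (1 - bosonA α t y) / y ≤ 1 / y₁ := by
          gcongr; linarith
        linarith
      have s4 : |(bosonSol α t y).2.2.2| ≤ B := by
        have : (bosonSol α t y).2.2.2 = bosonV α t y / y ^ 2 := by
          simp only [bosonV]; field_simp
        rw [this, abs_div, abs_of_pos (pow_pos hy0 2)]
        have : |bosonV α t y| / y ^ 2 ≤ |R| / y₁ ^ 2 :=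
          div_le_div₀ hp4 (r4.trans hRR) (by positivity) (by gcongr)
        linarith
      exact max_le s1 (max_le s2 (max_le s3 s4))
    · exact (hR y ⟨hy, hy1.trans hyy⟩ hyy.le (hbd y hy)).1

/-- An orbit is either global, or `A` tends to zero at the end of its domain. -/
theorem bosonDom_eq_Ici_or (hα : 0 < α) (ht : t ∈ Icc (0 : ℝ) 1) :
    bosonDom α t = Ici 0 ∨
      ∃ X > 0, bosonDom α t = Ico 0 X ∧ Tendsto (bosonA α t) (𝓝[<] X) (𝓝 0) := by
  by_cases hg : bosonDom α t = Ici 0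
  · exact Or.inl hg
  right
  obtain ⟨X', hX0', hX'⟩ : ∃ X, 0 ≤ X ∧ X ∉ bosonDom α t := by
    by_contra! hcon
    exact hg (Subset.antisymm (fun y hy => hy.1) hcon)
  have hbd : ∀ y ∈ bosonDom α t, y ≤ X' := fun y hy => by
    by_contra h
    exact hX' (bosonDom_of_le hy hX0' (le_of_not_ge h))
  have hbdd : BddAbove (bosonDom α t) := ⟨X', hbd⟩
  have h0 : 0 ∈ bosonDom α t := zero_mem_bosonDom hα
  set X := sSup (bosonDom α t) with hX
  have hlt : ∀ y ∈ bosonDom α t, y < X := fun y hy => by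
    obtain ⟨Z, hZ, hyZ⟩ := exists_gt_mem_bosonDom hy
    exact hyZ.trans_le (le_csSup hbdd hZ)
  have hmem : ∀ y, 0 ≤ y → y < X → y ∈ bosonDom α t := fun y hy hyX => by
    obtain ⟨Z, hZ, hyZ⟩ := exists_lt_of_lt_csSup ⟨0, h0⟩ hyX
    exact bosonDom_of_le hZ hy hyZ.le
  have hX0 : 0 < X := hlt 0 h0
  refine ⟨X, hX0, Subset.antisymm (fun y hy => ⟨hy.1, hlt y hy⟩) fun y hy => hmem y hy.1 hy.2, ?_⟩
  rw [Metric.tendsto_nhds]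
  intro c hc
  have hkey : ∃ y ∈ bosonDom α t, 0 < y ∧ bosonA α t y < c / 2 ∧ X * (1 - c / 2) ≤ y := by
    by_contra! hcon
    have hx1 : ∃ Y ∈ bosonDom α t, X * (1 - c / 2) ≤ Y ∧ 0 < Y := by
      rcases le_or_gt (X * (1 - c / 2)) 0 with hle | hgt
      · exact ⟨X / 2, hmem _ (by linarith) (by linarith), by linarith, by linarith⟩
      · refine ⟨_, hmem (X * (1 - c / 2)) hgt.le (by nlinarith), le_rfl, hgt⟩
    obtain ⟨Y, hY, hY1, hY0⟩ := hx1
    obtain ⟨z, hz, hzmin⟩ := isCompact_Icc.exists_isMinOn (nonempty_Icc.2 hY.1)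
      (continuousOn_bosonA hY)
    have hz0 := bosonA_pos (bosonDom_of_le hY hz.1 hz.2)
    refine hg (bosonDom_eq_Ici_of_le_bosonA hα ht (c := min (bosonA α t z) (c / 2))
      (lt_min hz0 (by linarith)) fun y hy => ?_)
    rcases le_or_gt y Y with hyY | hyY
    · exact (min_le_left _ _).trans (hzmin ⟨hy.1, hyY⟩)
    · by_contra hlt'
      have h3 := hcon y hy (hY0.trans hyY) ((not_le.1 hlt').trans_le (min_le_right _ _))
      linarith
  obtain ⟨y, hy, hy0, hyA, hyX⟩ := hkey
  have hev : ∀ᶠ s in 𝓝[<] X, s ∈ Ioo y X := Ioo_mem_nhdsLT (hlt y hy)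
  filter_upwards [hev] with s hs
  have hsd := hmem s (hy0.trans hs.1).le hs.2
  have hA0 := bosonA_pos hsd
  rw [Real.dist_eq, sub_zero, abs_of_pos hA0]
  have hmono := monotoneOn_mul_one_sub_bosonA ht hsd ⟨hy.1, hs.1.le⟩ ⟨hsd.1, le_rfl⟩ hs.1.le
  simp only at hmono
  have hs0 := hy0.trans hs.1
  by_contra hcs
  push Not at hcs
  have h5 : s * (1 - bosonA α t s) ≤ X * (1 - c) ∨ 1 - c < 0 := by
    rcases lt_or_ge (1 - c) 0 with h | h
    · exact Or.inr h
    · left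
      calc s * (1 - bosonA α t s) ≤ s * (1 - c) := by gcongr
        _ ≤ X * (1 - c) := by gcongr; exact hs.2.le
  have hA1 := bosonA_le_one ht hsd hs0
  rcases h5 with h5 | h5
  · have h6 : y * (1 - c / 2) ≤ y * (1 - bosonA α t y) := by gcongr
    nlinarith [sq_nonneg c]
  · linarith

end

/-- A function that starts negative and decreases at its first possible zero stays negative. -/
lemma neg_of_hasDerivAt_neg_of_eq_zero {f f' : ℝ → ℝ} {a b : ℝ}
    (hd : ∀ x ∈ Icc a b, HasDerivAt f (f' x) x) (ha : f a < 0)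
    (hcross : ∀ x ∈ Icc a b, (∀ z ∈ Ico a x, f z < 0) → f x = 0 → f' x < 0) :
    ∀ x ∈ Icc a b, f x < 0 := by
  by_contra! hcon
  have hc : ContinuousOn f (Icc a b) := fun x hx => (hd x hx).continuousAt.continuousWithinAt
  set T := Icc a b ∩ f ⁻¹' Ici 0 with hT
  have hTc : IsClosed T := hc.preimage_isClosed_of_isClosed isClosed_Icc isClosed_Ici
  have hTk : IsCompact T := isCompact_Icc.of_isClosed_subset hTc inter_subset_left
  obtain ⟨x, hx, hx0⟩ := hcon
  obtain ⟨c, hcT, hcmin⟩ := hTk.exists_isLeast ⟨x, hx, hx0⟩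
  have hbefore : ∀ z ∈ Ico a c, f z < 0 := fun z hz => by
    by_contra h
    exact absurd (hcmin ⟨⟨hz.1, hz.2.le.trans hcT.1.2⟩, not_lt.1 h⟩) (not_le.2 hz.2)
  have hac : a < c := by
    refine hcT.1.1.lt_of_ne ?_
    rintro rfl
    exact absurd hcT.2 (not_le.2 ha)
  have hev : ∀ᶠ z in 𝓝[<] c, f z < 0 := by
    filter_upwards [Ico_mem_nhdsLT hac] with z hz using hbefore z hz
  have hc0 : f c = 0 := by
    refine le_antisymm ?_ hcT.2
    have h1 : Tendsto f (𝓝[<] c) (𝓝 (f c)) :=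
      (hd c hcT.1).continuousAt.tendsto.mono_left nhdsWithin_le_nhds
    exact le_of_tendsto h1 (hev.mono fun z hz => hz.le)
  have hneg := hcross c hcT.1 hbefore hc0
  have hslope : Tendsto (slope f c) (𝓝[<] c) (𝓝 (f' c)) :=
    (hasDerivAt_iff_tendsto_slope.1 (hd c hcT.1)).mono_left
      (nhdsWithin_mono _ fun z hz => ne_of_lt hz)
  obtain ⟨z, h1, h2, h3⟩ := ((hslope.eventually (gt_mem_nhds hneg)).and
    (hev.and self_mem_nhdsWithin)).exists
  rw [slope_def_field, hc0, sub_zero] at h1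
  have h4 : 0 < f z / (z - c) := div_pos_of_neg_of_neg h2 (sub_neg.2 h3)
  linarith

namespace BosonOrbit

variable {α ε μ : ℝ} {S : Set ℝ} {g v A C : ℝ → ℝ}

lemma neg (h : BosonOrbit α ε μ S g v A C) :
    BosonOrbit α ε μ S (fun y => -g y) (fun y => -v y) A C where
  ordConnected := h.ordConnected
  pos := h.pos
  A_pos := h.A_pos
  C_pos := h.C_pos
  A_le := h.A_le
  A_lt := h.A_lt
  AC_le := h.AC_le
  ne y hy := by simpa using h.ne y hy
  hasDerivAt_g y hy := (h.hasDerivAt_g y hy).neg.congr_deriv (by ring)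
  hasDerivAt_v y hy := (h.hasDerivAt_v y hy).neg.congr_deriv (by ring)
  hasDerivAt_A y hy := (h.hasDerivAt_A y hy).congr_deriv (by ring)
  hasDerivAt_C y hy := (h.hasDerivAt_C y hy).congr_deriv (by ring)

variable (h : BosonOrbit α ε μ S g v A C)
include h

lemma Icc_subset {a b : ℝ} (ha : a ∈ S) (hb : b ∈ S) : Icc a b ⊆ S := h.ordConnected.out ha hb

lemma D_pos {y : ℝ} (hy : y ∈ S) : 0 < A y * C y ^ 2 := by
  have := h.A_pos y hy
  have := h.C_pos y hy
  positivity

lemma hasDerivAt_D {y : ℝ} (hy : y ∈ S) :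
    HasDerivAt (fun r => A r * C r ^ 2) (-(A y * C y ^ 2 * (1 - A y +
      μ * ε * (A y * C y ^ 2) * v y ^ 2 / y ^ 2 + μ * y ^ 2 * g y ^ 2 * (A y * C y ^ 2 - 1)) /
        (y * A y))) y := by
  have hy0 := h.pos y hy
  have hA := h.A_pos y hy
  refine ((h.hasDerivAt_A y hy).mul ((h.hasDerivAt_C y hy).pow 2)).congr_deriv ?_
  simp only [Pi.pow_apply]
  push_cast
  field_simp
  ring

lemma hasDerivAt_log_D {y : ℝ} (hy : y ∈ S) :
    HasDerivAt (fun r => log (A r * C r ^ 2)) (-((1 - A y +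
      μ * ε * (A y * C y ^ 2) * v y ^ 2 / y ^ 2 + μ * y ^ 2 * g y ^ 2 * (A y * C y ^ 2 - 1)) /
        (y * A y))) y := by
  have hy0 := h.pos y hy
  have hA := h.A_pos y hy
  have hC := h.C_pos y hy
  refine ((h.hasDerivAt_D hy).log (h.D_pos hy).ne').congr_deriv ?_
  field_simp

lemma hasDerivAt_gv {y : ℝ} (hy : y ∈ S) :
    HasDerivAt (fun r => g r * v r) (ε * v y ^ 2 * C y / y ^ 2 +
      (1 - A y * C y ^ 2) * y ^ 2 * g y ^ 2 / (A y * C y)) y := by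
  refine ((h.hasDerivAt_g y hy).mul (h.hasDerivAt_v y hy)).congr_deriv ?_
  ring

lemma hasDerivAt_mass {y : ℝ} (hy : y ∈ S) :
    HasDerivAt (fun r => r * (1 - A r)) (μ * (ε * (A y * C y) * (v y ^ 2 * C y / y ^ 2) +
      y ^ 2 * (A y * C y ^ 2 + 1) * g y ^ 2)) y := by
  have hy0 := h.pos y hy
  refine ((hasDerivAt_id y).mul ((h.hasDerivAt_A y hy).const_sub 1)).congr_deriv ?_
  simp only [id]
  field_simp
  ring

lemma mass_deriv_ge (hε : 0 ≤ ε) (hμ : 0 ≤ μ) {y : ℝ} (hy : y ∈ S) :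
    μ * (y ^ 2 * g y ^ 2) ≤ μ * (ε * (A y * C y) * (v y ^ 2 * C y / y ^ 2) +
      y ^ 2 * (A y * C y ^ 2 + 1) * g y ^ 2) := by
  have hA := h.A_pos y hy
  have hC := h.C_pos y hy
  have h1 : 0 ≤ ε * (A y * C y) * (v y ^ 2 * C y / y ^ 2) := by positivity
  have h2 : 0 ≤ y ^ 2 * (A y * C y ^ 2) * g y ^ 2 := by positivity
  gcongr
  nlinarith

lemma monotoneOn_mass (hε : 0 ≤ ε) (hμ : 0 ≤ μ) : MonotoneOn (fun r => r * (1 - A r)) S :=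
  monotoneOn_of_hasDerivAt_nonneg h.ordConnected (fun _ hy => h.hasDerivAt_mass hy)
    fun _ hy => le_trans (by positivity) (h.mass_deriv_ge hε hμ hy)

/-- The quantity `K` governing the logarithmic derivative of `A C ^ 2`. -/
lemma hasDerivAt_K {y : ℝ} (hy : y ∈ S) :
    HasDerivAt (fun r => r * (1 - A r +
      μ * ε * (A r * C r ^ 2) * v r ^ 2 / r ^ 2 + μ * r ^ 2 * g r ^ 2 * (A r * C r ^ 2 - 1)) /
        (A r * C r)) (2 * μ * y ^ 2 * g y ^ 2 * (2 * (A y * C y ^ 2) - 1) / (A y * C y)) y := by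
  have hy0 := h.pos y hy
  have hA := h.A_pos y hy
  have hC := h.C_pos y hy
  have dA := h.hasDerivAt_A y hy
  have dC := h.hasDerivAt_C y hy
  have dg := h.hasDerivAt_g y hy
  have dv := h.hasDerivAt_v y hy
  have di := hasDerivAt_id y
  have dD := h.hasDerivAt_D hy
  have h1 := (di.mul (((dA.const_sub 1).add (((dD.const_mul (μ * ε)).mul (dv.pow 2)).div (di.pow 2)
    (pow_ne_zero 2 hy0.ne'))).add ((((di.pow 2).const_mul μ).mul (dg.pow 2)).mul
      (dD.sub_const 1)))).div (dA.mul dC) (mul_pos hA hC).ne'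
  refine h1.congr_deriv ?_
  simp only [Pi.pow_apply, id, Pi.mul_apply, Pi.add_apply, Pi.div_apply]
  push_cast
  field_simp
  ring

lemma D_lt_one_of_le (hε : 0 ≤ ε) (hμ : 0 < μ) {y₀ y : ℝ} (h0 : y₀ ∈ S) (hy : y ∈ S)
    (hle : y₀ ≤ y) (hD : A y₀ * C y₀ ^ 2 < 1) : A y * C y ^ 2 < 1 := by
  have hsub := h.Icc_subset h0 hy
  have := neg_of_hasDerivAt_neg_of_eq_zero (f := fun r => A r * C r ^ 2 - 1)
    (fun x hx => (h.hasDerivAt_D (hsub hx)).sub_const 1) (by simpa using hD) ?_ y ⟨hle, le_rfl⟩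
  · simpa using this
  · intro x hx _ hx1
    have hxS := hsub hx
    have hx0 := h.pos x hxS
    have hA := h.A_pos x hxS
    have hA1 := h.A_lt hμ x hxS
    rw [hx1, sub_eq_zero.1 hx1]
    have h1 : 0 ≤ μ * ε * 1 * v x ^ 2 / x ^ 2 := by positivity
    rw [neg_lt_zero]
    apply div_pos _ (by positivity)
    nlinarith

lemma gv_deriv_nonneg (hε : 0 ≤ ε) {y : ℝ} (hy : y ∈ S) (hD : A y * C y ^ 2 ≤ 1) :
    0 ≤ ε * v y ^ 2 * C y / y ^ 2 + (1 - A y * C y ^ 2) * y ^ 2 * g y ^ 2 / (A y * C y) := by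
  have hA := h.A_pos y hy
  have hC := h.C_pos y hy
  have h1 : 0 ≤ 1 - A y * C y ^ 2 := by linarith
  positivity

lemma monotoneOn_gv (hε : 0 ≤ ε) (hμ : 0 < μ) {y₀ : ℝ} (h0 : y₀ ∈ S)
    (hD : A y₀ * C y₀ ^ 2 < 1) : MonotoneOn (fun r => g r * v r) (S ∩ Ici y₀) :=
  monotoneOn_of_hasDerivAt_nonneg (h.ordConnected.inter ordConnected_Ici)
    (fun _ hy => h.hasDerivAt_gv hy.1) fun _ hy =>
      h.gv_deriv_nonneg hε hy.1 (h.D_lt_one_of_le hε hμ h0 hy.1 hy.2 hD).le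

lemma gv_pos_of_lt (hε : 0 ≤ ε) (hμ : 0 < μ) (hne : ε = 0 → ∀ y ∈ S, g y ≠ 0) {y₀ y : ℝ}
    (h0 : y₀ ∈ S) (hy : y ∈ S) (hlt : y₀ < y) (hD : A y₀ * C y₀ ^ 2 < 1) (hgv : 0 ≤ g y₀ * v y₀) : 0 < g y * v y := by
  have hm := h.monotoneOn_gv hε hμ h0 hD
  have hsub : Icc y₀ y ⊆ S ∩ Ici y₀ := fun z hz => ⟨h.Icc_subset h0 hy hz, hz.1⟩
  have h0' : y₀ ∈ S ∩ Ici y₀ := ⟨h0, le_refl y₀⟩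
  have hy' : y ∈ S ∩ Ici y₀ := ⟨hy, hlt.le⟩
  have h1 : 0 ≤ g y * v y := hgv.trans (hm h0' hy' hlt.le)
  refine h1.lt_of_ne fun h2 => ?_
  have hz : ∀ z ∈ Icc y₀ y, g z * v z = 0 := fun z hz => by
    have h3 : g z * v z ≤ g y * v y := hm (hsub hz) hy' hz.2
    have h4 : g y₀ * v y₀ ≤ g z * v z := hm h0' (hsub hz) hz.1
    linarith
  obtain ⟨z, hz1, hz2⟩ := exists_between hlt
  have hzS := (hsub ⟨hz1.le, hz2.le⟩).1
  have h3 : HasDerivAt (fun r => g r * v r) 0 z := by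
    apply (hasDerivAt_const z (0 : ℝ)).congr_of_eventuallyEq
    filter_upwards [Icc_mem_nhds hz1 hz2] with r hr using hz r hr
  have h4 := (h.hasDerivAt_gv hzS).unique h3
  have hA := h.A_pos z hzS
  have hC := h.C_pos z hzS
  have hz0 := h.pos z hzS
  have hD1 : 0 < 1 - A z * C z ^ 2 := sub_pos.2 (h.D_lt_one_of_le hε hμ h0 hzS hz1.le hD)
  have hor : g z ≠ 0 ∨ v z ≠ 0 ∧ 0 < ε := by
    rcases hε.eq_or_lt with hε0 | hε0
    · exact Or.inl (hne hε0.symm z hzS)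
    · exact (h.ne z hzS).imp_right fun hv => ⟨hv, hε0⟩
  rcases hor with hg | ⟨hv, hε0⟩
  · have : 0 < (1 - A z * C z ^ 2) * z ^ 2 * g z ^ 2 / (A z * C z) := by positivity
    have : 0 ≤ ε * v z ^ 2 * C z / z ^ 2 := by positivity
    linarith
  · have : 0 ≤ (1 - A z * C z ^ 2) * z ^ 2 * g z ^ 2 / (A z * C z) := by positivity
    have : 0 < ε * v z ^ 2 * C z / z ^ 2 := by positivity
    linarith

end BosonOrbit

/-- The quantity governing the logarithmic derivative of `A C ^ 2`. -/
def virial (ε μ : ℝ) (g v A C : ℝ → ℝ) (r : ℝ) : ℝ :=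
  r * (1 - A r + μ * ε * (A r * C r ^ 2) * v r ^ 2 / r ^ 2 +
    μ * r ^ 2 * g r ^ 2 * (A r * C r ^ 2 - 1)) / (A r * C r)

namespace BosonOrbit

variable {α ε μ : ℝ} {S : Set ℝ} {g v A C : ℝ → ℝ} (h : BosonOrbit α ε μ S g v A C)
include h

lemma hasDerivAt_virial {y : ℝ} (hy : y ∈ S) :
    HasDerivAt (virial ε μ g v A C)
      (2 * μ * y ^ 2 * g y ^ 2 * (2 * (A y * C y ^ 2) - 1) / (A y * C y)) y := h.hasDerivAt_K hy

lemma hasDerivAt_log_D_virial {y : ℝ} (hy : y ∈ S) :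
    HasDerivAt (fun r => log (A r * C r ^ 2)) (-(virial ε μ g v A C y * (C y / y ^ 2))) y := by
  have hy0 := h.pos y hy
  have hA := h.A_pos y hy
  have hC := h.C_pos y hy
  refine (h.hasDerivAt_log_D hy).congr_deriv ?_
  rw [virial]
  field_simp

lemma virial_ge (hε : 0 ≤ ε) (hμ : 0 ≤ μ) {y : ℝ} (hy : y ∈ S) (hD : 1 ≤ A y * C y ^ 2) :
    y * (1 - A y) / (A y * C y) ≤ virial ε μ g v A C y := by
  have hy0 := h.pos y hy
  have hA := h.A_pos y hy
  have hC := h.C_pos y hy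
  have h1 : 0 ≤ μ * ε * (A y * C y ^ 2) * v y ^ 2 / y ^ 2 := by positivity
  have h2 : 0 ≤ A y * C y ^ 2 - 1 := sub_nonneg.2 hD
  have h3 : 0 ≤ μ * y ^ 2 * g y ^ 2 * (A y * C y ^ 2 - 1) := by positivity
  rw [virial]
  gcongr
  linarith

lemma antitoneOn_log_D (hε : 0 ≤ ε) (hμ : 0 ≤ μ) (hD : ∀ y ∈ S, 1 ≤ A y * C y ^ 2) :
    AntitoneOn (fun r => log (A r * C r ^ 2)) S := by
  refine antitoneOn_of_hasDerivAt_nonpos h.ordConnected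
    (fun _ hy => h.hasDerivAt_log_D_virial hy) fun y hy => ?_
  have hy0 := h.pos y hy
  have hA := h.A_pos y hy
  have hA1 := h.A_le y hy
  have hC := h.C_pos y hy
  have h1 : 0 ≤ y * (1 - A y) / (A y * C y) := by
    have : 0 ≤ 1 - A y := sub_nonneg.2 hA1
    positivity
  have h2 := h1.trans (h.virial_ge hε hμ hy (hD y hy))
  rw [neg_nonpos]
  positivity

/-- An orbit whose scalar field is large when `A` is small never vanishes afterwards. -/
lemma pos_of_trap (hε : 0 ≤ ε) (hε1 : ε ≤ 1) (hμ : 0 < μ) {y₀ V η r : ℝ} (h0 : y₀ ∈ S)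
    (hD : A y₀ * C y₀ ^ 2 < 1) (hV : 0 < V) (hη : 0 < η) (hr : 0 < r) (hv : -V < v y₀)
    (hg : r + 2 * V / (y₀ * η) * √(A y₀) < g y₀) (hl : 1 + η ≤ μ * y₀ ^ 2 * r ^ 2) {y : ℝ}
    (hy : y ∈ S) (hle : y₀ ≤ y) : 0 < g y := by
  have hsub := h.Icc_subset h0 hy
  have hy0 := h.pos y₀ h0
  set κ := 2 * V / (y₀ * η) with hκ
  have hκ0 : 0 < κ := by positivity
  have hmain := neg_of_hasDerivAt_neg_of_eq_zero (f := fun x => r + κ * √(A x) - g x)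
    (a := y₀) (b := y)
    (fun x hx => ((((h.hasDerivAt_A x (hsub hx)).sqrt (h.A_pos x (hsub hx)).ne').const_mul
      κ).const_add r).sub (h.hasDerivAt_g x (hsub hx))) (by linarith) ?_ y ⟨hle, le_rfl⟩
  · have : 0 ≤ κ * √(A y) := by positivity
    linarith
  intro x hx hbef hx0
  have hxS := hsub hx
  have hx0' := h.pos x hxS
  have hA := h.A_pos x hxS
  have hC := h.C_pos x hxS
  have hA1 := h.A_le x hxS
  have hsub' : Icc y₀ x ⊆ S := h.Icc_subset h0 hxS
  have hgr : ∀ z ∈ Icc y₀ x, r ≤ g z := by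
    intro z hz
    have h1 : 0 ≤ κ * √(A z) := by positivity
    rcases hz.2.eq_or_lt with rfl | hlt
    · linarith
    · linarith [hbef z ⟨hz.1, hlt⟩]
  have hvm : MonotoneOn v (Icc y₀ x) := by
    refine monotoneOn_of_hasDerivAt_nonneg ordConnected_Icc
      (fun z hz => h.hasDerivAt_v z (hsub' hz)) fun z hz => ?_
    have h1 := hr.trans_le (hgr z hz)
    have h2 := h.D_lt_one_of_le hε hμ h0 (hsub' hz) hz.1 hD
    have h3 := h.A_pos z (hsub' hz)
    have h4 := h.C_pos z (hsub' hz)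
    have h5 : 0 ≤ 1 - A z * C z ^ 2 := by linarith
    positivity
  have hvx : -V < v x := hv.trans_le (hvm ⟨le_rfl, hx.1⟩ ⟨hx.1, le_rfl⟩ hx.1)
  have hDx := h.D_lt_one_of_le hε hμ h0 hxS hx.1 hD
  set s := √(A x) with hs
  have hs0 : 0 < s := sqrt_pos.2 hA
  have hss : s ^ 2 = A x := sq_sqrt hA.le
  have hCs : C x * s < 1 := by
    rw [← hss] at hDx
    have h1 : (C x * s) ^ 2 < 1 := by linarith
    nlinarith [mul_pos hC hs0]
  have hgx := hgr x ⟨hx.1, le_rfl⟩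
  have hA' : (1 - A x) / x - x * μ * (ε * A x * (v x * C x / x ^ 2) ^ 2 +
      (A x * C x ^ 2 + 1) * g x ^ 2) ≤ -(η / x) := by
    have h1 : 1 + η ≤ μ * x ^ 2 * g x ^ 2 := hl.trans (by gcongr; exact hx.1)
    have h2 : 0 ≤ x * μ * (ε * A x * (v x * C x / x ^ 2) ^ 2 + A x * C x ^ 2 * g x ^ 2) := by
      positivity
    have h3 : (1 - A x) / x - x * μ * g x ^ 2 ≤ -(η / x) := by
      rw [← sub_nonneg]
      have : -(η / x) - ((1 - A x) / x - x * μ * g x ^ 2)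
        = (μ * x ^ 2 * g x ^ 2 - (1 + η) + A x) / x := by field_simp; ring
      rw [this]
      apply div_nonneg _ hx0'.le
      linarith
    linarith
  have h1 : -(ε * v x * C x / x ^ 2) < V / (x ^ 2 * s) := by
    have h2 : -(ε * v x * C x / x ^ 2) ≤ V * C x / x ^ 2 := by
      rw [← neg_div, ← neg_mul]
      gcongr
      nlinarith [mul_le_mul_of_nonneg_right hε1 hV.le]
    refine h2.trans_lt ?_
    rw [div_lt_div_iff₀ (by positivity) (by positivity)]
    have h3 : 0 < V * x ^ 2 := by positivity
    nlinarith
  have h2 : κ * (((1 - A x) / x - x * μ * (ε * A x * (v x * C x / x ^ 2) ^ 2 +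
      (A x * C x ^ 2 + 1) * g x ^ 2)) / (2 * s)) ≤ -(V / (x ^ 2 * s)) := by
    calc _ ≤ κ * (-(η / x) / (2 * s)) := by gcongr
      _ = -(V / (y₀ * x * s)) := by rw [hκ]; field_simp
      _ ≤ _ := by
        rw [neg_le_neg_iff, sq]
        gcongr
        exact hx.1
  linarith

lemma false_of_one_le_D_of_tendsto_zero (hε : 0 ≤ ε) (hε1 : ε ≤ 1) (hμ : 0 < μ) {X : ℝ}
    (hX : 0 < X) (hS : S = Ioo 0 X) (hA0 : Tendsto A (𝓝[<] X) (𝓝 0))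
    (hD : ∀ y ∈ S, 1 ≤ A y * C y ^ 2) : False := by
  have h1S : X / 2 ∈ S := by rw [hS]; constructor <;> linarith
  set y₁ := X / 2 with hy1
  have hy1p := h.pos _ h1S
  have hKm : MonotoneOn (virial ε μ g v A C) S := by
    refine monotoneOn_of_hasDerivAt_nonneg h.ordConnected
      (fun _ hy => h.hasDerivAt_virial hy) fun y hy => ?_
    have hA := h.A_pos y hy
    have hC := h.C_pos y hy
    have h2 : 0 ≤ 2 * (A y * C y ^ 2) - 1 := by linarith [hD y hy]
    positivity
  set K₁ := virial ε μ g v A C y₁ with hK1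
  have hK1p : 0 < K₁ := by
    refine lt_of_lt_of_le ?_ (h.virial_ge hε hμ.le h1S (hD _ h1S))
    have hA := h.A_pos _ h1S
    have hC := h.C_pos _ h1S
    have : 0 < 1 - A y₁ := sub_pos.2 (h.A_lt hμ _ h1S)
    positivity
  set L := fun r => log (A r * C r ^ 2) with hL
  have hLm : AntitoneOn L S := h.antitoneOn_log_D hε hμ.le hD
  have hL0 : ∀ y ∈ S, 0 ≤ L y := fun y hy => log_nonneg (hD y hy)
  have hT : (S ∩ Ici y₁).OrdConnected := h.ordConnected.inter ordConnected_Ici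
  have h1T : y₁ ∈ S ∩ Ici y₁ := ⟨h1S, le_refl y₁⟩
  have hKge : ∀ y ∈ S ∩ Ici y₁, K₁ ≤ virial ε μ g v A C y := fun y hy => hKm h1S hy.1 hy.2
  have hyX : ∀ y ∈ S, y < X := fun y hy => by rw [hS] at hy; exact hy.2
  have hdiv : ∀ y ∈ S, 1 / (A y * C y) ≤ C y := fun y hy => by
    have hA := h.A_pos y hy
    have hC := h.C_pos y hy
    rw [div_le_iff₀ (by positivity)]
    linarith [hD y hy]
  set k := (1 + X ^ 4) / K₁ with hk
  have hkp : 0 < k := by positivity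
  have hρ : AntitoneOn (fun r => (g r ^ 2 + v r ^ 2) * exp (k * L r)) (S ∩ Ici y₁) := by
    refine antitoneOn_of_hasDerivAt_nonpos hT (fun y hy =>
      (((h.hasDerivAt_g y hy.1).pow 2).add ((h.hasDerivAt_v y hy.1).pow 2)).mul
        ((h.hasDerivAt_log_D_virial hy.1).const_mul k).exp) fun y hy => ?_
    have hA := h.A_pos y hy.1
    have hC := h.C_pos y hy.1
    have hy0 := h.pos y hy.1
    simp only [Pi.pow_apply, Pi.add_apply]
    push_cast
    set E := exp (k * log (A y * C y ^ 2)) with hE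
    have hEp : 0 < E := exp_pos _
    set c := C y / y ^ 2 with hc
    have hcp : 0 < c := by positivity
    have e1 : ε * v y * C y / y ^ 2 = ε * c * v y := by rw [hc]; ring
    have hq0 : 0 ≤ y ^ 2 * (A y * C y ^ 2 - 1) / (A y * C y) := by
      have : 0 ≤ A y * C y ^ 2 - 1 := sub_nonneg.2 (hD y hy.1)
      positivity
    set q := y ^ 2 * (A y * C y ^ 2 - 1) / (A y * C y) with hq
    have e2 : y ^ 2 * (1 - A y * C y ^ 2) * g y / (A y * C y) = -(q * g y) := by rw [hq]; ring
    have hqc : q ≤ X ^ 4 * c := by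
      have h3 : q ≤ y ^ 2 * C y := by
        rw [hq, div_le_iff₀ (by positivity)]
        nlinarith [sq_nonneg y]
      have h4 : y ^ 2 * C y = y ^ 4 * c := by rw [hc]; field_simp
      have h5 := (hyX y hy.1).le
      rw [h4] at h3
      exact h3.trans (by gcongr)
    have hkK : (1 + X ^ 4) * c ≤ k * (virial ε μ g v A C y * c) := by
      have h3 : 1 + X ^ 4 = k * K₁ := by rw [hk]; field_simp
      rw [h3, mul_assoc]
      have := hKge y hy
      gcongr
    rw [e1, e2]
    have h6 : 2 * (g y * v y) * (ε * c - q) ≤ (g y ^ 2 + v y ^ 2) * ((1 + X ^ 4) * c) := by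
      have h7 : |ε * c - q| ≤ (1 + X ^ 4) * c := by
        have : ε * c ≤ c := by nlinarith
        have : 0 ≤ ε * c := by positivity
        have : 0 ≤ X ^ 4 * c := by positivity
        rw [abs_le]; constructor <;> linarith
      have h8 : |2 * (g y * v y)| ≤ g y ^ 2 + v y ^ 2 := by
        rw [abs_le]; constructor <;> nlinarith [sq_nonneg (g y - v y), sq_nonneg (g y + v y)]
      calc _ ≤ |2 * (g y * v y) * (ε * c - q)| := le_abs_self _
        _ = |2 * (g y * v y)| * |ε * c - q| := abs_mul _ _
        _ ≤ _ := by gcongr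
    have h9 : (g y ^ 2 + v y ^ 2) * ((1 + X ^ 4) * c) ≤
        (g y ^ 2 + v y ^ 2) * (k * (virial ε μ g v A C y * c)) := by gcongr
    have h10 : (2 * (g y * v y) * (ε * c - q) -
        (g y ^ 2 + v y ^ 2) * (k * (virial ε μ g v A C y * c))) * E ≤ 0 :=
      mul_nonpos_of_nonpos_of_nonneg (by linarith) hEp.le
    convert h10 using 1
    ring
  set R := (g y₁ ^ 2 + v y₁ ^ 2) * exp (k * L y₁) with hR
  have hR0 : 0 ≤ R := by positivity
  have hgR : ∀ y ∈ S ∩ Ici y₁, g y ^ 2 ≤ R := fun y hy => by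
    have h3 := hρ h1T hy hy.2
    have h4 : 1 ≤ exp (k * L y) := one_le_exp (mul_nonneg hkp.le (hL0 y hy.1))
    have h5 : g y ^ 2 + v y ^ 2 ≤ (g y ^ 2 + v y ^ 2) * exp (k * L y) :=
      le_mul_of_one_le_right (by positivity) h4
    have h6 : (g y ^ 2 + v y ^ 2) * exp (k * L y) ≤ R := h3
    nlinarith [sq_nonneg (v y)]
  set k₂ := 4 * μ * R * X ^ 4 / K₁ with hk2
  have hk20 : 0 ≤ k₂ := by positivity
  have hKb : AntitoneOn (fun r => virial ε μ g v A C r + k₂ * L r) (S ∩ Ici y₁) := by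
    refine antitoneOn_of_hasDerivAt_nonpos hT (fun y hy =>
      (h.hasDerivAt_virial hy.1).add ((h.hasDerivAt_log_D_virial hy.1).const_mul k₂)) fun y hy => ?_
    have hA := h.A_pos y hy.1
    have hC := h.C_pos y hy.1
    have hy0 := h.pos y hy.1
    have hgy := hgR y hy
    have hyX := hyX y hy.1
    have h3 : (2 * (A y * C y ^ 2) - 1) / (A y * C y) ≤ 2 * C y := by
      rw [div_le_iff₀ (by positivity)]; linarith
    have h4 : 2 * μ * y ^ 2 * g y ^ 2 * (2 * (A y * C y ^ 2) - 1) / (A y * C y) ≤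
        4 * μ * R * X ^ 4 * (C y / y ^ 2) := by
      calc _ = 2 * μ * y ^ 2 * g y ^ 2 * ((2 * (A y * C y ^ 2) - 1) / (A y * C y)) := by ring
        _ ≤ 2 * μ * y ^ 2 * g y ^ 2 * (2 * C y) := by gcongr
        _ = 4 * μ * g y ^ 2 * y ^ 4 * (C y / y ^ 2) := by field_simp; ring
        _ ≤ _ := by gcongr
    have h5 : 4 * μ * R * X ^ 4 * (C y / y ^ 2) ≤
        k₂ * (virial ε μ g v A C y * (C y / y ^ 2)) := by
      have h3 : 4 * μ * R * X ^ 4 = k₂ * K₁ := by rw [hk2]; field_simp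
      rw [h3, mul_assoc]
      have := hKge y hy
      gcongr
    linarith
  set Km := K₁ + k₂ * L y₁ with hKm'
  have hfin : ∀ y ∈ S ∩ Ici y₁, y₁ ^ 2 * (1 - A y) ^ 2 ≤ Km ^ 2 * (A y * (A y₁ * C y₁ ^ 2)) := by
    intro y hy
    have hA := h.A_pos y hy.1
    have hA1 := h.A_le y hy.1
    have hC := h.C_pos y hy.1
    have hy0 := h.pos y hy.1
    have h3 : virial ε μ g v A C y ≤ Km := by
      have h4 : virial ε μ g v A C y + k₂ * L y ≤ Km := hKb h1T hy hy.2
      have := mul_nonneg hk20 (hL0 y hy.1)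
      linarith
    have h4 := (h.virial_ge hε hμ.le hy.1 (hD y hy.1)).trans h3
    rw [div_le_iff₀ (by positivity)] at h4
    have h5 : A y * C y ^ 2 ≤ A y₁ * C y₁ ^ 2 :=
      (log_le_log_iff (h.D_pos hy.1) (h.D_pos h1S)).1 (hLm h1S hy.1 hy.2)
    have h6 : y₁ * (1 - A y) ≤ Km * (A y * C y) :=
      le_trans (mul_le_mul_of_nonneg_right hy.2 (by linarith)) h4
    calc y₁ ^ 2 * (1 - A y) ^ 2 = (y₁ * (1 - A y)) ^ 2 := by ring
      _ ≤ (Km * (A y * C y)) ^ 2 := by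
        have : 0 ≤ y₁ * (1 - A y) := mul_nonneg hy1p.le (by linarith)
        gcongr
      _ = Km ^ 2 * (A y * (A y * C y ^ 2)) := by ring
      _ ≤ _ := by gcongr
  have hlim := le_of_tendsto_of_tendsto
    (((hA0.const_sub 1).pow 2).const_mul (y₁ ^ 2))
    ((hA0.mul_const (A y₁ * C y₁ ^ 2)).const_mul (Km ^ 2)) (by
      filter_upwards [Ioo_mem_nhdsLT (show y₁ < X by linarith)] with y hy
      exact hfin y ⟨by rw [hS]; exact ⟨hy1p.trans hy.1, hy.2⟩, hy.1.le⟩)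
  have : 0 < y₁ ^ 2 := by positivity
  simp at hlim
  linarith

lemma false_of_cubic_mass (hε : 0 ≤ ε) (hμ : 0 < μ) {y₁ c : ℝ} (hS : S = Ioi 0) (h1 : 0 < y₁)
    (hc : 0 < c) (hg : ∀ y, y₁ ≤ y → c ≤ g y ^ 2) : False := by
  have hSub : Ici y₁ ⊆ S := fun y hy => by rw [hS]; exact h1.trans_le hy
  have hm : MonotoneOn (fun r => r * (1 - A r) - μ * c * (r ^ 3 / 3)) (Ici y₁) := by
    refine monotoneOn_of_hasDerivAt_nonneg ordConnected_Ici (fun y hy =>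
      (h.hasDerivAt_mass (hSub hy)).sub (((hasDerivAt_pow 3 y).div_const 3).const_mul (μ * c)))
      fun y hy => ?_
    have h2 := h.mass_deriv_ge hε hμ.le (hSub hy)
    have h3 := hg y hy
    have h4 : μ * (y ^ 2 * c) ≤ μ * (y ^ 2 * g y ^ 2) := by gcongr
    push_cast
    norm_num
    linarith
  set d := μ * c with hd
  have hdp : 0 < d := by positivity
  set y := y₁ + 1 + 6 / d + d * y₁ ^ 3 with hy
  have h6 : 0 < 6 / d := by positivity
  have h7 : 0 < d * y₁ ^ 3 := by positivity
  have hy1 : y₁ ≤ y := by linarith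
  have h8 := hm (mem_Ici.2 le_rfl) (mem_Ici.2 hy1) hy1
  have hA := h.A_pos y (hSub hy1)
  have hA1 := h.A_le y₁ (hSub self_mem_Ici)
  have h9 : 0 ≤ y₁ * (1 - A y₁) := mul_nonneg h1.le (by linarith)
  simp only at h8
  have h10 : y * (1 - A y) ≤ y := by nlinarith
  have h11 : 6 ≤ d * y := by
    have : 6 = d * (6 / d) := by field_simp
    rw [this]; gcongr; linarith
  have h12 : 1 ≤ y := by linarith
  have h13 : d * y₁ ^ 3 ≤ y := by linarith
  have h14 : 6 * y ^ 2 ≤ d * y ^ 3 := by nlinarith [sq_nonneg y]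
  nlinarith

lemma false_of_one_le_D_of_pos (hε : 0 ≤ ε) (hμ : 0 < μ) (hS : S = Ioi 0)
    (hD : ∀ y ∈ S, 1 ≤ A y * C y ^ 2) {y₁ : ℝ} (h1 : 0 < y₁) (hg : ∀ y, y₁ ≤ y → 0 < g y) :
    False := by
  have hSub : Ici y₁ ⊆ S := fun y hy => by rw [hS]; exact h1.trans_le hy
  have hvm : AntitoneOn v (Ici y₁) := by
    refine antitoneOn_of_hasDerivAt_nonpos ordConnected_Ici
      (fun y hy => h.hasDerivAt_v y (hSub hy)) fun y hy => ?_
    have hA := h.A_pos y (hSub hy)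
    have hC := h.C_pos y (hSub hy)
    have h2 := hg y hy
    have h3 := hD y (hSub hy)
    apply div_nonpos_of_nonpos_of_nonneg _ (by positivity)
    have h4 : y ^ 2 * (1 - A y * C y ^ 2) ≤ 0 :=
      mul_nonpos_of_nonneg_of_nonpos (sq_nonneg y) (by linarith)
    exact mul_nonpos_of_nonpos_of_nonneg h4 h2.le
  by_cases hcase : ∀ y, y₁ ≤ y → 0 ≤ ε * v y
  · have hgm : MonotoneOn g (Ici y₁) := by
      refine monotoneOn_of_hasDerivAt_nonneg ordConnected_Ici
        (fun y hy => h.hasDerivAt_g y (hSub hy)) fun y hy => ?_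
      have hC := h.C_pos y (hSub hy)
      have := hcase y hy
      positivity
    have hg1 := hg y₁ le_rfl
    refine h.false_of_cubic_mass hε hμ hS h1 (c := g y₁ ^ 2) (by positivity) fun y hy => ?_
    have := hgm (mem_Ici.2 le_rfl) (mem_Ici.2 hy) hy
    gcongr
  push Not at hcase
  obtain ⟨y₂, h12, hv2⟩ := hcase
  have h2p := h1.trans_le h12
  set w := -(ε * v y₂) with hw
  have hwp : 0 < w := by linarith
  have hC1 : ∀ y ∈ S, 1 ≤ C y := fun y hy => by
    have hA := h.A_pos y hy
    have hA1 := h.A_le y hy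
    have hC := h.C_pos y hy
    have := hD y hy
    by_contra hlt
    push Not at hlt
    nlinarith [mul_pos hA hC]
  have hgm : AntitoneOn (fun r => g r - w * r⁻¹) (Ici y₂) := by
    refine antitoneOn_of_hasDerivAt_nonpos ordConnected_Ici
      (fun y hy => (h.hasDerivAt_g y (hSub (h12.trans hy))).sub
        ((hasDerivAt_inv (h2p.trans_le hy).ne').const_mul w)) fun y hy => ?_
    have hy' : y₂ ≤ y := hy
    have hC := hC1 y (hSub (h12.trans hy'))
    have hvy : v y ≤ v y₂ := hvm h12 (h12.trans hy') hy'
    have h3 : ε * v y ≤ -w := by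
      rw [hw, neg_neg]; gcongr
    have h4 : ε * v y * C y ≤ -w := by nlinarith
    have h5 : 0 < y ^ 2 := by have := h2p.trans_le hy'; positivity
    have : ε * v y * C y / y ^ 2 - w * -(y ^ 2)⁻¹ = (ε * v y * C y + w) / y ^ 2 := by
      field_simp; ring
    rw [this]
    exact div_nonpos_of_nonpos_of_nonneg (by linarith) h5.le
  have hgl : ∀ y, y₂ ≤ y → w * y⁻¹ ≤ g y := by
    intro y hy
    by_contra hlt
    push Not at hlt
    have h3 : Tendsto (fun r : ℝ => w * r⁻¹ + (g y - w * y⁻¹)) atTop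
        (𝓝 (w * 0 + (g y - w * y⁻¹))) :=
      (tendsto_inv_atTop_zero.const_mul w).add_const _
    obtain ⟨z, hz1, hz2⟩ := ((h3.eventually (gt_mem_nhds (show w * 0 + (g y - w * y⁻¹) < 0 by
      linarith))).and (eventually_ge_atTop y)).exists
    have h4 := hgm (mem_Ici.2 hy) (mem_Ici.2 (hy.trans hz2)) hz2
    have h5 := hg z (h12.trans (hy.trans hz2))
    simp only at h4
    linarith
  set l := μ * w ^ 2 with hl
  have hlp : 0 < l := by positivity
  have hll : ∀ y, y₂ ≤ y → l ≤ μ * (y ^ 2 * g y ^ 2) := fun y hy => by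
    have h3 := hgl y hy
    have hyp := h2p.trans_le hy
    have h4 : w ≤ y * g y := by
      rw [← div_eq_mul_inv, div_le_iff₀ hyp] at h3
      linarith
    rw [← mul_pow, hl]
    gcongr
  have hNm : MonotoneOn (fun r => r * (1 - A r) - l * r) (Ici y₂) := by
    refine monotoneOn_of_hasDerivAt_nonneg ordConnected_Ici (fun y hy =>
      (h.hasDerivAt_mass (hSub (h12.trans hy))).sub ((hasDerivAt_id y).const_mul l))
      fun y hy => ?_
    have h2 := h.mass_deriv_ge hε hμ.le (hSub (h12.trans hy))
    have h3 := hll y hy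
    linarith
  have hAl : ∀ y, 2 * y₂ ≤ y → l / 2 ≤ 1 - A y := fun y hy => by
    have hy2 : y₂ ≤ y := by linarith
    have h3 := hNm (mem_Ici.2 le_rfl) (mem_Ici.2 hy2) hy2
    have hA1 := h.A_le y₂ (hSub h12)
    have h9 : 0 ≤ y₂ * (1 - A y₂) := mul_nonneg h2p.le (by linarith)
    simp only at h3
    have hyp := h2p.trans_le hy2
    by_contra hlt
    push Not at hlt
    nlinarith
  have hLm : AntitoneOn (fun r => log (A r * C r ^ 2) + l / 2 * log r) (Ici (2 * y₂)) := by
    have hS2 : ∀ y ∈ Ici (2 * y₂), y ∈ S := fun y hy =>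
      hSub (show y₁ ≤ y by have : 2 * y₂ ≤ y := hy; linarith)
    refine antitoneOn_of_hasDerivAt_nonpos ordConnected_Ici
      (fun y hy => (h.hasDerivAt_log_D (hS2 y hy)).add
        ((hasDerivAt_log (h.pos y (hS2 y hy)).ne').const_mul (l / 2))) fun y hy => ?_
    have hyS := hS2 y hy
    have hyp := h.pos y hyS
    have hA := h.A_pos y hyS
    have hA1 := h.A_le y hyS
    have hC := h.C_pos y hyS
    have h3 := hAl y hy
    have h4 : 0 ≤ A y * C y ^ 2 - 1 := sub_nonneg.2 (hD y hyS)
    have h5 : 0 ≤ μ * ε * (A y * C y ^ 2) * v y ^ 2 / y ^ 2 +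
      μ * y ^ 2 * g y ^ 2 * (A y * C y ^ 2 - 1) := by positivity
    have h6 : l / 2 * y⁻¹ ≤ (1 - A y + μ * ε * (A y * C y ^ 2) * v y ^ 2 / y ^ 2 +
      μ * y ^ 2 * g y ^ 2 * (A y * C y ^ 2 - 1)) / (y * A y) := by
      rw [← div_eq_mul_inv]
      apply div_le_div₀ <;> first | positivity | nlinarith
    linarith
  obtain ⟨z, hz1, hz2⟩ := ((tendsto_log_atTop.const_mul_atTop (half_pos hlp)).eventually_gt_atTop
    (log (A (2 * y₂) * C (2 * y₂) ^ 2) + l / 2 * log (2 * y₂)) |>.and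
      (eventually_ge_atTop (2 * y₂))).exists
  have h3 := hLm (mem_Ici.2 le_rfl) (mem_Ici.2 hz2) hz2
  have hzS : z ∈ S := hSub (show y₁ ≤ z by linarith)
  have h4 := log_nonneg (hD z hzS)
  simp only at h3
  linarith

end BosonOrbit

namespace BosonOrbit

variable {α ε μ : ℝ} {S : Set ℝ} {g v A C : ℝ → ℝ} (h : BosonOrbit α ε μ S g v A C)
include h

lemma monotoneOn_v (hε : 0 ≤ ε) (hμ : 0 < μ) {y₀ : ℝ} (h0 : y₀ ∈ S) (hD : A y₀ * C y₀ ^ 2 < 1)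
    (hg : ∀ y ∈ S, y₀ ≤ y → 0 < g y) : MonotoneOn v (S ∩ Ici y₀) := by
  refine monotoneOn_of_hasDerivAt_nonneg (h.ordConnected.inter ordConnected_Ici)
    (fun z hz => h.hasDerivAt_v z hz.1) fun z hz => ?_
  have h1 := hg z hz.1 hz.2
  have h2 := h.D_lt_one_of_le hε hμ h0 hz.1 hz.2 hD
  have h3 := h.A_pos z hz.1
  have h4 := h.C_pos z hz.1
  have h5 : 0 ≤ 1 - A z * C z ^ 2 := by linarith
  positivity

lemma antitoneOn_g (hε : 0 ≤ ε) {y₀ : ℝ} (hv : ∀ y ∈ S, y₀ ≤ y → v y < 0) :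
    AntitoneOn g (S ∩ Ici y₀) := by
  refine antitoneOn_of_hasDerivAt_nonpos (h.ordConnected.inter ordConnected_Ici)
    (fun z hz => h.hasDerivAt_g z hz.1) fun z hz => ?_
  have h1 := hv z hz.1 hz.2
  have h4 := h.C_pos z hz.1
  rw [mul_assoc, mul_div_assoc]
  refine mul_nonpos_of_nonneg_of_nonpos hε (div_nonpos_of_nonpos_of_nonneg ?_ (sq_nonneg z))
  nlinarith

lemma hasDerivAt_virial_add_gv {y : ℝ} (hy : y ∈ S) :
    HasDerivAt (fun r => virial ε μ g v A C r + 4 * μ * (g r * v r))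
      (4 * μ * ε * v y ^ 2 * (C y / y ^ 2) + 2 * μ * y ^ 2 * g y ^ 2 / (A y * C y)) y := by
  have hA := h.A_pos y hy
  have hC := h.C_pos y hy
  have hy0 := h.pos y hy
  refine ((h.hasDerivAt_virial hy).add ((h.hasDerivAt_gv hy).const_mul (4 * μ))).congr_deriv ?_
  field_simp
  ring

lemma one_le_of_tendsto_zero (hε : 0 ≤ ε) (hμ : 0 < μ) {X y₀ f : ℝ}
    (hS : S = Ioo 0 X) (hA0 : Tendsto A (𝓝[<] X) (𝓝 0)) (h0 : y₀ ∈ S)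
    (hv : ∀ y ∈ S, y₀ ≤ y → -v y₀ ≥ |v y|) (hf : Tendsto g (𝓝[<] X) (𝓝 f)) :
    1 ≤ μ * X ^ 2 * f ^ 2 := by
  by_contra! hlt
  have hX' : Tendsto (fun r : ℝ => r) (𝓝[<] X) (𝓝 X) := tendsto_nhdsWithin_of_tendsto_nhds tendsto_id
  have hl : Tendsto (fun r => μ * r ^ 2 * g r ^ 2) (𝓝[<] X) (𝓝 (μ * X ^ 2 * f ^ 2)) :=
    ((hX'.pow 2).const_mul μ).mul (hf.pow 2)
  have hSev : ∀ᶠ y in 𝓝[<] X, y ∈ S ∩ Ici y₀ := by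
    have h1 : y₀ < X := by rw [hS] at h0; exact h0.2
    filter_upwards [Ioo_mem_nhdsLT h1] with y hy
    rw [hS]
    exact ⟨⟨(h.pos _ h0).trans hy.1, hy.2⟩, hy.1.le⟩
  have mk : ∀ {p : ℝ → Prop}, (∀ᶠ y in 𝓝[<] X, p y) → ∃ z ∈ S ∩ Ici y₀, ∀ y ∈ S, z ≤ y → p y := by
    intro p hp
    obtain ⟨a, ha, hap⟩ := (mem_nhdsLT_iff_exists_Ioo_subset).1 (hp.and hSev)
    have haX : a < X := ha
    have hm : (a + X) / 2 ∈ Ioo a X := ⟨by linarith, by linarith⟩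
    refine ⟨_, (hap hm).2, fun y hy hle => (hap ⟨hm.1.trans_le hle, ?_⟩).1⟩
    rw [hS] at hy
    exact hy.2
  set l := μ * X ^ 2 * f ^ 2 with hldef
  have hCev : ∀ᶠ y in 𝓝[<] X, A y - 1 + μ * y ^ 2 * g y ^ 2 < 0 := by
    refine ((hA0.sub_const 1).add hl).eventually (gt_mem_nhds ?_)
    linarith
  obtain ⟨y₂, hy2, hCneg⟩ := mk hCev
  have hCm : AntitoneOn C (S ∩ Ici y₂) := by
    refine antitoneOn_of_hasDerivAt_nonpos (h.ordConnected.inter ordConnected_Ici)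
      (fun z hz => h.hasDerivAt_C z hz.1) fun z hz => ?_
    have h3 := h.A_pos z hz.1
    have h4 := h.C_pos z hz.1
    have h5 := h.pos z hz.1
    exact div_nonpos_of_nonpos_of_nonneg
      (mul_nonpos_of_nonneg_of_nonpos h4.le (hCneg z hz.1 hz.2).le) (by positivity)
  set V := -v y₀ with hV
  set c := C y₂ with hc
  have hlim : Tendsto (fun y => 1 - A y - μ * ε * (A y * c ^ 2) * V ^ 2 / y₂ ^ 2 -
      μ * y ^ 2 * g y ^ 2 * (A y * c ^ 2) - μ * y ^ 2 * g y ^ 2) (𝓝[<] X)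
      (𝓝 (1 - 0 - μ * ε * (0 * c ^ 2) * V ^ 2 / y₂ ^ 2 - l * (0 * c ^ 2) - l)) := by
    have hAc := hA0.mul_const (c ^ 2)
    exact (((hA0.const_sub 1).sub (((hAc.const_mul (μ * ε)).mul_const (V ^ 2)).div_const _)).sub
      (hl.mul hAc)).sub hl
  have hAev : ∀ᶠ y in 𝓝[<] X, 0 < 1 - A y - μ * ε * (A y * c ^ 2) * V ^ 2 / y₂ ^ 2 -
      μ * y ^ 2 * g y ^ 2 * (A y * c ^ 2) - μ * y ^ 2 * g y ^ 2 := by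
    refine hlim.eventually (lt_mem_nhds ?_)
    simp only [zero_mul, mul_zero, zero_div, sub_zero]
    linarith
  have h2ev : ∀ᶠ y in 𝓝[<] X, y₂ ≤ y := by
    have h1 : y₂ < X := by have := hy2.1; rw [hS] at this; exact this.2
    filter_upwards [Ioo_mem_nhdsLT h1] with y hy using hy.1.le
  obtain ⟨y₃, hy3, hpos⟩ := mk (hAev.and h2ev)
  have hAm : MonotoneOn A (S ∩ Ici y₃) := by
    refine monotoneOn_of_hasDerivAt_nonneg (h.ordConnected.inter ordConnected_Ici)
      (fun z hz => h.hasDerivAt_A z hz.1) fun z hz => ?_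
    have h3 := h.A_pos z hz.1
    have h4 := h.C_pos z hz.1
    have h5 := h.pos z hz.1
    have hy2p := h.pos y₂ hy2.1
    obtain ⟨h6, h7⟩ := hpos z hz.1 hz.2
    have h8 : C z ≤ c := hCm ⟨hy2.1, le_refl y₂⟩ ⟨hz.1, h7⟩ h7
    have h9 : |v z| ≤ V := hv z hz.1 (le_trans hy2.2 h7)
    have h10 : v z ^ 2 ≤ V ^ 2 := sq_le_sq' (by linarith [neg_abs_le (v z)])
      ((le_abs_self _).trans h9)
    have h11 : μ * ε * (A z * C z ^ 2) * v z ^ 2 / z ^ 2 ≤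
        μ * ε * (A z * c ^ 2) * V ^ 2 / y₂ ^ 2 := by gcongr
    have h12 : μ * z ^ 2 * g z ^ 2 * (A z * C z ^ 2) ≤ μ * z ^ 2 * g z ^ 2 * (A z * c ^ 2) := by
      gcongr
    have e : (1 - A z) / z - z * μ * (ε * A z * (v z * C z / z ^ 2) ^ 2 +
        (A z * C z ^ 2 + 1) * g z ^ 2) = (1 - A z - μ * ε * (A z * C z ^ 2) * v z ^ 2 / z ^ 2 -
        μ * z ^ 2 * g z ^ 2 * (A z * C z ^ 2) - μ * z ^ 2 * g z ^ 2) / z := by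
      field_simp
      ring
    rw [e]
    apply div_nonneg _ h5.le
    linarith
  have h13 : A y₃ ≤ 0 := by
    refine ge_of_tendsto hA0 ?_
    have h1 : y₃ < X := by have := hy3.1; rw [hS] at this; exact this.2
    filter_upwards [Ioo_mem_nhdsLT h1] with y hy
    exact hAm ⟨hy3.1, le_refl y₃⟩
      ⟨by rw [hS]; exact ⟨(h.pos _ hy3.1).trans hy.1, hy.2⟩, hy.1.le⟩ hy.1.le
  linarith [h.A_pos _ hy3.1]

/-- An orbit on which `A` degenerates while `A C ^ 2 < 1` is trapped. -/
lemma exists_trap (hε : 0 ≤ ε) (hμ : 0 < μ) {X y₀ : ℝ}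
    (hX : 0 < X) (hS : S = Ioo 0 X) (hA0 : Tendsto A (𝓝[<] X) (𝓝 0)) (h0 : y₀ ∈ S)
    (hD : A y₀ * C y₀ ^ 2 < 1) (hg : ∀ y ∈ S, y₀ ≤ y → 0 < g y)
    (hv : ∀ y ∈ S, y₀ ≤ y → v y < 0) :
    ∃ V > 0, ∃ η > 0, ∃ r > 0, ∃ y ∈ S, A y * C y ^ 2 < 1 ∧ -V < v y ∧
      r + 2 * V / (y * η) * √(A y) < g y ∧ 1 + η < μ * y ^ 2 * r ^ 2 := by
  have hy0 := h.pos _ h0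
  have h0X : y₀ < X := by rw [hS] at h0; exact h0.2
  have hyX : ∀ y ∈ S, y < X := fun y hy => by rw [hS] at hy; exact hy.2
  have hIoo : ∀ y ∈ Ioo y₀ X, y ∈ S ∩ Ici y₀ := fun y hy =>
    ⟨by rw [hS]; exact ⟨hy0.trans hy.1, hy.2⟩, hy.1.le⟩
  have h0T : y₀ ∈ S ∩ Ici y₀ := ⟨h0, le_refl y₀⟩
  have hvm := h.monotoneOn_v hε hμ h0 hD hg
  have hgm := h.antitoneOn_g hε hv
  set V₀ := -v y₀ with hV0
  have hV0p : 0 < V₀ := by have := hv y₀ h0 le_rfl; linarith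
  have hvb : ∀ y ∈ S, y₀ ≤ y → |v y| ≤ V₀ := fun y hy hle => by
    rw [abs_of_neg (hv y hy hle), hV0]
    have := hvm h0T ⟨hy, hle⟩ hle
    linarith
  obtain ⟨f, hf⟩ : ∃ f, Tendsto g (𝓝[<] X) (𝓝 f) := by
    have h1 := MonotoneOn.tendsto_nhdsWithin_Ioo_left (f := fun y => -g y) (y := y₀) (x := X)
      ⟨_, ⟨(by linarith : y₀ < (y₀ + X) / 2), by linarith⟩⟩
      (fun x hx z hz hxz => neg_le_neg (hgm (hIoo x hx) (hIoo z hz) hxz)) (by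
        refine ⟨0, ?_⟩
        rintro _ ⟨y, hy, rfl⟩
        have := hg y (hIoo y hy).1 hy.1.le
        simp only
        linarith)
    exact ⟨_, by simpa using h1.neg⟩
  have hSev : ∀ᶠ y in 𝓝[<] X, y ∈ S ∩ Ici y₀ := by
    filter_upwards [Ioo_mem_nhdsLT h0X] with y hy using hIoo y hy
  have hf1 := h.one_le_of_tendsto_zero hε hμ hS hA0 h0 hvb hf
  have hf0 : 0 ≤ f := ge_of_tendsto hf (hSev.mono fun y hy => (hg y hy.1 hy.2).le)
  have hfp : 0 < f := by
    refine hf0.lt_of_ne ?_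
    rintro rfl
    norm_num at hf1
  have hfg : ∀ y ∈ S, y₀ ≤ y → f ≤ g y := fun y hy hle => by
    refine le_of_tendsto hf ?_
    filter_upwards [Ioo_mem_nhdsLT (hyX y hy)] with z hz
    exact hgm ⟨hy, hle⟩ (hIoo z ⟨lt_of_le_of_lt hle hz.1, hz.2⟩) hz.1.le
  set g₀ := g y₀ with hg0
  have hgg : ∀ y ∈ S, y₀ ≤ y → g y ≤ g₀ := fun y hy hle => hgm h0T ⟨hy, hle⟩ hle
  set K := virial ε μ g v A C with hK
  set G := fun r => K r + 4 * μ * (g r * v r) with hG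
  have hGd := fun y (hy : y ∈ S ∩ Ici y₀) => h.hasDerivAt_virial_add_gv hy.1
  have hTc : ∀ z, (S ∩ Ici z).OrdConnected := fun z => h.ordConnected.inter ordConnected_Ici
  have hGm : MonotoneOn G (S ∩ Ici y₀) := by
    refine monotoneOn_of_hasDerivAt_nonneg (hTc y₀) hGd fun y hy => ?_
    have hA := h.A_pos y hy.1
    have hC := h.C_pos y hy.1
    positivity
  have hGK : ∀ y ∈ S, y₀ ≤ y → G y ≤ K y := fun y hy hle => by
    have h1 := mul_neg_of_pos_of_neg (hg y hy hle) (hv y hy hle)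
    have : 4 * μ * (g y * v y) ≤ 0 := by nlinarith
    simp only [hG]
    linarith
  obtain ⟨y₂, hy2, B, hB, hKB⟩ : ∃ y₂ ∈ S ∩ Ici y₀, ∃ B > 0, ∀ y ∈ S, y₂ ≤ y → K y ≤ B := by
    by_cases hc : ∀ y ∈ S, y₀ ≤ y → G y ≤ 0
    · have hg0p := hg y₀ h0 le_rfl
      refine ⟨y₀, h0T, 4 * μ * (g₀ * V₀), by positivity, fun y hy hle => ?_⟩
      have h1 := hc y hy hle
      have h2 := hgg y hy hle
      have h3 := hvb y hy hle
      rw [abs_of_neg (hv y hy hle)] at h3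
      have h4 := hg y hy hle
      have h5 : 4 * μ * (g y * -v y) ≤ 4 * μ * (g₀ * V₀) := by
        have := hv y hy hle
        gcongr
        linarith
      simp only [hG] at h1
      linarith
    push Not at hc
    obtain ⟨y₂, hy2S, hy2, hGp⟩ := hc
    have hKp : ∀ y ∈ S, y₂ ≤ y → 0 < K y := fun y hy hle =>
      hGp.trans_le ((hGm ⟨hy2S, hy2⟩ ⟨hy, hy2.trans hle⟩ hle).trans (hGK y hy (hy2.trans hle)))
    have hLm : AntitoneOn (fun r => log (A r * C r ^ 2)) (S ∩ Ici y₂) := by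
      refine antitoneOn_of_hasDerivAt_nonpos (hTc y₂)
        (fun y hy => h.hasDerivAt_log_D_virial hy.1) fun y hy => ?_
      have hC := h.C_pos y hy.1
      have := hKp y hy.1 hy.2
      have : 0 ≤ K y * (C y / y ^ 2) := by positivity
      linarith
    have hD2 := h.D_lt_one_of_le hε hμ h0 hy2S hy2 hD
    set d := 1 - A y₂ * C y₂ ^ 2 with hd
    have hdp : 0 < d := by linarith
    have hDd : ∀ y ∈ S, y₂ ≤ y → d ≤ 1 - A y * C y ^ 2 := fun y hy hle => by
      have h5 : A y * C y ^ 2 ≤ A y₂ * C y₂ ^ 2 :=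
        (log_le_log_iff (h.D_pos hy) (h.D_pos hy2S)).1 (hLm ⟨hy2S, le_refl y₂⟩ ⟨hy, hle⟩ hle)
      linarith
    set k := 2 * μ * X ^ 2 * g₀ ^ 2 / (d * y₀ ^ 2 * f) with hk
    have hkp : 0 ≤ k := by positivity
    have hKv : AntitoneOn (fun r => K r - k * v r) (S ∩ Ici y₂) := by
      refine antitoneOn_of_hasDerivAt_nonpos (hTc y₂)
        (fun y hy => (h.hasDerivAt_virial hy.1).sub ((h.hasDerivAt_v y hy.1).const_mul k))
        fun y hy => ?_
      have hA := h.A_pos y hy.1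
      have hC := h.C_pos y hy.1
      have hyp := h.pos y hy.1
      have hle : y₀ ≤ y := hy2.trans hy.2
      have h1 := hgg y hy.1 hle
      have h2 := hfg y hy.1 hle
      have h3 := hDd y hy.1 hy.2
      have h4 := (hyX y hy.1).le
      have h5 := h.D_lt_one_of_le hε hμ h0 hy.1 hle hD
      have h6 := hg y hy.1 hle
      have e1 : 2 * μ * y ^ 2 * g y ^ 2 * (2 * (A y * C y ^ 2) - 1) / (A y * C y) ≤
          2 * μ * X ^ 2 * g₀ ^ 2 * 1 / (A y * C y) := by
        refine div_le_div_of_nonneg_right ?_ (by positivity)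
        have e3 : 2 * μ * y ^ 2 * g y ^ 2 * (2 * (A y * C y ^ 2) - 1) ≤
            2 * μ * y ^ 2 * g y ^ 2 * 1 := mul_le_mul_of_nonneg_left (by linarith) (by positivity)
        exact e3.trans (by gcongr)
      have e2 : 2 * μ * X ^ 2 * g₀ ^ 2 * 1 / (A y * C y) ≤
          k * (y ^ 2 * (1 - A y * C y ^ 2) * g y / (A y * C y)) := by
        have : 2 * μ * X ^ 2 * g₀ ^ 2 * 1 = k * (y₀ ^ 2 * d * f) := by rw [hk]; field_simp
        rw [this, mul_div_assoc]
        have : 0 < 1 - A y * C y ^ 2 := hdp.trans_le h3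
        gcongr
      linarith
    refine ⟨y₂, ⟨hy2S, hy2⟩, K y₂ + k * V₀, ?_, fun y hy hle => ?_⟩
    · have := hKp y₂ hy2S le_rfl
      positivity
    · have h1 : K y - k * v y ≤ K y₂ - k * v y₂ := hKv ⟨hy2S, le_refl y₂⟩ ⟨hy, hle⟩ hle
      have h2 := hv y hy (hy2.trans hle)
      have h3 := hvb y₂ hy2S hy2
      rw [abs_of_neg (hv y₂ hy2S hy2)] at h3
      have h4 : k * -v y₂ ≤ k * V₀ := by gcongr
      have h5 : k * v y ≤ 0 := by nlinarith
      linarith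
  have h2T : y₂ ∈ S ∩ Ici y₂ := ⟨hy2.1, le_refl y₂⟩
  have hle2 : ∀ {y}, y₂ ≤ y → y₀ ≤ y := fun hy => le_trans hy2.2 hy
  set k₀ := 2 * μ * y₀ ^ 2 * f ^ 2 with hk0
  have hk0p : 0 < k₀ := by positivity
  set k₃ := B / (y₀ ^ 2 * k₀) with hk3
  have hk3p : 0 < k₃ := by positivity
  have hLG : MonotoneOn (fun r => log (A r * C r ^ 2) + k₃ * G r) (S ∩ Ici y₂) := by
    refine monotoneOn_of_hasDerivAt_nonneg (hTc y₂) (fun y hy =>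
      (h.hasDerivAt_log_D_virial hy.1).add ((hGd y ⟨hy.1, hle2 hy.2⟩).const_mul k₃)) fun y hy => ?_
    have hA := h.A_pos y hy.1
    have hC := h.C_pos y hy.1
    have hyp := h.pos y hy.1
    have hle : y₀ ≤ y := hle2 hy.2
    have h2 := hfg y hy.1 hle
    have h5 := h.D_lt_one_of_le hε hμ h0 hy.1 hle hD
    have h7 := hKB y hy.1 hy.2
    have e0 : 0 ≤ 4 * μ * ε * v y ^ 2 * (C y / y ^ 2) := by positivity
    have e1 : K y * (C y / y ^ 2) ≤ k₃ * (2 * μ * y ^ 2 * g y ^ 2 / (A y * C y)) := by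
      calc K y * (C y / y ^ 2) ≤ B * (C y / y ^ 2) := by gcongr
        _ ≤ B * (C y / y₀ ^ 2) := by gcongr
        _ ≤ B * (1 / (A y * C y) / y₀ ^ 2) := by
          gcongr
          rw [le_div_iff₀ (by positivity)]
          linarith
        _ = k₃ * (k₀ / (A y * C y)) := by rw [hk3]; field_simp
        _ ≤ _ := by rw [hk0]; gcongr
    have := mul_nonneg hk3p.le e0
    linarith
  set D₀ := exp (log (A y₂ * C y₂ ^ 2) + k₃ * G y₂ - k₃ * B) with hD0
  have hD0p : 0 < D₀ := exp_pos _
  have hDD : ∀ y ∈ S, y₂ ≤ y → D₀ ≤ A y * C y ^ 2 := fun y hy hle => by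
    have h1 := hLG h2T ⟨hy, hle⟩ hle
    have h2 := (hGK y hy (hle2 hle)).trans (hKB y hy hle)
    have h3 : k₃ * G y ≤ k₃ * B := by gcongr
    simp only at h1
    rw [← exp_log (h.D_pos hy), hD0]
    apply exp_le_exp.2
    linarith
  have hX' : Tendsto (fun r : ℝ => r) (𝓝[<] X) (𝓝 X) := tendsto_nhdsWithin_of_tendsto_nhds tendsto_id
  have hsA : Tendsto (fun r => √(A r)) (𝓝[<] X) (𝓝 0) := by
    simpa using hA0.sqrt
  have hl1 : 1 < μ * X ^ 2 * f ^ 2 := by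
    have hlim := le_of_tendsto_of_tendsto
      ((hA0.const_sub 1).sub ((hsA.const_mul B).div_const y₀))
      (((((hX'.pow 2).const_mul μ).mul (hf.pow 2))).mul_const (1 - D₀)) (by
        filter_upwards [Ioo_mem_nhdsLT (hyX _ hy2.1), hSev] with y hy hyT
        have hyS := hyT.1
        have hA := h.A_pos y hyS
        have hC := h.C_pos y hyS
        have hyp := h.pos y hyS
        have h5 := h.D_lt_one_of_le hε hμ h0 hyS hyT.2 hD
        have h7 := hKB y hyS hy.1.le
        have h8 := hDD y hyS hy.1.le
        have hAC : A y * C y ≤ √(A y) := by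
          apply le_sqrt_of_sq_le
          nlinarith
        have e1 : K y * (A y * C y) / y = 1 - A y + μ * ε * (A y * C y ^ 2) * v y ^ 2 / y ^ 2 +
            μ * y ^ 2 * g y ^ 2 * (A y * C y ^ 2 - 1) := by
          rw [hK, virial]; field_simp
        have e2 : K y * (A y * C y) / y ≤ B * √(A y) / y₀ := by
          have := hyT.2
          have : K y * (A y * C y) ≤ B * √(A y) := by
            calc _ ≤ B * (A y * C y) := by gcongr
              _ ≤ _ := by gcongr
          gcongr
          exact hyT.2
        have e3 : 0 ≤ μ * ε * (A y * C y ^ 2) * v y ^ 2 / y ^ 2 := by positivity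
        have e4 : μ * y ^ 2 * g y ^ 2 * (1 - A y * C y ^ 2) ≤
          μ * y ^ 2 * g y ^ 2 * (1 - D₀) := by gcongr
        linarith)
    simp only [sub_zero, mul_zero, zero_div] at hlim
    have : 0 < μ * X ^ 2 * f ^ 2 := by positivity
    nlinarith
  set η := (μ * X ^ 2 * f ^ 2 - 1) / 2 with hη
  have hηp : 0 < η := by linarith
  obtain ⟨r, ⟨hr1, hr2⟩, hr0⟩ : ∃ r, (1 + η < μ * X ^ 2 * r ^ 2 ∧ 0 < r) ∧ r < f := by
    have h1 : Tendsto (fun r : ℝ => μ * X ^ 2 * r ^ 2) (𝓝[<] f) (𝓝 (μ * X ^ 2 * f ^ 2)) :=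
      ((tendsto_nhdsWithin_of_tendsto_nhds tendsto_id).pow 2).const_mul _
    exact (((h1.eventually (lt_mem_nhds (by linarith))).and
      (eventually_nhdsWithin_of_eventually_nhds (lt_mem_nhds hfp))).and self_mem_nhdsWithin).exists
  refine ⟨V₀ + 1, by linarith, η, hηp, r, hr2, ?_⟩
  have e1 : Tendsto (fun y => r + 2 * (V₀ + 1) / (y * η) * √(A y)) (𝓝[<] X)
      (𝓝 (r + 2 * (V₀ + 1) / (X * η) * 0)) :=
    ((tendsto_const_nhds.div (hX'.mul_const η) (by positivity)).mul hsA).const_add r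
  have e2 : Tendsto (fun y : ℝ => μ * y ^ 2 * r ^ 2) (𝓝[<] X) (𝓝 (μ * X ^ 2 * r ^ 2)) :=
    ((hX'.pow 2).const_mul μ).mul_const _
  obtain ⟨y, ⟨h1, h2⟩, h3⟩ := (((e1.eventually (gt_mem_nhds (show _ < f by
    rw [mul_zero, add_zero]; exact hr0))).and (e2.eventually (lt_mem_nhds hr1))).and hSev).exists
  refine ⟨y, h3.1, h.D_lt_one_of_le hε hμ h0 h3.1 h3.2 hD, ?_, h1.trans_le (hfg y h3.1 h3.2), h2⟩
  have := neg_abs_le (v y)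
  have := hvb y h3.1 h3.2
  linarith

end BosonOrbit

namespace BosonOrbit

variable {α ε μ : ℝ} {S : Set ℝ} {g v A C : ℝ → ℝ} (h : BosonOrbit α ε μ S g v A C)
include h

/-- Where `D < 1`, decay of `g` bounds the mass density by a multiple of `(g v)'`. -/
lemma mass_deriv_le (hε : 0 < ε) (hμ : 0 < μ) (hα : 0 < α) {c y : ℝ} (hyS : y ∈ S) (hcp : 0 < c)
    (h1y : 1 ≤ y) (hDy : A y * C y ^ 2 < 1) (hφy : c < y * (1 - A y * C y ^ 2))
    (hgp : 0 < g y) (hvn : v y < 0) (hεcy : 1 ≤ ε * c * y) :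
    μ * (ε * (A y * C y) * (v y ^ 2 * C y / y ^ 2) + y ^ 2 * (A y * C y ^ 2 + 1) * g y ^ 2) +
      2 * μ * α * (1 + 2 / c) * -(g y * v y) ≤ 2 * μ * α * (1 + 2 / c) *
        (y * (ε * v y ^ 2 * C y / y ^ 2 + (1 - A y * C y ^ 2) * y ^ 2 * g y ^ 2 / (A y * C y))) := by
  have hA := h.A_pos y hyS
  have hA1 := h.A_le y hyS
  have hC := h.C_pos y hyS
  have hyp := h.pos y hyS
  have hAC := h.AC_le y hyS
  have hd : 0 < 1 - A y * C y ^ 2 := by linarith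
  set a := ε * v y ^ 2 * C y / y ^ 2 with ha
  set b := (1 - A y * C y ^ 2) * y ^ 2 * g y ^ 2 / (A y * C y) with hb
  have ha0 : 0 ≤ a := by positivity
  have hb0 : 0 ≤ b := by positivity
  have hGab : -(g y * v y) ≤ (a + b) * y / 2 := by
    have hgv0 : 0 ≤ -(g y * v y) := by nlinarith
    refine (sq_le_sq₀ hgv0 (by positivity)).1 ?_
    have e1 : a * b * A y = ε * (1 - A y * C y ^ 2) * (g y * v y) ^ 2 := by
      rw [ha, hb]; field_simp
    have e2 : a * b * A y ≤ a * b := mul_le_of_le_one_right (by positivity) hA1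
    have e3 : (g y * v y) ^ 2 ≤ (g y * v y) ^ 2 * (ε * (y * (1 - A y * C y ^ 2)) * y) := by
      refine le_mul_of_one_le_right (sq_nonneg _) (hεcy.trans ?_)
      gcongr
    have e4 : (g y * v y) ^ 2 * (ε * (y * (1 - A y * C y ^ 2)) * y) ≤ a * b * y ^ 2 := by
      calc _ = ε * (1 - A y * C y ^ 2) * (g y * v y) ^ 2 * y ^ 2 := by ring
        _ ≤ _ := by rw [← e1]; gcongr
    have e5 : a * b * y ^ 2 ≤ ((a + b) * y / 2) ^ 2 := by
      nlinarith [mul_nonneg (sq_nonneg (a - b)) (sq_nonneg y)]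
    rw [neg_sq]
    linarith
  have hN' : μ * (ε * (A y * C y) * (v y ^ 2 * C y / y ^ 2) +
      y ^ 2 * (A y * C y ^ 2 + 1) * g y ^ 2) ≤ μ * α * (a + 2 * b * y / c) := by
    have e1 : ε * (A y * C y) * (v y ^ 2 * C y / y ^ 2) ≤ α * a := by
      calc _ = (A y * C y) * a := by rw [ha]; ring
        _ ≤ _ := by gcongr
    have e2 : y ^ 2 * g y ^ 2 ≤ α * (b * y / c) := by
      have e3 : y ^ 2 * g y ^ 2 * (1 - A y * C y ^ 2) = A y * C y * b := by
        rw [hb]; field_simp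
      rw [← mul_div_assoc, le_div_iff₀ hcp]
      calc y ^ 2 * g y ^ 2 * c ≤ y ^ 2 * g y ^ 2 * (y * (1 - A y * C y ^ 2)) := by gcongr
        _ = A y * C y * (b * y) := by linear_combination y * e3
        _ ≤ _ := by gcongr
    have e4 : y ^ 2 * (A y * C y ^ 2 + 1) * g y ^ 2 ≤ 2 * (α * (b * y / c)) := by
      have : y ^ 2 * (A y * C y ^ 2 + 1) * g y ^ 2 ≤ 2 * (y ^ 2 * g y ^ 2) := by
        nlinarith [mul_nonneg (sq_nonneg y) (sq_nonneg (g y))]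
      linarith
    calc _ ≤ μ * (α * a + 2 * (α * (b * y / c))) := by gcongr
      _ = _ := by ring
  have hfin : μ * α * (a + 2 * b * y / c) ≤ 2 * μ * α * (1 + 2 / c) * ((a + b) * y / 2) := by
    have e1 : 2 * μ * α * (1 + 2 / c) * ((a + b) * y / 2) = μ * α * ((a + b) * y + 2 * a * y / c + 2 * b * y / c) := by
      field_simp; ring
    rw [e1]
    have e2 : 0 ≤ 2 * a * y / c := by positivity
    have e3 : a ≤ (a + b) * y := by nlinarith
    gcongr
    linarith
  have hk2 : 2 * μ * α * (1 + 2 / c) * -(g y * v y) ≤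
      2 * μ * α * (1 + 2 / c) * ((a + b) * y / 2) := by gcongr
  linarith

/-- An orbit which exists for all radii and decays has a finite mass. -/
lemma tendsto_mass (hε : 0 ≤ ε) (hμ : 0 < μ) (hα : 0 < α) (hS : S = Ioi 0) {y₀ : ℝ} (h0 : y₀ ∈ S)
    (hD : A y₀ * C y₀ ^ 2 < 1) (hg : ∀ y ∈ S, y₀ ≤ y → 0 < g y)
    (hv : ∀ y ∈ S, y₀ ≤ y → v y < 0) :
    0 < ε ∧ ∃ m > 0, Tendsto (fun y => y * (1 - A y)) atTop (𝓝 m) := by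
  have hy0 := h.pos _ h0
  have hSub : ∀ {y}, y₀ ≤ y → y ∈ S := fun hy => by rw [hS]; exact hy0.trans_le hy
  have hgm := h.antitoneOn_g hε hv
  have hεp : 0 < ε := by
    refine hε.lt_of_ne ?_
    rintro rfl
    have hgp := hg y₀ h0 le_rfl
    have hgm' : MonotoneOn g (Ici y₀) :=
      monotoneOn_of_hasDerivAt_nonneg ordConnected_Ici (fun y hy => h.hasDerivAt_g y (hSub hy))
        fun y _ => by simp
    refine h.false_of_cubic_mass hε hμ hS hy0 (c := g y₀ ^ 2) (by positivity) fun y hy => ?_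
    have := hgm' self_mem_Ici (mem_Ici.2 hy) hy
    gcongr
  refine ⟨hεp, ?_⟩
  have hNm := h.monotoneOn_mass hε hμ.le
  set N := fun y => y * (1 - A y) with hN
  have hN0 : 0 < N y₀ := mul_pos hy0 (sub_pos.2 (h.A_lt hμ y₀ h0))
  have hNle : ∀ y, y₀ ≤ y → N y ≤ y := fun y hy => by
    have := h.A_pos y (hSub hy)
    have := hy0.trans_le hy
    simp only [hN]
    nlinarith
  have hl4 : ∀ y, 2 * y₀ ≤ y → μ * y ^ 2 * g y ^ 2 ≤ 4 := by
    intro y hy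
    have hyy : y₀ ≤ y := by linarith
    have hyp := hy0.trans_le hyy
    have hm : MonotoneOn (fun r => r * (1 - A r) - μ * g y ^ 2 * (r ^ 3 / 3)) (Icc y₀ y) := by
      refine monotoneOn_of_hasDerivAt_nonneg ordConnected_Icc (fun z hz =>
        (h.hasDerivAt_mass (hSub hz.1)).sub (((hasDerivAt_pow 3 z).div_const 3).const_mul _))
        fun z hz => ?_
      have h2 := h.mass_deriv_ge hε hμ.le (hSub hz.1)
      have h3 : g y ≤ g z := hgm ⟨hSub hz.1, hz.1⟩ ⟨hSub hyy, hyy⟩ hz.2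
      have h5 := hg y (hSub hyy) hyy
      have h4 : μ * (z ^ 2 * g y ^ 2) ≤ μ * (z ^ 2 * g z ^ 2) := by gcongr
      push_cast
      norm_num
      linarith
    have h1 := hm ⟨le_rfl, hyy⟩ ⟨hyy, le_rfl⟩ hyy
    have h2 := hNle y hyy
    simp only [hN] at h1 h2 hN0
    have h3 : y₀ ^ 3 ≤ (y / 2) ^ 3 := by gcongr; linarith
    have h4 : μ * g y ^ 2 * (y₀ ^ 3 / 3) ≤ μ * g y ^ 2 * ((y / 2) ^ 3 / 3) := by gcongr
    by_contra! hlt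
    nlinarith
  set y₁ := 2 * y₀ with hy1
  have h01 : y₀ ≤ y₁ := by linarith
  have hDlt : ∀ y, y₀ ≤ y → A y * C y ^ 2 < 1 := fun y hy =>
    h.D_lt_one_of_le hε hμ h0 (hSub hy) hy hD
  set c := min (N y₀ / 8) (y₁ * (1 - A y₁ * C y₁ ^ 2) / 2) with hc
  have hφ1 : 0 < y₁ * (1 - A y₁ * C y₁ ^ 2) := mul_pos (by linarith) (sub_pos.2 (hDlt _ h01))
  have hcp : 0 < c := lt_min (by linarith) (by linarith)
  have hc1 : c ≤ N y₀ / 8 := min_le_left _ _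
  have hc2 : c ≤ y₁ * (1 - A y₁ * C y₁ ^ 2) / 2 := min_le_right _ _
  have hφ : ∀ y, y₁ ≤ y → c < y * (1 - A y * C y ^ 2) := by
    intro y hy
    have := neg_of_hasDerivAt_neg_of_eq_zero (f := fun r => c - r * (1 - A r * C r ^ 2))
      (a := y₁) (b := y)
      (fun x hx => (((hasDerivAt_id x).mul ((h.hasDerivAt_D (hSub (h01.trans hx.1))).const_sub
        1)).const_sub c)) (by linarith) ?_ y ⟨hy, le_rfl⟩
    · linarith
    intro x hx _ hx0
    have hxS := hSub (h01.trans hx.1)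
    have hA := h.A_pos x hxS
    have hC := h.C_pos x hxS
    have hxp := h.pos x hxS
    have hlx := hl4 x hx.1
    have hNx : N y₀ ≤ N x := hNm h0 hxS (h01.trans hx.1)
    have hDx := hDlt x (h01.trans hx.1)
    have hW : 0 ≤ μ * ε * (A x * C x ^ 2) * v x ^ 2 / x ^ 2 := by positivity
    have hφx : x * (1 - A x * C x ^ 2) = c := by linarith
    have h1 : 0 ≤ x * (1 - A x + μ * ε * (A x * C x ^ 2) * v x ^ 2 / x ^ 2 +
        μ * x ^ 2 * g x ^ 2 * (A x * C x ^ 2 - 1)) := by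
      have h2 : μ * x ^ 2 * g x ^ 2 * c ≤ 4 * c := by gcongr
      have h3 := mul_nonneg hxp.le hW
      have h4 : x * (μ * x ^ 2 * g x ^ 2 * (A x * C x ^ 2 - 1)) = -(μ * x ^ 2 * g x ^ 2 * c) := by
        rw [← hφx]; ring
      simp only [hN] at hNx hc1 hN0
      nlinarith
    have h2 := nonneg_of_mul_nonneg_right h1 hxp
    have h3 : 0 ≤ x * (A x * C x ^ 2 * (1 - A x + μ * ε * (A x * C x ^ 2) * v x ^ 2 / x ^ 2 +
        μ * x ^ 2 * g x ^ 2 * (A x * C x ^ 2 - 1)) / (x * A x)) := by positivity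
    simp only [id]
    linarith
  set k := 2 * μ * α * (1 + 2 / c) with hk
  have hkp : 0 < k := by positivity
  set y₂ := max y₁ (max 1 (1 / (ε * c))) with hy2
  have h12 : y₁ ≤ y₂ := le_max_left _ _
  have hy21 : 1 ≤ y₂ := (le_max_left _ _).trans (le_max_right _ _)
  have hy22 : 1 / (ε * c) ≤ y₂ := (le_max_right _ _).trans (le_max_right _ _)
  have hB : AntitoneOn (fun r => N r + k * (r * -(g r * v r))) (Ici y₂) := by
    refine antitoneOn_of_hasDerivAt_nonpos ordConnected_Ici (fun y hy => by
      have hyS := hSub (h01.trans (h12.trans hy))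
      exact (h.hasDerivAt_mass hyS).add
        (((hasDerivAt_id y).mul (h.hasDerivAt_gv hyS).neg).const_mul k)) fun y hy => ?_
    have hy' : y₂ ≤ y := hy
    have hy0' := h01.trans (h12.trans hy')
    have hyS := hSub hy0'
    have hεcy : 1 ≤ ε * c * y := by
      have := hy22.trans hy'
      rw [div_le_iff₀ (by positivity)] at this
      linarith
    have := h.mass_deriv_le hεp hμ hα hyS hcp (hy21.trans hy') (hDlt y hy0')
      (hφ y (h12.trans hy')) (hg y hyS hy0') (hv y hyS hy0') hεcy
    simp only [id, hk, Pi.neg_apply]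
    linarith
  have h02 : y₀ ≤ y₂ := h01.trans h12
  have hmono : Monotone fun y => N (max y y₂) := fun a b hab =>
    hNm (hSub (h02.trans (le_max_right _ _))) (hSub (h02.trans (le_max_right _ _)))
      (max_le_max_right _ hab)
  have hbdd : BddAbove (range fun y => N (max y y₂)) := by
    refine ⟨N y₂ + k * (y₂ * -(g y₂ * v y₂)), ?_⟩
    rintro _ ⟨y, rfl⟩
    have hle : y₂ ≤ max y y₂ := le_max_right _ _
    have h1 := hB self_mem_Ici hle hle
    have h2 : 0 ≤ k * (max y y₂ * -(g (max y y₂) * v (max y y₂))) := by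
      have := mul_neg_of_pos_of_neg (hg _ (hSub (h02.trans hle)) (h02.trans hle))
        (hv _ (hSub (h02.trans hle)) (h02.trans hle))
      have : 0 < max y y₂ := by linarith
      have : 0 ≤ -(g (max y y₂) * v (max y y₂)) := by linarith
      positivity
    simp only at h1 ⊢
    linarith
  have hlim := tendsto_atTop_ciSup hmono hbdd
  refine ⟨_, ?_, hlim.congr' ?_⟩
  · have h1 := le_ciSup hbdd y₂
    simp only [max_self] at h1
    exact hN0.trans_le ((hNm h0 (hSub h02) h02).trans h1)
  · filter_upwards [eventually_ge_atTop y₂] with y hy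
    rw [max_eq_left hy]

end BosonOrbit

/-- The set `W` contains at least `m` points. -/
def HasPoints (W : Set ℝ) (m : ℕ) : Prop := ∃ z : Fin m → ℝ, StrictMono z ∧ ∀ i, z i ∈ W

lemma HasPoints.mono {W W' : Set ℝ} {m : ℕ} (h : HasPoints W m) (hW : W ⊆ W') : HasPoints W' m :=
  let ⟨z, hz, hzW⟩ := h
  ⟨z, hz, fun i => hW (hzW i)⟩

lemma hasPoints_of_finset {W : Set ℝ} {m : ℕ} {F : Finset ℝ} (hF : ↑F ⊆ W) (hm : F.card = m) :
    HasPoints W m :=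
  ⟨F.orderEmbOfFin hm, (F.orderEmbOfFin hm).strictMono, fun i =>
    hF (F.orderEmbOfFin_mem hm i)⟩

lemma finite_of_not_hasPoints {W : Set ℝ} {m : ℕ} (h : ¬HasPoints W m) : W.Finite := by
  by_contra hW
  obtain ⟨F, hF, hm⟩ := Set.Infinite.exists_subset_card_eq hW m
  exact h (hasPoints_of_finset hF hm)

lemma ncard_eq_of_hasPoints {W : Set ℝ} {n : ℕ} (h : HasPoints W n) (h' : ¬HasPoints W (n + 1)) :
    W.ncard = n := by
  have hfin := finite_of_not_hasPoints h'
  apply le_antisymm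
  · by_contra! hlt
    obtain ⟨F, hF, hm⟩ := Finset.exists_subset_card_eq (s := hfin.toFinset) (n := n + 1)
      (by rwa [← Set.ncard_eq_toFinset_card W hfin])
    exact h' (hasPoints_of_finset (fun x hx => by simpa using hF hx) hm)
  · obtain ⟨z, hz, hzW⟩ := h
    have h1 : (range z).ncard = n := by
      rw [← Set.image_univ, Set.ncard_image_of_injective _ hz.injective]
      simp
    rw [← h1]
    exact Set.ncard_le_ncard (range_subset_iff.2 hzW) hfin

/-- A nonvanishing continuous function on an interval has a constant sign. -/
lemma exists_sign {s : Set ℝ} (hs : s.OrdConnected) {f : ℝ → ℝ} (hc : ContinuousOn f s)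
    (hne : ∀ y ∈ s, f y ≠ 0) : ∃ σ : ℝ, (σ = 1 ∨ σ = -1) ∧ ∀ y ∈ s, 0 < σ * f y := by
  by_contra! hcon
  obtain ⟨y₁, h1, h1'⟩ := hcon 1 (Or.inl rfl)
  obtain ⟨y₂, h2, h2'⟩ := hcon (-1) (Or.inr rfl)
  obtain ⟨y, hy, hy'⟩ := hs.isPreconnected.intermediate_value h1 h2 hc
    (show (0 : ℝ) ∈ Icc (f y₁) (f y₂) from ⟨by linarith, by linarith⟩)
  exact hne y hy hy'

/-- A function changes sign at a zero with nonzero derivative. -/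
lemma exists_mul_neg_of_hasDerivAt {f : ℝ → ℝ} {d x η : ℝ} (hf : HasDerivAt f d x) (hd : d ≠ 0)
    (hx : f x = 0) (hη : 0 < η) : ∃ a ∈ Ioo (x - η) x, ∃ b ∈ Ioo x (x + η), f a * f b < 0 := by
  have h1 : ∀ᶠ y in 𝓝[≠] x, 0 < d * slope f x y :=
    (hasDerivAt_iff_tendsto_slope.1 hf).const_mul d |>.eventually_const_lt (mul_self_pos.2 hd)
  have hl := (h1.filter_mono (nhdsWithin_mono x (s := Iio x) fun y hy => ne_of_lt hy)).and
    (Ioo_mem_nhdsLT (show x - η < x by linarith))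
  have hr := (h1.filter_mono (nhdsWithin_mono x (s := Ioi x) fun y hy => ne_of_gt hy)).and
    (Ioo_mem_nhdsGT (show x < x + η by linarith))
  obtain ⟨a, ha, ha'⟩ := hl.exists
  obtain ⟨b, hb, hb'⟩ := hr.exists
  refine ⟨a, ha', b, hb', ?_⟩
  rw [slope_def_field, hx, sub_zero] at ha hb
  have h2 : 0 < d ^ 2 * (f a * f b) / ((a - x) * (b - x)) := by
    have := mul_pos ha hb
    rwa [mul_div_assoc', mul_div_assoc', div_mul_div_comm, mul_mul_mul_comm, ← sq] at this
  have h3 : (a - x) * (b - x) < 0 := mul_neg_of_neg_of_pos (by linarith [ha'.2])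
    (by linarith [hb'.1])
  by_contra! h4
  have h5 : 0 ≤ d ^ 2 * (f a * f b) := mul_nonneg (sq_nonneg d) h4
  linarith [div_nonpos_of_nonneg_of_nonpos h5 h3.le]

section

variable {α t t₀ y Y : ℝ}

lemma tendsto_bosonSol {ι : Type*} {l : Filter ι} {u w : ι → ℝ} (h : Y ∈ bosonDom α t₀)
    (hu : Tendsto u l (𝓝 t₀)) (hw : Tendsto w l (𝓝 y)) (hwY : ∀ᶠ i in l, w i ∈ Icc 0 Y)
    (hy : y ∈ Icc 0 Y) :
    Tendsto (fun i => bosonSol α (u i) (w i)) l (𝓝 (bosonSol α t₀ y)) := by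
  obtain ⟨δ, hδ, Q, hQ, hQ'⟩ := bosonDom_extend h
  rw [(hQ' t₀ (by simpa)).2 y ⟨hy.1, by linarith [hy.2]⟩]
  refine ((hQ.tendsto (t₀, y)).comp (hu.prodMk_nhds hw)).congr' ?_
  filter_upwards [hwY, hu (Metric.ball_mem_nhds t₀ hδ)] with i hi hi'
  exact ((hQ' (u i) hi').2 _ ⟨hi.1, by linarith [hi.2]⟩).symm

lemma eventually_mem_bosonDom (h : Y ∈ bosonDom α t₀) : ∀ᶠ t in 𝓝 t₀, Y ∈ bosonDom α t := by
  obtain ⟨δ, hδ, Q, hQ, hQ'⟩ := bosonDom_extend h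
  filter_upwards [Metric.ball_mem_nhds t₀ hδ] with t ht
  exact bosonDom_of_le (hQ' t ht).1 h.1 (by linarith)

lemma continuousAt_bosonSol_param (h : Y ∈ bosonDom α t₀) :
    ContinuousAt (fun t => bosonSol α t Y) t₀ :=
  tendsto_bosonSol h tendsto_id tendsto_const_nhds (Eventually.of_forall fun _ => ⟨h.1, le_rfl⟩)
    ⟨h.1, le_rfl⟩

lemma continuousAt_bosonG_param (h : Y ∈ bosonDom α t₀) :
    ContinuousAt (fun t => bosonG α t Y) t₀ :=
  continuousAt_const.add (continuousAt_bosonSol_param h).fst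

lemma continuousAt_bosonV_param (h : Y ∈ bosonDom α t₀) :
    ContinuousAt (fun t => bosonV α t Y) t₀ :=
  continuousAt_const.mul (continuousAt_bosonSol_param h).snd.snd.snd

lemma continuousAt_bosonA_param (h : Y ∈ bosonDom α t₀) :
    ContinuousAt (fun t => bosonA α t Y) t₀ :=
  continuousAt_const.sub (continuousAt_const.mul (continuousAt_bosonSol_param h).snd.snd.fst)

lemma continuousAt_bosonC_param (h : Y ∈ bosonDom α t₀) :
    ContinuousAt (fun t => bosonC α t Y) t₀ :=
  continuousAt_const.add (continuousAt_bosonSol_param h).snd.fst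

variable (α t) in
/-- The positive zeros of the scalar field of the orbit with parameter `t`. -/
def bosonZeros : Set ℝ := {y | y ∈ bosonDom α t ∧ 0 < y ∧ bosonG α t y = 0}

lemma bosonG_one (hα : 0 < α) (h : y ∈ bosonDom α 1) : bosonG α 1 y = 1 := by
  rcases h.1.eq_or_lt with h0 | h0
  · rw [← h0, bosonG_zero hα]
  have h1 := constant_of_has_deriv_right_zero (continuousOn_bosonG h) (fun s hs => by
    rcases hs.1.eq_or_lt with h2 | h2
    · rw [← h2]
      exact hasDerivWithinAt_bosonG_zero hα
    · have := hasDerivAt_bosonG (bosonDom_of_le h hs.1 hs.2.le) h2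
      simp only [sub_self, zero_mul, zero_div] at this
      exact this.hasDerivWithinAt) y ⟨h.1, le_rfl⟩
  rw [h1, bosonG_zero hα]

lemma not_hasPoints_bosonZeros_one (hα : 0 < α) {n : ℕ} :
    ¬HasPoints (bosonZeros α 1) (n + 1) := by
  rintro ⟨z, -, hz⟩
  have h1 := (hz 0).2.2
  rw [bosonG_one hα (hz 0).1] at h1
  exact one_ne_zero h1

/-- Zeros persist under small changes of the parameter. -/
lemma eventually_hasPoints (hα : 0 < α) (ht1 : t₀ < 1) {m : ℕ}
    (h : HasPoints (bosonZeros α t₀) m) : ∀ᶠ t in 𝓝 t₀, HasPoints (bosonZeros α t) m := by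
  obtain ⟨z, hz, hzW⟩ := h
  have hη : ∀ᶠ η in 𝓝[>] (0 : ℝ), ∀ i, (0 < z i - η) ∧ ∀ j, i < j → z i + η < z j - η := by
    refine eventually_all.2 fun i => ?_
    refine Eventually.and ?_ (eventually_all.2 fun j => ?_)
    · have : Tendsto (fun η => z i - η) (𝓝[>] 0) (𝓝 (z i - 0)) :=
        tendsto_nhdsWithin_of_tendsto_nhds (Continuous.tendsto (by fun_prop) 0)
      exact this.eventually_const_lt (by simpa using (hzW i).2.1)
    · by_cases hij : i < j
      · have : Tendsto (fun η => z j - η - (z i + η)) (𝓝[>] 0) (𝓝 (z j - 0 - (z i + 0))) :=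
          tendsto_nhdsWithin_of_tendsto_nhds (Continuous.tendsto (by fun_prop) 0)
        filter_upwards [this.eventually_const_lt (show 0 < z j - 0 - (z i + 0) by
          linarith [hz hij])] with η hη _
        linarith
      · exact Eventually.of_forall fun _ hij' => absurd hij' hij
  obtain ⟨η, hη, hη0⟩ := (hη.and self_mem_nhdsWithin).exists
  have hη0' : 0 < η := hη0
  have key : ∀ i, ∀ᶠ t in 𝓝 t₀, ∃ x ∈ bosonZeros α t, |x - z i| < η := by
    intro i
    obtain ⟨hd, hp, h0⟩ := hzW i
    obtain ⟨Z, hZ, hzZ⟩ := exists_gt_mem_bosonDom hd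
    have hV : bosonV α t₀ (z i) ≠ 0 := (bosonG_ne_zero_or hα hd hp).resolve_left (by simpa using h0)
    have hC := bosonC_pos hd
    have h1t : 0 < 1 - t₀ := by linarith
    obtain ⟨a, ha, b, hb, hab⟩ := exists_mul_neg_of_hasDerivAt (hasDerivAt_bosonG hd hp)
      (by positivity) h0 (lt_min hη0' (sub_pos.2 hzZ))
    have hm1 := min_le_left η (Z - z i)
    have hm2 := min_le_right η (Z - z i)
    have ha0 : 0 < a := by linarith [(hη i).1, ha.1]
    have hbZ : b ≤ Z := by linarith [hb.2]
    have hab' : a < b := ha.2.trans hb.1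
    have had := bosonDom_of_le hZ ha0.le (by linarith)
    have hbd := bosonDom_of_le hZ (by linarith) hbZ
    have hev := ((continuousAt_bosonG_param had).mul (continuousAt_bosonG_param hbd)).eventually_lt
      continuousAt_const hab
    filter_upwards [hev, eventually_mem_bosonDom hbd] with t ht htd
    have hct : ContinuousOn (bosonG α t) (uIcc a b) :=
      (continuousOn_bosonG htd).mono (by rw [uIcc_of_le hab'.le]; exact Icc_subset_Icc_left ha0.le)
    have h0m : (0 : ℝ) ∈ uIcc (bosonG α t a) (bosonG α t b) := by
      rw [mem_uIcc]
      rcases mul_neg_iff.1 ht with h2 | h2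
      · exact Or.inr ⟨h2.2.le, h2.1.le⟩
      · exact Or.inl ⟨h2.1.le, h2.2.le⟩
    obtain ⟨x, hx, hx0⟩ := intermediate_value_uIcc hct h0m
    rw [uIcc_of_le hab'.le] at hx
    refine ⟨x, ⟨bosonDom_of_le htd (ha0.le.trans hx.1) hx.2, ha0.trans_le hx.1, hx0⟩, ?_⟩
    rw [abs_lt]
    constructor <;> linarith [hx.1, hx.2, ha.1, hb.2]
  filter_upwards [eventually_all.2 key] with t ht
  choose x hx hxz using ht
  refine ⟨x, fun i j hij => ?_, hx⟩
  have h1 := (hη i).2 j hij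
  have h2 := abs_lt.1 (hxz i)
  have h3 := abs_lt.1 (hxz j)
  linarith [h2.2, h3.1]

/-- Zeros in a compact interval persist in the limit. -/
lemma hasPoints_of_frequently (hα : 0 < α) (h : Y ∈ bosonDom α t₀) {m : ℕ}
    (hf : ∃ᶠ t in 𝓝 t₀, t < 1 ∧ HasPoints (bosonZeros α t ∩ Iic Y) m) :
    HasPoints (bosonZeros α t₀) m := by
  obtain ⟨u, hu, hu'⟩ := exists_seq_forall_of_frequently hf
  choose hu1 w hw hwW using hu'
  have hwY : ∀ j i, w j i ∈ Icc 0 Y := fun j i => ⟨(hwW j i).1.2.1.le, (hwW j i).2⟩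
  obtain ⟨z, hz, φ, hφ, hlim⟩ := (isCompact_univ_pi fun _ : Fin m => isCompact_Icc (a := (0 : ℝ))
    (b := Y)).tendsto_subseq (x := w) fun j => mem_univ_pi.2 (hwY j)
  have hzY : ∀ i, z i ∈ Icc 0 Y := mem_univ_pi.1 hz
  have hlim' : ∀ i, Tendsto (fun j => w (φ j) i) atTop (𝓝 (z i)) := fun i =>
    (tendsto_pi_nhds.1 hlim) i
  have huφ := hu.comp hφ.tendsto_atTop
  have hG : ∀ i, bosonG α t₀ (z i) = 0 := fun i => by
    have h1 : Tendsto (fun j => bosonG α (u (φ j)) (w (φ j) i)) atTop (𝓝 (bosonG α t₀ (z i))) :=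
      tendsto_const_nhds.add (tendsto_bosonSol h huφ (hlim' i)
        (Eventually.of_forall fun j => hwY _ i) (hzY i)).fst_nhds
    exact tendsto_nhds_unique h1 (tendsto_const_nhds.congr fun j => ((hwW (φ j) i).1.2.2).symm)
  have hz0 : ∀ i, 0 < z i := fun i => (hzY i).1.lt_of_ne fun h0 => by
    have := hG i
    rw [← h0, bosonG_zero hα] at this
    exact one_ne_zero this
  have hzd : ∀ i, z i ∈ bosonDom α t₀ := fun i => bosonDom_of_le h (hzY i).1 (hzY i).2
  refine ⟨z, fun i k hik => ?_, fun i => ⟨hzd i, hz0 i, hG i⟩⟩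
  have hle : z i ≤ z k := le_of_tendsto_of_tendsto' (hlim' i) (hlim' k) fun j =>
    (hw (φ j) hik).le
  refine hle.lt_of_ne fun heq => ?_
  have hx : ∀ j, ∃ x ∈ Ioo (w j i) (w j k), bosonV α (u j) x = 0 := fun j => by
    have hd : ∀ x ∈ Icc (w j i) (w j k), x ∈ bosonDom α (u j) ∧ 0 < x := fun x hx =>
      ⟨bosonDom_of_le (hwW j k).1.1 ((hwY j i).1.trans hx.1) hx.2, (hwW j i).1.2.1.trans_le hx.1⟩
    obtain ⟨x, hx, hx0⟩ := exists_hasDerivAt_eq_zero (hw j hik)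
      (fun x hx => (hasDerivAt_bosonG (hd x hx).1 (hd x hx).2).continuousAt.continuousWithinAt)
      ((hwW j i).1.2.2.trans (hwW j k).1.2.2.symm)
      fun x hx => hasDerivAt_bosonG (hd x (Ioo_subset_Icc_self hx)).1
        (hd x (Ioo_subset_Icc_self hx)).2
    refine ⟨x, hx, ?_⟩
    have hxd := hd x (Ioo_subset_Icc_self hx)
    have hC := bosonC_pos hxd.1
    have hx0' := hxd.2
    have h1 : 1 - u j ≠ 0 := (sub_pos.2 (hu1 j)).ne'
    rw [div_eq_zero_iff, mul_eq_zero, mul_eq_zero] at hx0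
    rcases hx0 with ((h2 | h2) | h2) | h2
    · exact absurd h2 h1
    · exact h2
    · exact absurd h2 hC.ne'
    · exact absurd h2 (by positivity)
  choose x hx hx0 using hx
  have hxl : Tendsto (fun j => x (φ j)) atTop (𝓝 (z i)) :=
    tendsto_of_tendsto_of_tendsto_of_le_of_le (hlim' i) (heq ▸ hlim' k)
      (fun j => (hx (φ j)).1.le) fun j => (hx (φ j)).2.le
  have hV : Tendsto (fun j => bosonV α (u (φ j)) (x (φ j))) atTop (𝓝 (bosonV α t₀ (z i))) :=
    (hxl.pow 2).mul (tendsto_bosonSol h huφ hxl (Eventually.of_forall fun j =>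
      ⟨(hwY _ i).1.trans (hx _).1.le, (hx _).2.le.trans (hwY _ k).2⟩) (hzY i)).snd_nhds.snd_nhds.snd_nhds
  have hV0 : bosonV α t₀ (z i) = 0 :=
    tendsto_nhds_unique hV (tendsto_const_nhds.congr fun j => (hx0 (φ j)).symm)
  exact (bosonG_ne_zero_or hα (hzd i) (hz0 i)).elim (fun h1 => h1 (hG i)) fun h1 => h1 hV0

end

section

variable {α y Y : ℝ}

/-- A continuous function with vanishing derivative on `(0, y)` takes its value at `0`. -/
lemma eq_of_hasDerivAt_zero {f : ℝ → ℝ} (hy : 0 ≤ y) (hc : ContinuousOn f (Icc 0 y))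
    (hd : ∀ s ∈ Ioo 0 y, HasDerivAt f 0 s) : f y = f 0 := by
  rcases hy.eq_or_lt with rfl | hy
  · rfl
  obtain ⟨c, -, h⟩ := exists_hasDerivAt_eq_slope f 0 hy hc hd
  rw [Pi.zero_apply, eq_comm, div_eq_zero_iff, sub_eq_zero, sub_zero] at h
  exact h.resolve_right hy.ne'

lemma bosonA_param_zero (h : y ∈ bosonDom α 0) : bosonA α 0 y = 1 := by
  rcases h.1.eq_or_lt with rfl | hy
  · exact bosonA_zero
  have h1 := eq_of_hasDerivAt_zero (f := fun s => s * (1 - bosonA α 0 s)) h.1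
    (continuousOn_id.mul (continuousOn_const.sub (continuousOn_bosonA h))) fun s hs => by
      have := hasDerivAt_mul_one_sub_bosonA (bosonDom_of_le h hs.1.le hs.2.le) hs.1
      simpa using this
  have h2 : y * (1 - bosonA α 0 y) = 0 := by simpa using h1
  linarith [(mul_eq_zero.1 h2).resolve_left hy.ne']

lemma bosonC_param_zero (hα : 0 < α) (h : y ∈ bosonDom α 0) : bosonC α 0 y = α := by
  refine (eq_of_hasDerivAt_zero h.1 (continuousOn_bosonC h) fun s hs => ?_).trans (bosonC_zero hα)
  have hs' := bosonDom_of_le h hs.1.le hs.2.le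
  have := hasDerivAt_bosonC hs' hs.1
  rw [bosonA_param_zero hs'] at this
  simpa using this

lemma bosonDom_param_zero (hα : 0 < α) : bosonDom α 0 = Ici 0 :=
  bosonDom_eq_Ici_of_le_bosonA hα ⟨le_rfl, zero_le_one⟩ one_pos fun _ hy =>
    (bosonA_param_zero hy).ge

/-- The flat orbit is a multiple of `sin (κ y) / y` with `κ ^ 2 = α ^ 2 - 1`. -/
lemma bosonG_param_zero (hα : 0 < α) {κ : ℝ} (hκ : κ ^ 2 = α ^ 2 - 1) (hy : 0 ≤ y) :
    κ * (y * bosonG α 0 y) * cos (κ * y) =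
      (bosonG α 0 y + α * (bosonV α 0 y / y)) * sin (κ * y) := by
  have hd : ∀ {s : ℝ}, 0 ≤ s → s ∈ bosonDom α 0 := fun hs => by rwa [bosonDom_param_zero hα]
  have hV : ∀ s, bosonV α 0 s / s = s * (bosonSol α 0 s).2.2.2 := fun s => by
    rcases eq_or_ne s 0 with rfl | hs
    · simp
    · rw [bosonV]; field_simp
  have hcV : ContinuousOn (fun s => bosonV α 0 s / s) (Icc 0 y) := by
    simp only [hV]
    exact continuousOn_id.mul (continuousOn_bosonSol (hd hy)).snd.snd.snd
  have hcG := continuousOn_bosonG (hd hy)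
  have h1 := eq_of_hasDerivAt_zero (f := fun s => κ * (s * bosonG α 0 s) * cos (κ * s) -
    (bosonG α 0 s + α * (bosonV α 0 s / s)) * sin (κ * s)) hy (by fun_prop) fun s hs => by
      have hs0 := hs.1
      have hG := hasDerivAt_bosonG (hd hs0.le) hs0
      have hV := hasDerivAt_bosonV (hd hs0.le) hs0
      rw [bosonA_param_zero (hd hs0.le), bosonC_param_zero hα (hd hs0.le)] at hV
      rw [bosonC_param_zero hα (hd hs0.le)] at hG
      have hk : HasDerivAt (fun s => κ * s) κ s := by
        simpa using (hasDerivAt_id s).const_mul κ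
      refine (((((hasDerivAt_id s).mul hG).const_mul κ).mul hk.cos).sub
        ((hG.add ((hV.div (hasDerivAt_id s) hs0.ne').const_mul α)).mul hk.sin)).congr_deriv ?_
      simp only [id, Pi.mul_apply, Pi.add_apply, Pi.div_apply]
      field_simp
      ring_nf
      rw [hκ]
      ring
  simp only [mul_zero, sin_zero, zero_mul, sub_zero] at h1
  linarith

/-- The flat orbit has infinitely many zeros. -/
lemma hasPoints_bosonZeros_param_zero (hα : 1 < α) (m : ℕ) : HasPoints (bosonZeros α 0) m := by
  have hα0 : 0 < α := by linarith
  set κ := √(α ^ 2 - 1) with hκ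
  have hκ2 : κ ^ 2 = α ^ 2 - 1 := sq_sqrt (by nlinarith)
  have hκ0 : 0 < κ := sqrt_pos.2 (by nlinarith)
  have hp : ∀ i : ℕ, 0 < ((i + 1 : ℕ) : ℝ) * π / κ := fun i => by positivity
  refine ⟨fun i => ((i + 1 : ℕ) : ℝ) * π / κ, fun i j hij => ?_, fun i => ⟨?_, hp i, ?_⟩⟩
  · have : ((i + 1 : ℕ) : ℝ) < ((j + 1 : ℕ) : ℝ) := by
      exact_mod_cast Nat.succ_lt_succ hij
    have := pi_pos
    simp only
    gcongr
  · rw [bosonDom_param_zero hα0]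
    exact (hp i).le
  · have h1 := bosonG_param_zero hα0 hκ2 (hp i).le
    rw [mul_div_cancel₀ _ hκ0.ne', sin_nat_mul_pi, mul_zero] at h1
    have h2 : cos (((i + 1 : ℕ) : ℝ) * π) ≠ 0 := fun h0 => by
      have := sin_sq_add_cos_sq (((i + 1 : ℕ) : ℝ) * π)
      rw [h0, sin_nat_mul_pi] at this
      norm_num at this
    have h3 := (mul_eq_zero.1 h1).resolve_right h2
    have h4 := (mul_eq_zero.1 h3).resolve_left hκ0.ne'
    exact (mul_eq_zero.1 h4).resolve_left (hp i).ne'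

end

section

variable {α t t₀ y Y σ : ℝ}

lemma bosonOrbit_sign (hα : 0 < α) (ht : t ∈ Icc (0 : ℝ) 1) (hσ : σ = 1 ∨ σ = -1) :
    BosonOrbit α (1 - t) t (bosonDom α t ∩ Ioi 0) (fun y => σ * bosonG α t y)
      (fun y => σ * bosonV α t y) (bosonA α t) (bosonC α t) := by
  rcases hσ with rfl | rfl
  · simpa using bosonOrbit hα ht
  · simpa using (bosonOrbit hα ht).neg

lemma eventually_bosonD_lt (hY : Y ∈ bosonDom α t₀) (hD : bosonA α t₀ Y * bosonC α t₀ Y ^ 2 < 1) :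
    ∀ᶠ t in 𝓝 t₀, bosonA α t Y * bosonC α t Y ^ 2 < 1 :=
  ((continuousAt_bosonA_param hY).mul ((continuousAt_bosonC_param hY).pow 2)).eventually_lt
    continuousAt_const hD

lemma hasPoints_of_eventually_le (hα : 0 < α) (hY : Y ∈ bosonDom α t₀) {m : ℕ}
    (hf : ∃ᶠ t in 𝓝 t₀, t < 1 ∧ HasPoints (bosonZeros α t) m)
    (he : ∀ᶠ t in 𝓝 t₀, t < 1 → ∀ y ∈ bosonZeros α t, y ≤ Y) :
    HasPoints (bosonZeros α t₀) m :=
  hasPoints_of_frequently hα hY ((hf.and_eventually he).mono fun _ h =>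
    ⟨h.1.1, h.1.2.mono fun y hy => ⟨hy, h.2 h.1.1 y hy⟩⟩)

/-- No zeros of nearby orbits escape to infinity once the field and its momentum have the same
sign. -/
lemma eventually_le_of_gv_pos (hα : 0 < α) (ht : 0 < t₀) (hY : Y ∈ bosonDom α t₀) (hY0 : 0 < Y)
    (hD : bosonA α t₀ Y * bosonC α t₀ Y ^ 2 < 1) (hgv : 0 < bosonG α t₀ Y * bosonV α t₀ Y) :
    ∀ᶠ t in 𝓝 t₀, t < 1 → ∀ y ∈ bosonZeros α t, y ≤ Y := by
  filter_upwards [eventually_gt_nhds ht, eventually_mem_bosonDom hY, eventually_bosonD_lt hY hD,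
    continuousAt_const.eventually_lt ((continuousAt_bosonG_param hY).mul
      (continuousAt_bosonV_param hY)) hgv] with t ht0 htY htD htgv ht1 y hy
  by_contra! hlt
  have := (bosonOrbit hα ⟨ht0.le, ht1.le⟩).gv_pos_of_lt (by linarith) ht0
    (fun h => by linarith) ⟨htY, hY0⟩ ⟨hy.1, hy.2.1⟩ hlt htD htgv.le
  rw [hy.2.2, zero_mul] at this
  exact this.false

/-- No zeros of nearby orbits escape to infinity once the orbit has entered the trapping region. -/
lemma eventually_le_of_trap (hα : 0 < α) (ht : 0 < t₀) (hσ : σ = 1 ∨ σ = -1)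
    (hY : Y ∈ bosonDom α t₀) (hY0 : 0 < Y) (hD : bosonA α t₀ Y * bosonC α t₀ Y ^ 2 < 1)
    {V η r : ℝ} (hV : 0 < V) (hη : 0 < η) (hr : 0 < r) (hv : -V < σ * bosonV α t₀ Y)
    (hg : r + 2 * V / (Y * η) * √(bosonA α t₀ Y) < σ * bosonG α t₀ Y)
    (hl : 1 + η < t₀ * Y ^ 2 * r ^ 2) :
    ∀ᶠ t in 𝓝 t₀, t < 1 → ∀ y ∈ bosonZeros α t, y ≤ Y := by
  have hcg : ContinuousAt (fun t => r + 2 * V / (Y * η) * √(bosonA α t Y)) t₀ :=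
    continuousAt_const.add (continuousAt_const.mul (continuousAt_bosonA_param hY).sqrt)
  have hcl : ContinuousAt (fun t => t * Y ^ 2 * r ^ 2) t₀ := by fun_prop
  filter_upwards [eventually_gt_nhds ht, eventually_mem_bosonDom hY, eventually_bosonD_lt hY hD,
    continuousAt_const.eventually_lt (continuousAt_const.mul (continuousAt_bosonV_param hY)) hv,
    hcg.eventually_lt (continuousAt_const.mul (continuousAt_bosonG_param hY)) hg,
    continuousAt_const.eventually_lt hcl hl] with t ht0 htY htD htv htg htl ht1 y hy
  by_contra! hlt
  have := (bosonOrbit_sign hα ⟨ht0.le, ht1.le⟩ hσ).pos_of_trap (by linarith) (by linarith) ht0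
    ⟨htY, hY0⟩ htD hV hη hr htv htg htl.le ⟨hy.1, hy.2.1⟩ hlt.le
  rw [hy.2.2, mul_zero] at this
  exact this.false

/-- If `A C ^ 2 < 1` at `Y`, at most one zero of a nearby orbit lies beyond `Y`. -/
lemma hasPoints_of_bosonD_lt (hα : 0 < α) (ht : 0 < t₀) (hY : Y ∈ bosonDom α t₀) (hY0 : 0 < Y)
    (hD : bosonA α t₀ Y * bosonC α t₀ Y ^ 2 < 1) {n : ℕ}
    (hf : ∃ᶠ t in 𝓝 t₀, t < 1 ∧ HasPoints (bosonZeros α t) (n + 1)) :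
    HasPoints (bosonZeros α t₀) n := by
  refine hasPoints_of_frequently hα hY ((hf.and_eventually ((eventually_gt_nhds ht).and
    ((eventually_mem_bosonDom hY).and (eventually_bosonD_lt hY hD)))).mono ?_)
  rintro t ⟨⟨ht1, z, hz, hzW⟩, ht0, htY, htD⟩
  have h := bosonOrbit hα ⟨ht0.le, ht1.le⟩
  refine ⟨ht1, fun i => z i.castSucc, fun i j hij => hz (Fin.castSucc_lt_castSucc_iff.2 hij),
    fun i => ⟨hzW _, ?_⟩⟩
  by_contra hlt
  have hlt : Y < z i.castSucc := not_le.1 hlt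
  have h1 := hzW i.castSucc
  have h2 := hzW (Fin.last n)
  have := h.gv_pos_of_lt (by linarith) ht0 (fun h => by linarith) ⟨h1.1, h1.2.1⟩ ⟨h2.1, h2.2.1⟩
    (hz (Fin.castSucc_lt_last i)) (h.D_lt_one_of_le (by linarith) ht0 ⟨htY, hY0⟩ ⟨h1.1, h1.2.1⟩
      hlt.le htD) (by rw [h1.2.2, zero_mul])
  rw [h2.2.2, zero_mul] at this
  exact this.false

/-- There is a critical parameter at which the `(n + 1)`-st zero is lost. -/
lemma exists_critical (hα : 1 < α) (n : ℕ) : ∃ t : ℝ, 0 < t ∧ t ≤ 1 ∧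
    ¬HasPoints (bosonZeros α t) (n + 1) ∧
    ∃ᶠ s in 𝓝 t, s < 1 ∧ HasPoints (bosonZeros α s) (n + 1) := by
  have hα0 : 0 < α := by linarith
  set T := {t : ℝ | t ∈ Icc 0 1 ∧ HasPoints (bosonZeros α t) (n + 1)} with hT
  have hT0 : (0 : ℝ) ∈ T := ⟨⟨le_rfl, zero_le_one⟩, hasPoints_bosonZeros_param_zero hα _⟩
  have hbdd : BddAbove T := ⟨1, fun t ht => ht.1.2⟩
  have hlt : ∀ t ∈ T, t < 1 := fun t ht => ht.1.2.lt_of_ne fun h1 =>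
    not_hasPoints_bosonZeros_one hα0 (h1 ▸ ht.2)
  have hopen : ∀ t ∈ T, ∃ s ∈ T, t < s := fun t ht => by
    have h1 := ((eventually_hasPoints hα0 (hlt t ht) ht.2).filter_mono
      nhdsWithin_le_nhds).and (Ioo_mem_nhdsGT (hlt t ht))
    obtain ⟨s, hs, hs'⟩ := h1.exists
    exact ⟨s, ⟨⟨ht.1.1.trans hs'.1.le, hs'.2.le⟩, hs⟩, hs'.1⟩
  have hpos : 0 < sSup T := by
    obtain ⟨s, hs, hs0⟩ := hopen 0 hT0
    exact hs0.trans_le (le_csSup hbdd hs)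
  have hle : sSup T ≤ 1 := csSup_le ⟨0, hT0⟩ fun t ht => ht.1.2
  refine ⟨sSup T, hpos, hle, fun h => ?_, ?_⟩
  · obtain ⟨s, hs, hs'⟩ := hopen _ ⟨⟨hpos.le, hle⟩, h⟩
    exact (le_csSup hbdd hs).not_gt hs'
  · exact (mem_closure_iff_frequently.1 (csSup_mem_closure ⟨0, hT0⟩ hbdd)).mono fun t ht =>
      ⟨hlt t ht, ht.2⟩

/-- At a critical parameter the region `A C ^ 2 < 1` is reached. -/
lemma exists_bosonD_lt (hα : 0 < α) (ht : 0 < t) (ht1 : t ≤ 1) {m : ℕ}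
    (hm : ¬HasPoints (bosonZeros α t) m) :
    ∃ y ∈ bosonDom α t ∩ Ioi 0, bosonA α t y * bosonC α t y ^ 2 < 1 := by
  by_contra! hcon
  have htI : t ∈ Icc (0 : ℝ) 1 := ⟨ht.le, ht1⟩
  rcases bosonDom_eq_Ici_or hα htI with hd | ⟨X, hX, hd, hA⟩
  · have hS : bosonDom α t ∩ Ioi 0 = Ioi 0 := by
      rw [hd]; exact inter_eq_right.2 Ioi_subset_Ici_self
    obtain ⟨b, hb⟩ := (finite_of_not_hasPoints hm).bddAbove
    have hb1 : 0 < max b 0 + 1 := by positivity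
    have hsub : ∀ y ∈ Ici (max b 0 + 1), y ∈ bosonDom α t ∩ Ioi 0 := fun y hy => by
      rw [hS]; exact hb1.trans_le hy
    obtain ⟨σ, hσ, hσ'⟩ := exists_sign (ordConnected_Ici (a := max b 0 + 1)) (f := bosonG α t)
      (fun y hy => (hasDerivAt_bosonG (hsub y hy).1 (hsub y hy).2).continuousAt.continuousWithinAt)
      fun y hy h0 => by
        have h1 : y ≤ b := hb ⟨(hsub y hy).1, (hsub y hy).2, h0⟩
        have h2 : max b 0 + 1 ≤ y := hy
        linarith [le_max_left b 0]
    exact (bosonOrbit_sign hα htI hσ).false_of_one_le_D_of_pos (by linarith) ht hS hcon hb1 hσ'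
  · have hS : bosonDom α t ∩ Ioi 0 = Ioo 0 X := by
      rw [hd]; ext y; simp only [mem_inter_iff, mem_Ico, mem_Ioi, mem_Ioo]; grind
    exact (bosonOrbit hα htI).false_of_one_le_D_of_tendsto_zero (by linarith) (by linarith) ht hX hS
      hA hcon

/-- A critical orbit is globally regular. -/
theorem exists_regular_orbit (hα : 1 < α) (n : ℕ) : ∃ t : ℝ, 0 < t ∧ t < 1 ∧
    bosonDom α t = Ici 0 ∧ HasPoints (bosonZeros α t) n ∧ ¬HasPoints (bosonZeros α t) (n + 1) ∧
    ∃ m > 0, Tendsto (fun y => y * (1 - bosonA α t y)) atTop (𝓝 m) := by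
  have hα0 : 0 < α := by linarith
  obtain ⟨t, ht, ht1, hn, hf⟩ := exists_critical hα n
  have htI : t ∈ Icc (0 : ℝ) 1 := ⟨ht.le, ht1⟩
  have hε : 0 ≤ 1 - t := by linarith
  obtain ⟨y₀, hy₀, hD⟩ := exists_bosonD_lt hα0 ht ht1 hn
  have h := bosonOrbit hα0 htI
  have hDy : ∀ y ∈ bosonDom α t ∩ Ioi 0, y₀ ≤ y → bosonA α t y * bosonC α t y ^ 2 < 1 :=
    fun y hy hle => h.D_lt_one_of_le hε ht hy₀ hy hle hD
  have hgv : ∀ y ∈ bosonDom α t ∩ Ioi 0, y₀ ≤ y → bosonG α t y * bosonV α t y < 0 := by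
    intro y hy hle
    by_contra! hcon
    obtain ⟨Y, hY, hyY⟩ := exists_gt_mem_bosonDom hy.1
    have hY0 : 0 < Y := lt_trans hy.2 hyY
    have h1 := h.gv_pos_of_lt hε ht (fun he z hz => by
      obtain rfl : t = 1 := by linarith
      rw [bosonG_one hα0 hz.1]
      exact one_ne_zero) hy ⟨hY, hY0⟩ hyY (hDy y hy hle) hcon
    exact hn (hasPoints_of_eventually_le hα0 hY hf (eventually_le_of_gv_pos hα0 ht hY hY0
      (hDy Y ⟨hY, hY0⟩ (hle.trans hyY.le)) h1))
  obtain ⟨σ, hσ, hσ'⟩ := exists_sign (ordConnected_bosonDom.inter ordConnected_Ici)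
    (s := bosonDom α t ∩ Ioi 0 ∩ Ici y₀) (f := bosonG α t)
    (fun y hy => (h.hasDerivAt_g y hy.1).continuousAt.continuousWithinAt)
    fun y hy h0 => by
      have := hgv y hy.1 hy.2
      rw [h0, zero_mul] at this
      exact this.false
  have hg : ∀ y ∈ bosonDom α t ∩ Ioi 0, y₀ ≤ y → 0 < σ * bosonG α t y :=
    fun y hy hle => hσ' y ⟨hy, hle⟩
  have hσ2 : σ * σ = 1 := by rcases hσ with rfl | rfl <;> norm_num
  have hv : ∀ y ∈ bosonDom α t ∩ Ioi 0, y₀ ≤ y → σ * bosonV α t y < 0 := fun y hy hle => by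
    have h1 : σ * bosonG α t y * (σ * bosonV α t y) < 0 := by
      rw [mul_mul_mul_comm, hσ2, one_mul]
      exact hgv y hy hle
    exact (pos_iff_neg_of_mul_neg h1).1 (hg y hy hle)
  have hs := bosonOrbit_sign hα0 htI hσ
  rcases bosonDom_eq_Ici_or hα0 htI with hd | ⟨X, hX, hd, hA⟩
  · have hS : bosonDom α t ∩ Ioi 0 = Ioi 0 := by
      rw [hd]; exact inter_eq_right.2 Ioi_subset_Ici_self
    obtain ⟨hε0, hm⟩ := hs.tendsto_mass hε ht hα0 hS hy₀ hD hg hv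
    exact ⟨t, ht, by linarith, hd, hasPoints_of_bosonD_lt hα0 ht hy₀.1 hy₀.2 hD hf, hn, hm⟩
  · have hS : bosonDom α t ∩ Ioi 0 = Ioo 0 X := by
      rw [hd]; ext y; simp only [mem_inter_iff, mem_Ico, mem_Ioi, mem_Ioo]; grind
    obtain ⟨V, hV, η, hη, r, hr, y, hy, hDy, hvy, hgy, hl⟩ :=
      hs.exists_trap hε ht hX hS hA hy₀ hD hg hv
    exact absurd (hasPoints_of_eventually_le hα0 hy.1 hf (eventually_le_of_trap hα0 ht hσ hy.1 hy.2
      hDy hV hη hr hvy hgy hl)) hn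

end

section

variable {α t a b x : ℝ}

lemma hasDerivAt_comp_mul_left {f : ℝ → ℝ} {f' : ℝ} (h : HasDerivAt f f' (b * x)) :
    HasDerivAt (fun z => f (b * z)) (b * f') x := by
  have hb : HasDerivAt (fun z => b * z) b x := by simpa using (hasDerivAt_id x).const_mul b
  exact (h.comp x hb).congr_deriv (mul_comm _ _)

/-- Rescaled orbits solve the mini-boson-star system. -/
lemma miniBosonSystem_rescale (hd : bosonDom α t = Ici 0) (hb : 0 < b)
    (hbt : b ^ 2 * (1 - t) = 1) (hab : a ^ 2 = t * b ^ 2) :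
    MiniBosonSystem (fun x => a * bosonG α t (b * x)) (fun x => bosonA α t (b * x))
      (fun x => bosonC α t (b * x)) (Ioi 0) := by
  have hdom : ∀ {x : ℝ}, 0 < x → b * x ∈ bosonDom α t := fun hx => by
    rw [hd]; exact (mul_pos hb hx).le
  have hf : ∀ x : ℝ, 0 < x → HasDerivAt (fun x => a * bosonG α t (b * x))
      (a / b * (bosonV α t (b * x) * bosonC α t (b * x) / (b * x) ^ 2)) x := fun x hx => by
    refine ((hasDerivAt_comp_mul_left
      (hasDerivAt_bosonG (hdom hx) (mul_pos hb hx))).const_mul a).congr_deriv ?_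
    field_simp
    linear_combination (a * bosonV α t (b * x) * bosonC α t (b * x)) * hbt
  intro x (hx : 0 < x)
  have hy := mul_pos hb hx
  have hA := hasDerivAt_comp_mul_left (hasDerivAt_bosonA (hdom hx) hy)
  have hC := hasDerivAt_comp_mul_left (hasDerivAt_bosonC (hdom hx) hy)
  have hV := hasDerivAt_comp_mul_left (hasDerivAt_bosonV (hdom hx) hy)
  have hA0 := bosonA_pos (hdom hx)
  have hC0 := bosonC_pos (hdom hx)
  have hdf : deriv (fun x => a * bosonG α t (b * x)) =ᶠ[𝓝 x]
      fun x => a / b * (bosonV α t (b * x) * bosonC α t (b * x) / (b * x) ^ 2) := by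
    filter_upwards [eventually_gt_nhds hx] with z hz using (hf z hz).deriv
  refine ⟨hx, hA0, hC0, (hf x hx).differentiableAt, ?_, hA.differentiableAt, hC.differentiableAt,
    ?_, ?_, ?_⟩
  · refine DifferentiableAt.congr_of_eventuallyEq ?_ hdf
    refine ((hV.differentiableAt.mul hC.differentiableAt).div (by fun_prop) ?_).const_mul _
    positivity
  · have hmom : (fun z => z ^ 2 * deriv (fun x => a * bosonG α t (b * x)) z / bosonC α t (b * z))
        =ᶠ[𝓝 x] fun z => a / b ^ 3 * bosonV α t (b * z) := by
      filter_upwards [hdf, eventually_gt_nhds hx] with z hz hz0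
      have : 0 < bosonC α t (z * b) := by rw [mul_comm]; exact bosonC_pos (hdom hz0)
      rw [hz, mul_comm b z]
      field_simp
    rw [hmom.deriv_eq, (hV.const_mul _).deriv]
    field_simp
  · rw [hA.deriv, (hf x hx).deriv]
    simp only [mul_pow, div_pow, hab]
    field_simp
    linear_combination (-(t * bosonA α t (b * x) * bosonV α t (b * x) ^ 2 * bosonC α t (b * x) ^ 2)) * hbt
  · rw [hC.deriv]
    simp only [mul_pow, hab]
    field_simp

end

/-- For every real `α > 1` and every nonnegative integer `n`, there exist
`a > 0` and an `a`-orbit defined for all `x ≥ 0` which is globally regular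
(the mass function has a finite positive limit at infinity) and whose scalar
field `f` has exactly `n` zeros in `(0, ∞)`. -/
theorem mini_boson_stars_exist (α : ℝ) (hα : 1 < α) (n : ℕ) :
    ∃ a > (0 : ℝ), ∃ f A C : ℝ → ℝ,
      IsAOrbit f A C a α (Set.Ici 0) ∧
      (∃ Minf > (0 : ℝ), Filter.Tendsto (massFn A) Filter.atTop (nhds Minf)) ∧
      {x : ℝ | 0 < x ∧ f x = 0}.Finite ∧
      {x : ℝ | 0 < x ∧ f x = 0}.ncard = n := by
  have hα0 : 0 < α := by linarith
  obtain ⟨t, ht, ht1, hd, hn, hn', m, hm, hlim⟩ := exists_regular_orbit hα n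
  have hε : 0 < 1 - t := by linarith
  set b := 1 / √(1 - t) with hb
  have hb0 : 0 < b := by positivity
  have hbt : b ^ 2 * (1 - t) = 1 := by
    rw [hb, div_pow, sq_sqrt hε.le, one_pow, one_div, inv_mul_cancel₀ hε.ne']
  set a := √t * b with ha
  have ha0 : 0 < a := by positivity
  have hab : a ^ 2 = t * b ^ 2 := by rw [ha, mul_pow, sq_sqrt ht.le]
  have hmaps : MapsTo (fun x => b * x) (Ici 0) (Ici 0) := fun x hx =>
    mul_nonneg hb0.le hx
  have hcw : ∀ {f : ℝ → ℝ}, ContinuousOn f (Icc 0 1) →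
      ContinuousWithinAt (fun x => f (b * x)) (Ici 0) 0 := fun {f} hf => by
    have h1 : ContinuousWithinAt f (Ici 0) (b * 0) := by
      rw [mul_zero]
      exact (hf 0 ⟨le_rfl, zero_le_one⟩).mono_of_mem_nhdsWithin (Icc_mem_nhdsGE zero_lt_one)
    exact h1.comp (continuous_const_mul b).continuousWithinAt hmaps
  have h1d : (1 : ℝ) ∈ bosonDom α t := by rw [hd]; exact zero_le_one' ℝ
  have hzero : (fun x => b * x) '' {x | 0 < x ∧ a * bosonG α t (b * x) = 0} = bosonZeros α t := by
    ext y
    constructor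
    · rintro ⟨x, ⟨hx, hx0⟩, rfl⟩
      have := mul_pos hb0 hx
      exact ⟨by rw [hd]; exact this.le, this, (mul_eq_zero.1 hx0).resolve_left ha0.ne'⟩
    · rintro ⟨-, hy, hy0⟩
      have : b * (y / b) = y := mul_div_cancel₀ _ hb0.ne'
      exact ⟨y / b, ⟨by positivity, by rw [this, hy0, mul_zero]⟩, this⟩
  have hinj : Function.Injective fun x => b * x := mul_right_injective₀ hb0.ne'
  refine ⟨a, ha0, fun x => a * bosonG α t (b * x), fun x => bosonA α t (b * x),
    fun x => bosonC α t (b * x), ⟨Or.inl rfl, ?_, (hcw (continuousOn_bosonG h1d)).const_mul a,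
      hcw (continuousOn_bosonA h1d), hcw (continuousOn_bosonC h1d), ?_, ?_, ?_, ?_⟩,
    ⟨m / (2 * b), by positivity, ?_⟩, ?_, ?_⟩
  · rw [Ici_sdiff_left]
    exact miniBosonSystem_rescale hd hb0 hbt hab
  · have h1 : HasDerivWithinAt (bosonG α t) 0 (Ici 0) (b * 0) := by
      rw [mul_zero]
      exact hasDerivWithinAt_bosonG_zero hα0
    have h2 := (h1.comp 0 ((hasDerivWithinAt_id 0 (Ici 0)).const_mul b) hmaps).const_mul a
    simpa using h2
  · simp [bosonG_zero hα0]
  · simp [bosonA_zero]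
  · simp [bosonC_zero hα0]
  · have h1 := (hlim.comp (tendsto_id.const_mul_atTop hb0)).div_const (2 * b)
    refine h1.congr fun x => ?_
    simp only [massFn, Function.comp, id]
    field_simp
  · apply Set.Finite.of_finite_image _ hinj.injOn
    rw [hzero]
    exact finite_of_not_hasPoints hn'
  · rw [← Set.ncard_image_of_injective _ hinj, hzero]
    exact ncard_eq_of_hasPoints hn hn'
end
end

section
/- Let (f, A, C) be an a-orbit of the mini-boson-star system with parameters a > 0, α > 0, defined on [0, x̄). If f is not identically zero, then A(x) < 1 for all x in (0, x̄). -/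
open Real Set Filter Topology MeasureTheory

noncomputable section

/-- If an `a`-orbit has `f` not identically zero, then `A x < 1` for all
`x > 0` in the domain. -/
theorem A_lt_one (f A C : ℝ → ℝ) (a α : ℝ) (s : Set ℝ)
    (ha : 0 < a) (hα : 0 < α) (horbit : IsAOrbit f A C a α s)
    (hne : ∃ x ∈ s, f x ≠ 0) :
    ∀ x ∈ s, 0 < x → A x < 1 := by
  intro x hxs hx
  obtain ⟨hs, hsys, hf0, hA0, -, -, hfa, hA1, -⟩ := horbit
  have hsub : Icc 0 x ⊆ s := by
    rcases hs with rfl | ⟨b, -, rfl⟩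
    · exact fun y hy => hy.1
    · exact fun y hy => ⟨hy.1, hy.2.trans_lt hxs.2⟩
  have hode : ∀ y ∈ Ioc 0 x, _ := fun y hy =>
    hsys y ⟨hsub (Ioc_subset_Icc_self hy), ne_of_gt hy.1⟩
  -- The function `y (1 - A y)` has nonnegative derivative, positive where `f ≠ 0`.
  have hder : ∀ y ∈ Ioc 0 x, HasDerivAt (fun y => y * (1 - A y))
      (y ^ 2 * (A y * deriv f y ^ 2 + A y * C y ^ 2 * f y ^ 2 + f y ^ 2)) y := by
    intro y hy
    obtain ⟨hy0, -, -, -, -, hAd, -, -, hA', -⟩ := hode y hy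
    have h := (hasDerivAt_id y).mul (hAd.hasDerivAt.const_sub 1)
    rw [hA'] at h
    refine h.congr_deriv ?_
    simp only [id]
    field_simp
    ring
  have hcont : ContinuousOn (fun y => y * (1 - A y)) (Icc 0 x) := by
    intro y hy
    rcases hy.1.eq_or_lt with rfl | hy0
    · exact continuousWithinAt_id.mul (continuousWithinAt_const.sub (hA0.mono hsub))
    · exact (hder y ⟨hy0, hy.2⟩).continuousAt.continuousWithinAt
  have hmono : MonotoneOn (fun y => y * (1 - A y)) (Icc 0 x) := by
    refine monotoneOn_of_deriv_nonneg (convex_Icc 0 x) hcont ?_ ?_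
    · rw [interior_Icc]
      exact fun y hy => (hder y ⟨hy.1, hy.2.le⟩).differentiableAt.differentiableWithinAt
    · rw [interior_Icc]
      intro y hy
      rw [(hder y ⟨hy.1, hy.2.le⟩).deriv]
      have hAy := (hode y ⟨hy.1, hy.2.le⟩).2.1
      positivity
  by_contra! hle
  have hzero : ∀ y ∈ Icc 0 x, y * (1 - A y) = 0 := by
    intro y hy
    have h0 := hmono (left_mem_Icc.2 hx.le) hy hy.1
    have h1 := hmono hy (right_mem_Icc.2 hx.le) hy.2
    simp only [zero_mul] at h0 h1
    nlinarith
  obtain ⟨y, hy, hfy⟩ : ∃ y ∈ Ioo 0 x, f y ≠ 0 := by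
    have hlim : Tendsto f (𝓝[>] 0) (𝓝 a) := by
      rw [← hfa, ← nhdsWithin_Ioo_eq_nhdsGT hx]
      exact hf0.mono (Ioo_subset_Icc_self.trans hsub)
    have hIoo : ∀ᶠ y in 𝓝[>] (0 : ℝ), y ∈ Ioo 0 x := Ioo_mem_nhdsGT hx
    exact (hIoo.and (hlim.eventually_ne ha.ne')).exists
  have hev : (fun y => y * (1 - A y)) =ᶠ[𝓝 y] fun _ => 0 := by
    filter_upwards [Ioo_mem_nhds hy.1 hy.2] with z hz
    exact hzero z (Ioo_subset_Icc_self hz)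
  have hy' : y ∈ Ioc 0 x := ⟨hy.1, hy.2.le⟩
  have heq := (hder y hy').unique ((hasDerivAt_const y (0 : ℝ)).congr_of_eventuallyEq hev)
  have hy0 := hy.1
  have hAy := (hode y hy').2.1
  have hpos : 0 < y ^ 2 *
      (A y * deriv f y ^ 2 + A y * C y ^ 2 * f y ^ 2 + f y ^ 2) := by positivity
  exact hpos.ne' heq
end
end
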